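/- arXiv:1405.2942 — 2 statements merged into one kernel-verified Lean document; each statement's English description precedes it below -/
import Mathlib

section
/- For any random countable conformal iterated function system S and any (θ×σ)-invariant probability measure μ on Λ×E^∞ with marginal m on Λ, the random projectional entropy is bounded above by the measure-theoretic entropy: h_μ(S) ≤ h(μ), where h(μ) is the Kolmogorov–Sinai entropy of μ with respect to θ×σ. -/
open MeasureTheory Filter Set Metric Function Topology
open scoped ENNReal NNReal

noncomputable section

namespace RIFS

/-- Euclidean space `ℝ^q`. -/
abbrev Pt (q : ℕ) := EuclideanSpace ℝ (Fin q)

/-- The one-sided shift on `E^∞`. -/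
def shift {E : Type*} (ω : ℕ → E) : ℕ → E := fun n => ω (n + 1)

/-- The cylinder `[e] = {ω : ω₁ = e}`. -/
def cyl {E : Type*} (e : E) : Set (ℕ → E) := {ω | ω 0 = e}

/-- `B_H(ω, r) = H⁻¹(B(H(ω), r))`. -/
def BH {E β : Type*} [PseudoMetricSpace β] (H : (ℕ → E) → β) (ω : ℕ → E) (r : ℝ) :
    Set (ℕ → E) := H ⁻¹' Metric.ball (H ω) r

/-- The randomized composition `φ_{ω|_n}^λ = φ_{ω₁}^λ ∘ φ_{ω₂}^{θλ} ∘ ⋯ ∘ φ_{ω_n}^{θ^{n-1}λ}`. -/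
def word {Λ E β : Type*} (θ : Λ → Λ) (φ : E → Λ → β → β) :
    Λ → (ℕ → E) → ℕ → β → β
  | _, _, 0 => id
  | l, ω, n + 1 => φ (ω 0) l ∘ word θ φ (θ l) (shift ω) n

/-- The coding map `π_λ(ω) = ⋂_n φ_{ω|_n}^λ(X)`, realized as the limit of
`φ_{ω|_n}^λ(x₀)` for a base point `x₀ ∈ X`. -/
def proj {Λ E β : Type*} [TopologicalSpace β] [Nonempty β]
    (θ : Λ → Λ) (φ : E → Λ → β → β) (x₀ : β) (l : Λ) (ω : ℕ → E) : β :=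
  limUnder atTop fun n => word θ φ l ω n x₀

section Entropy

variable {Λ E β : Type*} [MeasurableSpace Λ] [MeasurableSpace E] [MeasurableSpace β]

/-- The σ-algebra generated by the partition `π_Λ^{-1}(ε_Λ)`. -/
def algL : MeasurableSpace (Λ × (ℕ → E)) := MeasurableSpace.comap Prod.fst inferInstance

/-- The σ-algebra generated by `π_Λ^{-1}(ε_Λ) ∨ π_{ℝ^q}^{-1}(ε_{ℝ^q})`. -/
def algLpi (π : Λ → (ℕ → E) → β) : MeasurableSpace (Λ × (ℕ → E)) :=
  MeasurableSpace.comap (fun p => (p.1, π p.1 p.2)) inferInstance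

/-- The σ-algebra generated by `π_Λ^{-1}(ε_Λ) ∨ (θ×σ)^{-1}(π_{ℝ^q}^{-1}(ε_{ℝ^q}))`. -/
def algLpiT (θ : Λ → Λ) (π : Λ → (ℕ → E) → β) : MeasurableSpace (Λ × (ℕ → E)) :=
  MeasurableSpace.comap (fun p => (p.1, π (θ p.1) (shift p.2))) inferInstance

/-- The information function of the cylinder partition `π_{E^∞}^{-1}(ξ)` with
respect to a sub-σ-algebra `𝔪`. -/
def condInfoCyl (μ : Measure (Λ × (ℕ → E))) (𝔪 : MeasurableSpace (Λ × (ℕ → E))) :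
    Λ × (ℕ → E) → ℝ := fun p =>
  - Real.log ((μ[Set.indicator (Prod.snd ⁻¹' cyl (p.2 0)) (fun _ => (1 : ℝ)) | 𝔪]) p)

/-- Conditional entropy `H_μ(π_{E^∞}^{-1}(ξ) | 𝔪)`. -/
def condEntCyl (μ : Measure (Λ × (ℕ → E))) (𝔪 : MeasurableSpace (Λ × (ℕ → E))) : ℝ :=
  ∫ p, condInfoCyl μ 𝔪 p ∂μ

/-- The random projectional entropy `h_μ(S)`. -/
def projEnt (θ : Λ → Λ) (π : Λ → (ℕ → E) → β) (μ : Measure (Λ × (ℕ → E))) : ℝ :=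
  condEntCyl μ (algLpiT θ π) - condEntCyl μ (algLpi π)

/-- The Lyapunov exponent `χ_μ = -∫ log |(φ_{ω₁}^λ)'(π_{θλ}(σω))| dμ`. -/
def lyap (θ : Λ → Λ) (π : Λ → (ℕ → E) → β) (D : E → Λ → β → ℝ)
    (μ : Measure (Λ × (ℕ → E))) : ℝ :=
  - ∫ p, Real.log (D (p.2 0) p.1 (π (θ p.1) (shift p.2))) ∂μ

/-- `(μ_λ)_λ` is the Rokhlin disintegration of `μ` over the marginal `m`. -/
structure IsDisint (m : Measure Λ) (μ : Measure (Λ × (ℕ → E)))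
    (μd : Λ → Measure (ℕ → E)) : Prop where
  prob : ∀ l, IsProbabilityMeasure (μd l)
  meas : ∀ A : Set (ℕ → E), MeasurableSet A → Measurable fun l => μd l A
  eq : ∀ A : Set (Λ × (ℕ → E)), MeasurableSet A →
    μ A = ∫⁻ l, μd l {ω | (l, ω) ∈ A} ∂m

end Entropy

section KS

variable {α : Type*} [MeasurableSpace α]

/-- A countable measurable partition (indexed by `ℕ`, atoms may be empty). -/
structure IsPartition (P : ℕ → Set α) : Prop where
  meas : ∀ n, MeasurableSet (P n)
  disj : Pairwise (Function.onFun Disjoint P)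
  cover : (⋃ n, P n) = Set.univ

/-- Static entropy of a countable partition. -/
def partEnt (μ : Measure α) (P : ℕ → Set α) : ℝ≥0∞ :=
  ∑' n, ENNReal.ofReal (Real.negMulLog (μ (P n)).toReal)

/-- The atom `⋂_{i<n} T^{-i} P_{k i}` of the dynamical refinement `⋁_{i<n} T^{-i}P`. -/
def refinePart (T : α → α) (P : ℕ → Set α) (n : ℕ) (k : Fin n → ℕ) : Set α :=
  ⋂ i : Fin n, (T^[(i : ℕ)]) ⁻¹' P (k i)

/-- Dynamical entropy `h(μ, T, P) = lim (1/n) H(⋁_{i<n} T^{-i}P)`. -/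
def dynEnt (μ : Measure α) (T : α → α) (P : ℕ → Set α) : ℝ≥0∞ :=
  ⨅ n : ℕ, (∑' k : Fin (n + 1) → ℕ,
    ENNReal.ofReal (Real.negMulLog (μ (refinePart T P (n + 1) k)).toReal)) / (n + 1 : ℝ≥0∞)

/-- Kolmogorov–Sinai entropy `h(μ) = sup_P h(μ, T, P)` over countable measurable
partitions of finite static entropy. -/
def ksEnt (μ : Measure α) (T : α → α) : ℝ≥0∞ :=
  ⨆ (P : ℕ → Set α) (_ : IsPartition P) (_ : partEnt μ P ≠ ⊤), dynEnt μ T P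

end KS

end RIFS

/-- A random countable conformal iterated function system on a compact set
`X ⊆ W ⊆ ℝ^q`, with countable alphabet `E` and parameter space `(Λ, m, θ)`. -/
structure RandomCIFS (q : ℕ) (E : Type*) (Λ : Type*) [MeasurableSpace Λ] where
  m : Measure Λ
  m_prob : IsProbabilityMeasure m
  θ : Λ → Λ
  θ_meas : Measurable θ
  θ_bij : Function.Bijective θ
  θ_mp : MeasurePreserving θ m m
  θ_erg : Ergodic θ m
  X : Set (RIFS.Pt q)
  W : Set (RIFS.Pt q)
  X_cpt : IsCompact X
  X_conn : IsConnected X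
  X_reg : X = closure (interior X)
  W_open : IsOpen W
  W_bdd : Bornology.IsBounded W
  W_conn : IsConnected W
  X_sub_W : X ⊆ W
  s : ℝ
  s_mem : s ∈ Set.Ioo (0 : ℝ) 1
  φ : E → Λ → RIFS.Pt q → RIFS.Pt q
  φ_meas : ∀ e, Measurable fun p : Λ × RIFS.Pt q => φ e p.1 p.2
  φ_inj : ∀ e l, Set.InjOn (φ e l) W
  φ_mapsX : ∀ e l, Set.MapsTo (φ e l) X X
  φ_mapsW : ∀ e l, Set.MapsTo (φ e l) W W
  φ_lip : ∀ e l, LipschitzOnWith s.toNNReal (φ e l) X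
  /-- the conformal derivative modulus `|(φ_e^λ)'(x)|` -/
  D : E → Λ → RIFS.Pt q → ℝ
  φ_conf : ∀ e l x, x ∈ W → ∃ A : RIFS.Pt q →ₗᵢ[ℝ] RIFS.Pt q,
    HasFDerivAt (φ e l) (D e l x • A.toContinuousLinearMap) x
  /-- Bounded Distortion Property -/
  bdp : ∃ K : ℝ → ℝ, K 0 = 1 ∧ Tendsto K (nhdsWithin 0 (Set.Ioi 0)) (nhds 1) ∧
    (∀ t ∈ Set.Ico (0 : ℝ) 1, 1 ≤ K t) ∧
    ∀ t ∈ Set.Ico (0 : ℝ) 1, ∀ e l x y, x ∈ X →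
      ‖y - x‖ ≤ t * Metric.infDist x Wᶜ → D e l y ≤ K t * D e l x

namespace RandomCIFS

variable {q : ℕ} {E Λ : Type*} [MeasurableSpace Λ]

/-- A base point of `X`. -/
def x0 (S : RandomCIFS q E Λ) : RIFS.Pt q := S.X_conn.nonempty.some

/-- The coding maps `π_λ : E^∞ → ℝ^q`. -/
def projMap (S : RandomCIFS q E Λ) : Λ → (ℕ → E) → RIFS.Pt q :=
  RIFS.proj S.θ S.φ S.x0

/-- The limit set `J_λ = π_λ(E^∞)`. -/
def J (S : RandomCIFS q E Λ) (l : Λ) : Set (RIFS.Pt q) := Set.range (S.projMap l)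

/-- The skew product `θ × σ`. -/
def Tmap (S : RandomCIFS q E Λ) : Λ × (ℕ → E) → Λ × (ℕ → E) :=
  fun p => (S.θ p.1, RIFS.shift p.2)

/-- `|(φ_{ω|_n}^λ)'(π_{θ^n λ}(σ^n ω))|`, computed via the chain rule. -/
def Dword (S : RandomCIFS q E Λ) (l : Λ) (ω : ℕ → E) (n : ℕ) : ℝ :=
  ∏ j ∈ Finset.range n,
    S.D (ω j) (S.θ^[j] l) (S.projMap (S.θ^[j + 1] l) (RIFS.shift^[j + 1] ω))

end RandomCIFS

open RIFS

namespace EntAux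

set_option linter.unusedSectionVars false

variable {Ω : Type*} {G G' N : MeasurableSpace Ω} {m0 : MeasurableSpace Ω}

/-- conditional probability of `s` given `G`. -/
def cpr (μ : Measure Ω) (G : MeasurableSpace Ω) (s : Set Ω) : Ω → ℝ :=
  μ[s.indicator (fun _ => (1 : ℝ)) | G]

/-- conditional probability of the atom of `X` containing the point. -/
def pI {κ : Type*} (μ : Measure Ω) (X : Ω → κ) (G : MeasurableSpace Ω) (x : Ω) : ℝ :=
  cpr μ G (X ⁻¹' {X x}) x

/-- conditional entropy of a countable valued map. -/
def ent {κ : Type*} (μ : Measure Ω) (X : Ω → κ) (G : MeasurableSpace Ω) : ℝ≥0∞ :=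
  ∫⁻ x, ENNReal.ofReal (- Real.log (pI μ X G x)) ∂μ

variable {μ : Measure Ω} [IsProbabilityMeasure μ]

lemma int_ind {s : Set Ω} (hs : MeasurableSet s) :
    Integrable (s.indicator (fun _ => (1 : ℝ))) μ :=
  (integrable_const _).indicator hs

lemma cpr_meas (s : Set Ω) : Measurable[G] (cpr μ G s) :=
  (stronglyMeasurable_condExp).measurable

lemma cpr_meas0 (hG : G ≤ m0) (s : Set Ω) : Measurable (cpr μ G s) :=
  (cpr_meas s).mono hG le_rfl

lemma cpr_mono {s t : Set Ω} (hs : MeasurableSet s) (ht : MeasurableSet t) (h : s ⊆ t) :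
    cpr μ G s ≤ᵐ[μ] cpr μ G t := by
  apply condExp_mono (int_ind hs) (int_ind ht)
  exact Eventually.of_forall (Set.indicator_le_indicator_of_subset h (fun _ => zero_le_one))

lemma cpr_nonneg (s : Set Ω) : ∀ᵐ x ∂μ, 0 ≤ cpr μ G s x := by
  apply condExp_nonneg
  exact Eventually.of_forall (fun x => Set.indicator_nonneg (fun _ _ => zero_le_one) x)

lemma cpr_le_one (hG : G ≤ m0) {s : Set Ω} (hs : MeasurableSet s) :
    ∀ᵐ x ∂μ, cpr μ G s x ≤ 1 := by
  have h := cpr_mono (μ := μ) (G := G) hs MeasurableSet.univ (subset_univ s)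
  have h2 : cpr μ G univ = fun _ => 1 := by
    unfold cpr; rw [Set.indicator_univ, condExp_const hG]
  rw [h2] at h; exact h

lemma cpr_setIntegral (hG : G ≤ m0) {s t : Set Ω} (hs : MeasurableSet s) (ht : MeasurableSet[G] t) :
    ∫ x in t, cpr μ G s x ∂μ = μ.real (t ∩ s) := by
  unfold cpr
  rw [setIntegral_condExp hG (int_ind hs) ht, setIntegral_indicator hs]
  simp

lemma cpr_setLIntegral (hG : G ≤ m0) {s t : Set Ω} (hs : MeasurableSet s)
    (ht : MeasurableSet[G] t) :
    ∫⁻ x in t, ENNReal.ofReal (cpr μ G s x) ∂μ = μ (t ∩ s) := by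
  rw [← ofReal_integral_eq_lintegral_ofReal, cpr_setIntegral hG hs ht]
  · simp [measureReal_def]
  · exact integrable_condExp.integrableOn
  · exact ae_restrict_of_ae (cpr_nonneg s)

lemma pull (hG : G ≤ m0) {s : Set Ω} (hs : MeasurableSet s) {f : Ω → ℝ≥0∞}
    (hf : Measurable[G] f) :
    ∫⁻ x in s, f x ∂μ = ∫⁻ x, f x * ENNReal.ofReal (cpr μ G s x) ∂μ := by
  have hc : Measurable (fun x => ENNReal.ofReal (cpr μ G s x)) :=
    (cpr_meas0 hG s).ennreal_ofReal
  refine Measurable.ennreal_induction (mα := G)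
    (motive := fun f => ∫⁻ x in s, f x ∂μ = ∫⁻ x, f x * ENNReal.ofReal (cpr μ G s x) ∂μ)
    ?_ ?_ ?_ hf
  · intro c t ht
    have ht0 := hG _ ht
    rw [lintegral_indicator ht0]
    have : (fun x => t.indicator (fun _ => c) x * ENNReal.ofReal (cpr μ G s x))
        = t.indicator (fun x => c * ENNReal.ofReal (cpr μ G s x)) := by
      ext x; by_cases hx : x ∈ t <;> simp [hx]
    rw [this, lintegral_indicator ht0, lintegral_const_mul _ hc, cpr_setLIntegral hG hs ht]
    simp [Measure.restrict_apply, ht0]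
  · intro f g _ hf hg h1 h2
    have hf0 : Measurable f := hf.mono hG le_rfl
    simp only [Pi.add_apply, add_mul]
    have hfc : Measurable (fun x => f x * ENNReal.ofReal (cpr μ G s x)) := hf0.mul hc
    rw [lintegral_add_left hf0, lintegral_add_left hfc, h1, h2]
  · intro f hf hm h
    have hf0 : ∀ n, Measurable (f n) := fun n => (hf n).mono hG le_rfl
    simp only [ENNReal.iSup_mul]
    have hfc : ∀ n, Measurable (fun x => f n x * ENNReal.ofReal (cpr μ G s x)) :=
      fun n => (hf0 n).mul hc
    rw [lintegral_iSup hf0 hm, lintegral_iSup hfc]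
    · simp [h]
    · intro a b hab x
      exact mul_le_mul_left (hm hab x) _

lemma cpr_pos (hG : G ≤ m0) {s : Set Ω} (hs : MeasurableSet s) :
    ∀ᵐ x ∂μ, x ∈ s → 0 < cpr μ G s x := by
  have ht : MeasurableSet[G] {x | cpr μ G s x ≤ 0} :=
    (cpr_meas (G := G) (μ := μ) s) measurableSet_Iic
  have h := cpr_setLIntegral (μ := μ) hG hs ht
  have h0 : ∫⁻ x in {x | cpr μ G s x ≤ 0}, ENNReal.ofReal (cpr μ G s x) ∂μ = 0 := by
    rw [setLIntegral_congr_fun (g := fun _ => 0) (hG _ ht)]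
    · simp
    · intro x hx; simpa using hx
  rw [h0] at h
  have := measure_eq_zero_iff_ae_notMem.1 h.symm
  filter_upwards [this] with x hx hxs
  by_contra hc
  exact hx ⟨not_lt.1 hc, hxs⟩

section X
variable {κ : Type*} [Countable κ] [MeasurableSpace κ] [MeasurableSingletonClass κ]

lemma pI_meas (hG : G ≤ m0) {X : Ω → κ} (hX : Measurable X) : Measurable (pI μ X G) := by
  have h : Measurable (fun p : κ × Ω => cpr μ G (X ⁻¹' {p.1}) p.2) :=
    measurable_from_prod_countable_right (fun k => cpr_meas0 hG (X ⁻¹' {k}))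
  exact h.comp (hX.prodMk measurable_id)

lemma pI_pos (hG : G ≤ m0) {X : Ω → κ} (hX : Measurable X) : ∀ᵐ x ∂μ, 0 < pI μ X G x := by
  have : ∀ᵐ x ∂μ, ∀ k, x ∈ X ⁻¹' {k} → 0 < cpr μ G (X ⁻¹' {k}) x :=
    ae_all_iff.2 fun k => cpr_pos hG (hX (measurableSet_singleton k))
  filter_upwards [this] with x hx using hx _ rfl

lemma pI_le_one (hG : G ≤ m0) {X : Ω → κ} (hX : Measurable X) : ∀ᵐ x ∂μ, pI μ X G x ≤ 1 := by
  have : ∀ᵐ x ∂μ, ∀ k, cpr μ G (X ⁻¹' {k}) x ≤ 1 :=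
    ae_all_iff.2 fun k => cpr_le_one hG (hX (measurableSet_singleton k))
  filter_upwards [this] with x hx using hx _

lemma lint_part {X : Ω → κ} (hX : Measurable X) (F : κ → Ω → ℝ≥0∞) :
    ∫⁻ x, F (X x) x ∂μ = ∑' k, ∫⁻ x in X ⁻¹' {k}, F k x ∂μ := by
  have hU : (⋃ k, X ⁻¹' {k}) = univ := by ext x; simp
  rw [← setLIntegral_univ, ← hU, lintegral_iUnion (fun k => hX (measurableSet_singleton k))]
  · congr 1; ext k
    apply setLIntegral_congr_fun (hX (measurableSet_singleton k))
    intro x hx; simp at hx; simp [hx]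
  · intro a b hab
    rw [Function.onFun, Set.disjoint_left]
    intro x hx hx'
    simp at hx hx'; exact hab (hx.symm.trans hx')

lemma ent_eq_tsum (hG : G ≤ m0) {X : Ω → κ} (hX : Measurable X) :
    ent μ X G = ∑' k, ∫⁻ x, ENNReal.ofReal (Real.negMulLog (cpr μ G (X ⁻¹' {k}) x)) ∂μ := by
  unfold ent pI
  rw [lint_part hX (fun k x => ENNReal.ofReal (-Real.log (cpr μ G (X ⁻¹' {k}) x)))]
  congr 1; ext k
  rw [pull hG (hX (measurableSet_singleton k))
    (f := fun x => ENNReal.ofReal (-Real.log (cpr μ G (X ⁻¹' {k}) x)))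
    (((cpr_meas (μ := μ) (G := G) _).log.neg).ennreal_ofReal)]
  apply lintegral_congr_ae
  filter_upwards [cpr_nonneg (μ := μ) (G := G) (X ⁻¹' {k})] with x hx
  rw [← ENNReal.ofReal_mul' hx, Real.negMulLog]
  ring_nf

lemma ent_anti (hG : G ≤ m0) (hGG : G' ≤ G) {X : Ω → κ}
    (hX : Measurable X) : ent μ X G ≤ ent μ X G' := by
  have hG' := hGG.trans hG
  have hp := pI_meas (μ := μ) hG hX
  have hq := pI_meas (μ := μ) hG' hX
  have key : ent μ X G + 1 ≤ ent μ X G' + 1 := by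
    have h1 : ∫⁻ x, ENNReal.ofReal (pI μ X G' x / pI μ X G x) ∂μ ≤ 1 := by
      unfold pI
      rw [lint_part hX (fun k x => ENNReal.ofReal
        (cpr μ G' (X ⁻¹' {k}) x / cpr μ G (X ⁻¹' {k}) x))]
      calc _ ≤ ∑' k, μ (X ⁻¹' {k}) := by
            apply ENNReal.tsum_le_tsum
            intro k
            have hk := hX (measurableSet_singleton k)
            rw [pull hG hk (f := fun x => ENNReal.ofReal
              (cpr μ G' (X ⁻¹' {k}) x / cpr μ G (X ⁻¹' {k}) x)) ((((cpr_meas (μ := μ) (G := G') _).mono hGG le_rfl).div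
              (cpr_meas (μ := μ) (G := G) _)).ennreal_ofReal)]
            have := cpr_setLIntegral (μ := μ) hG' hk MeasurableSet.univ
            rw [univ_inter, setLIntegral_univ] at this
            rw [← this]
            apply lintegral_mono_ae
            filter_upwards [cpr_nonneg (μ := μ) (G := G) (X ⁻¹' {k}),
              cpr_nonneg (μ := μ) (G := G') (X ⁻¹' {k})] with x hx hx'
            rw [← ENNReal.ofReal_mul' hx]
            apply ENNReal.ofReal_le_ofReal
            by_cases h0 : cpr μ G (X ⁻¹' {k}) x = 0
            · rw [h0, mul_zero]; exact hx'
            · rw [div_mul_cancel₀ _ h0]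
        _ = 1 := by
            have := lint_part (μ := μ) hX (fun _ _ => 1)
            simpa using this.symm
    calc ent μ X G + 1 = ∫⁻ x, (ENNReal.ofReal (- Real.log (pI μ X G x)) + 1) ∂μ := by
          rw [lintegral_add_right _ measurable_const]; simp [ent]
      _ ≤ ∫⁻ x, (ENNReal.ofReal (- Real.log (pI μ X G' x)) +
            ENNReal.ofReal (pI μ X G' x / pI μ X G x)) ∂μ := by
          apply lintegral_mono_ae
          filter_upwards [pI_pos (μ := μ) hG hX, pI_pos (μ := μ) hG' hX,
            pI_le_one (μ := μ) hG hX, pI_le_one (μ := μ) hG' hX] with x a b c d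
          have e1 : 0 ≤ - Real.log (pI μ X G x) := neg_nonneg.2 (Real.log_nonpos a.le c)
          have e2 : 0 ≤ - Real.log (pI μ X G' x) := neg_nonneg.2 (Real.log_nonpos b.le d)
          rw [← ENNReal.ofReal_one, ← ENNReal.ofReal_add e1 zero_le_one,
            ← ENNReal.ofReal_add e2 (div_pos b a).le]
          apply ENNReal.ofReal_le_ofReal
          have := Real.log_le_sub_one_of_pos (div_pos b a)
          rw [Real.log_div b.ne' a.ne'] at this
          linarith
      _ = ent μ X G' + ∫⁻ x, ENNReal.ofReal (pI μ X G' x / pI μ X G x) ∂μ := by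
          have hme : Measurable (fun x => ENNReal.ofReal (- Real.log (pI μ X G' x))) :=
            hq.log.neg.ennreal_ofReal
          rw [lintegral_add_left hme]; rfl
      _ ≤ _ := by gcongr
  exact (ENNReal.add_le_add_iff_right ENNReal.one_ne_top).1 key

lemma ent_comp_le {κ' : Type*} [Countable κ'] [MeasurableSpace κ'] [MeasurableSingletonClass κ']
    (hG : G ≤ m0) {X : Ω → κ} (hX : Measurable X) {Y : Ω → κ'} (hY : Measurable Y)
    (f : κ' → κ) (h : ∀ x, X x = f (Y x)) : ent μ X G ≤ ent μ Y G := by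
  apply lintegral_mono_ae
  have h1 : ∀ᵐ x ∂μ, ∀ k l, Y ⁻¹' {l} ⊆ X ⁻¹' {k} →
      cpr μ G (Y ⁻¹' {l}) x ≤ cpr μ G (X ⁻¹' {k}) x := by
    rw [ae_all_iff]; intro k
    rw [ae_all_iff]; intro l
    by_cases hkl : Y ⁻¹' {l} ⊆ X ⁻¹' {k}
    · filter_upwards [cpr_mono (μ := μ) (G := G) (hY (measurableSet_singleton l))
        (hX (measurableSet_singleton k)) hkl] with x hx _ using hx
    · exact Eventually.of_forall (fun x hx => absurd hx hkl)
  filter_upwards [h1, pI_pos (μ := μ) hG hY] with x hx hp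
  apply ENNReal.ofReal_le_ofReal
  apply neg_le_neg
  apply Real.log_le_log hp
  apply hx
  intro y hy
  simp only [mem_preimage, mem_singleton_iff] at hy ⊢
  rw [h, h, hy]

lemma ent_eq_zero (hG : G ≤ m0) {X : Ω → κ} (hX : Measurable[G] X) : ent μ X G = 0 := by
  unfold ent
  rw [lintegral_eq_zero_iff' ]
  · have : ∀ x, pI μ X G x = 1 := by
      intro x
      unfold pI cpr
      have hs : MeasurableSet[G] (X ⁻¹' {X x}) := hX (measurableSet_singleton _)
      rw [condExp_of_stronglyMeasurable hG (stronglyMeasurable_const.indicator hs)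
        (int_ind (hG _ hs))]
      simp
    simp [this]; rfl
  · exact (pI_meas hG (hX.mono hG le_rfl)).log.neg.ennreal_ofReal.aemeasurable

lemma ent_comp_T {T : Ω → Ω} (hT : MeasurePreserving T μ μ) (hG : G ≤ m0) {X : Ω → κ}
    (hX : Measurable X) : ent μ (X ∘ T) (G.comap T) = ent μ X G := by
  have hGT : G.comap T ≤ m0 := by
    rintro s ⟨t, ht, rfl⟩; exact hT.measurable (hG _ ht)
  have h1 : ∀ s, MeasurableSet s → cpr μ (G.comap T) (T ⁻¹' s) =ᵐ[μ] cpr μ G s ∘ T := by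
    intro s hs
    symm
    have hIntg : Integrable (cpr μ G s ∘ T) μ :=
      hT.integrable_comp_of_integrable integrable_condExp
    apply ae_eq_condExp_of_forall_setIntegral_eq hGT (int_ind (hT.measurable hs))
    · intro t _ _; exact hIntg.integrableOn
    · rintro t ⟨u, hu, rfl⟩ _
      have e := cpr_setIntegral (μ := μ) hG hs hu
      rw [setIntegral_indicator (hT.measurable hs)]
      have e2 : ∫ x in T ⁻¹' u, (cpr μ G s ∘ T) x ∂μ = ∫ x in u, cpr μ G s x ∂μ := by
        have e3 := setIntegral_map (μ := μ) (f := cpr μ G s) (hG _ hu)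
          (by rw [hT.map_eq]; exact integrable_condExp.aestronglyMeasurable)
          hT.measurable.aemeasurable
        rw [hT.map_eq] at e3
        exact e3.symm
      rw [e2, e, ← preimage_inter]
      simp only [integral_const, smul_eq_mul, mul_one, measureReal_def, Measure.restrict_apply,
        MeasurableSet.univ, univ_inter]
      rw [hT.measure_preimage ((hG _ hu).inter hs).nullMeasurableSet]
    · apply StronglyMeasurable.aestronglyMeasurable
      apply Measurable.stronglyMeasurable
      exact (cpr_meas s).comp (comap_measurable (m := G) T)
  have h2 : ∀ᵐ x ∂μ, ∀ k, cpr μ (G.comap T) (T ⁻¹' (X ⁻¹' {k})) x = cpr μ G (X ⁻¹' {k}) (T x) :=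
    ae_all_iff.2 fun k => h1 _ (hX (measurableSet_singleton k))
  have hm : Measurable (fun x => ENNReal.ofReal (- Real.log (pI μ X G x))) :=
    (pI_meas hG hX).log.neg.ennreal_ofReal
  unfold ent
  rw [← hT.lintegral_comp hm]
  apply lintegral_congr_ae
  filter_upwards [h2] with x hx
  have : pI μ (X ∘ T) (G.comap T) x = pI μ X G (T x) := hx (X (T x))
  rw [this]

lemma cpr_chain {κ' : Type*} [MeasurableSpace κ'] [MeasurableSingletonClass κ']
    (hG : G ≤ m0) {X : Ω → κ'} (hX : Measurable X) (k : κ') {s : Set Ω} (hs : MeasurableSet s)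
    (hN : N = MeasurableSpace.comap X inferInstance ⊔ G) :
    ∀ᵐ x ∂μ, X x = k →
      cpr μ G (X ⁻¹' {k} ∩ s) x
        = cpr μ G (X ⁻¹' {k}) x * cpr μ N s x := by
  have hXk : MeasurableSet (X ⁻¹' {k}) := hX (measurableSet_singleton k)
  have hNm : N ≤ m0 := hN ▸ sup_le hX.comap_le hG
  have hGN : G ≤ N := hN ▸ le_sup_right
  have hXN : MeasurableSet[N] (X ⁻¹' {k}) :=
    (hN ▸ le_sup_left : MeasurableSpace.comap X inferInstance ≤ N) _ ⟨{k}, measurableSet_singleton k, rfl⟩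
  set p := cpr μ G (X ⁻¹' {k}) with hp
  set r := cpr μ G (X ⁻¹' {k} ∩ s) with hr
  have hrp : r ≤ᵐ[μ] p := cpr_mono (hXk.inter hs) hXk inter_subset_left
  have hr0 := cpr_nonneg (μ := μ) (G := G) (X ⁻¹' {k} ∩ s)
  have hp0 := cpr_nonneg (μ := μ) (G := G) (X ⁻¹' {k})
  have hq_meas : Measurable[G] (fun x => r x / p x) := (cpr_meas _).div (cpr_meas _)
  have hq0 : ∀ᵐ x ∂μ, 0 ≤ r x / p x := by
    filter_upwards [hr0, hp0] with x a b using div_nonneg a b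
  have hq1 : ∀ᵐ x ∂μ, r x / p x ≤ 1 := by
    filter_upwards [hp0, hrp] with x b c using div_le_one_of_le₀ c b
  have hqint : Integrable (fun x => r x / p x) μ := by
    refine Integrable.of_bound (hq_meas.mono hG le_rfl).aestronglyMeasurable 1 ?_
    filter_upwards [hq0, hq1] with x a b
    rw [Real.norm_of_nonneg a]; exact b
  have hcand : (X ⁻¹' {k}).indicator (fun x => r x / p x) =ᵐ[μ]
      μ[(X ⁻¹' {k}).indicator (s.indicator (fun _ => (1:ℝ))) | N] := by
    apply ae_eq_condExp_of_forall_setIntegral_eq hNm ((int_ind hs).indicator hXk)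
    · intro t _ _; exact (hqint.indicator hXk).integrableOn
    · intro t ht _
      obtain ⟨t', ht', htt⟩ : ∃ t', MeasurableSet[G] t' ∧ t ∩ X ⁻¹' {k} = t' ∩ X ⁻¹' {k} := by
        have hc : N.comap (Subtype.val : (X ⁻¹' {k}) → Ω) = G.comap Subtype.val := by
          rw [hN, MeasurableSpace.comap_sup, MeasurableSpace.comap_comp]
          have : (X ∘ (Subtype.val : (X ⁻¹' {k}) → Ω)) = fun _ => k := by
            ext ⟨x, hx⟩; exact hx
          rw [this, MeasurableSpace.comap_const, bot_sup_eq]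
        have : MeasurableSet[N.comap (Subtype.val : (X ⁻¹' {k}) → Ω)] (Subtype.val ⁻¹' t) :=
          ⟨t, ht, rfl⟩
        rw [hc] at this
        obtain ⟨t', ht', h⟩ := this
        refine ⟨t', ht', ?_⟩
        ext x
        constructor
        · rintro ⟨a, b⟩
          have : (⟨x, b⟩ : X ⁻¹' {k}) ∈ (Subtype.val ⁻¹' t' : Set (X ⁻¹' {k})) := by rw [h]; exact a
          exact ⟨this, b⟩
        · rintro ⟨a, b⟩
          have : (⟨x, b⟩ : X ⁻¹' {k}) ∈ (Subtype.val ⁻¹' t : Set (X ⁻¹' {k})) := by rw [← h]; exact a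
          exact ⟨this, b⟩
      have ht'0 := hG _ ht'
      rw [setIntegral_indicator hXk, setIntegral_indicator hXk, htt]
      rw [setIntegral_indicator hs, integral_const, smul_eq_mul, mul_one]
      rw [measureReal_restrict_apply_univ, inter_assoc]
      rw [integral_eq_lintegral_of_nonneg_ae (ae_restrict_of_ae hq0)
        hqint.aestronglyMeasurable.restrict]
      rw [measureReal_def, ← cpr_setLIntegral hG (hXk.inter hs) ht']
      congr 1
      have hf : Measurable[G] (t'.indicator (fun x => ENNReal.ofReal (r x / p x))) :=
        (hq_meas.ennreal_ofReal).indicator ht'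
      have e := pull (μ := μ) hG hXk hf
      rw [setLIntegral_indicator ht'0] at e
      rw [e, ← lintegral_indicator ht'0]
      apply lintegral_congr_ae
      filter_upwards [hr0, hp0, hrp] with x a b c
      by_cases hx : x ∈ t'
      · rw [indicator_of_mem hx, indicator_of_mem hx]
        change ENNReal.ofReal (r x / p x) * ENNReal.ofReal (p x) = ENNReal.ofReal (r x)
        rw [← ENNReal.ofReal_mul' b]
        by_cases h0 : p x = 0
        · have : r x = 0 := le_antisymm (h0 ▸ c) a
          simp [this]
        · rw [div_mul_cancel₀ _ h0]
      · simp [hx]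
    · apply StronglyMeasurable.aestronglyMeasurable
      apply Measurable.stronglyMeasurable
      exact (hq_meas.mono hGN le_rfl).indicator hXN
  have hci := condExp_indicator (μ := μ) (m := N) (int_ind (μ := μ) hs) hXN
  have := hcand.trans hci
  filter_upwards [this, hr0, hp0, hrp] with x hx a b c hxk
  have hxk' : x ∈ X ⁻¹' {k} := hxk
  rw [indicator_of_mem hxk', indicator_of_mem hxk'] at hx
  change r x = p x * (μ[s.indicator (fun _ => (1:ℝ)) | N]) x
  rw [← hx]
  by_cases h0 : p x = 0
  · rw [h0, zero_mul]; exact le_antisymm (h0 ▸ c) a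
  · field_simp

lemma ent_chain {κ' : Type*} [Countable κ'] [MeasurableSpace κ'] [MeasurableSingletonClass κ']
    (hG : G ≤ m0) {X : Ω → κ'} (hX : Measurable X) {Y : Ω → κ} (hY : Measurable Y) :
    ent μ (fun x => (X x, Y x)) G
      = ent μ X G + ent μ Y (MeasurableSpace.comap X inferInstance ⊔ G) := by
  have hN : MeasurableSpace.comap X inferInstance ⊔ G ≤ m0 := sup_le hX.comap_le hG
  unfold ent
  have hme : Measurable (fun x => ENNReal.ofReal (- Real.log (pI μ X G x))) :=
    (pI_meas hG hX).log.neg.ennreal_ofReal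
  rw [← lintegral_add_left hme]
  apply lintegral_congr_ae
  have h1 : ∀ᵐ x ∂μ, ∀ k l, X x = k →
      cpr μ G (X ⁻¹' {k} ∩ Y ⁻¹' {l}) x
        = cpr μ G (X ⁻¹' {k}) x * cpr μ (MeasurableSpace.comap X inferInstance ⊔ G) (Y ⁻¹' {l}) x := by
    rw [ae_all_iff]; intro k
    rw [ae_all_iff]; intro l
    exact cpr_chain hG hX k (hY (measurableSet_singleton l)) rfl
  filter_upwards [h1, pI_pos (μ := μ) hG hX, pI_pos (μ := μ) hN hY,
            pI_le_one (μ := μ) hG hX, pI_le_one (μ := μ) hN hY] with x hx a b c d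
  have e1 : 0 ≤ - Real.log (pI μ X G x) := neg_nonneg.2 (Real.log_nonpos a.le c)
  have e2 : 0 ≤ - Real.log (pI μ Y _ x) := neg_nonneg.2 (Real.log_nonpos b.le d)
  rw [← ENNReal.ofReal_add e1 e2]
  have : pI μ (fun x => (X x, Y x)) G x = pI μ X G x *
      pI μ Y (MeasurableSpace.comap X inferInstance ⊔ G) x := by
    have := hx (X x) (Y x) rfl
    unfold pI
    rw [← this]
    congr 1
    ext y; simp [Prod.ext_iff]
  rw [this, Real.log_mul a.ne' b.ne']
  ring_nf

end X
end EntAux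

namespace EntAux

set_option linter.unusedSectionVars false

variable {Ω : Type*} {G G' N M : MeasurableSpace Ω} {m0 : MeasurableSpace Ω}
variable {μ : Measure Ω} [IsProbabilityMeasure μ]

/-- the σ-algebra generated by a map to `ℕ`. -/
abbrev sg (X : Ω → ℕ) : MeasurableSpace Ω := MeasurableSpace.comap X inferInstance

/-- bounded measurable -/
def BM (M : MeasurableSpace Ω) (X : Ω → ℕ) : Prop := Measurable[M] X ∧ ∃ B, ∀ x, X x ≤ B

/-- pairing -/
def join (X Y : Ω → ℕ) : Ω → ℕ := fun x => Nat.pair (X x) (Y x)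

lemma BM.mono {X : Ω → ℕ} (h : BM M X) (hMN : M ≤ N) : BM N X := ⟨h.1.mono hMN le_rfl, h.2⟩

lemma BM.sg_le {X : Ω → ℕ} (h : BM M X) : sg X ≤ M := by
  rintro s ⟨t, ht, rfl⟩; exact h.1 ht

lemma BM.self {X : Ω → ℕ} (h : BM M X) : BM (sg X) X := ⟨comap_measurable X, h.2⟩

lemma BM.join {X Y : Ω → ℕ} (hX : BM M X) (hY : BM M Y) : BM M (join X Y) := by
  refine ⟨(measurable_from_prod_countable_right (fun _ => measurable_from_top) :
    Measurable (fun p : ℕ × ℕ => Nat.pair p.1 p.2)).comp (hX.1.prodMk hY.1), ?_⟩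
  obtain ⟨B, hB⟩ := hX.2
  obtain ⟨C, hC⟩ := hY.2
  refine ⟨(max B C + 1)^2, fun x => (Nat.pair_lt_max_add_one_sq _ _).le.trans ?_⟩
  gcongr
  · exact hB x
  · exact hC x

lemma sg_join_left (X Y : Ω → ℕ) : sg X ≤ sg (join X Y) := by
  rintro s ⟨t, ht, rfl⟩
  refine ⟨(fun n => n.unpair.1) ⁻¹' t, trivial, ?_⟩
  ext x; simp [join]

lemma sg_join_right (X Y : Ω → ℕ) : sg Y ≤ sg (join X Y) := by
  rintro s ⟨t, ht, rfl⟩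
  refine ⟨(fun n => n.unpair.2) ⁻¹' t, trivial, ?_⟩
  ext x; simp [join]

lemma ent_join (hG : G ≤ m0) {X Y : Ω → ℕ} (hX : Measurable X) (hY : Measurable Y) :
    ent μ (join X Y) G = ent μ X G + ent μ Y (sg X ⊔ G) := by
  rw [← ent_chain hG hX hY]
  have hJ : Measurable (join X Y) :=
    (measurable_from_prod_countable_right (fun _ => measurable_from_top) :
    Measurable (fun p : ℕ × ℕ => Nat.pair p.1 p.2)).comp (hX.prodMk hY)
  apply le_antisymm
  · exact ent_comp_le hG hJ (hX.prodMk hY) (fun p => Nat.pair p.1 p.2) (fun x => rfl)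
  · exact ent_comp_le hG (hX.prodMk hY) hJ (fun n => n.unpair) (fun x => by simp [join])

/-- conditional entropy of σ-algebras -/
def Hs (μ : Measure Ω) (M G : MeasurableSpace Ω) : ℝ≥0∞ :=
  ⨆ X : {X : Ω → ℕ // BM M X}, ent μ X.1 G

instance : Nonempty {X : Ω → ℕ // BM M X} := ⟨⟨fun _ => 0, measurable_const, 0, fun _ => le_rfl⟩⟩

lemma le_Hs {X : Ω → ℕ} (h : BM M X) : ent μ X G ≤ Hs μ M G :=
  le_iSup (fun X : {X : Ω → ℕ // BM M X} => ent μ X.1 G) ⟨X, h⟩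

lemma Hs_le {C : ℝ≥0∞} (h : ∀ X, BM M X → ent μ X G ≤ C) : Hs μ M G ≤ C :=
  iSup_le fun X => h X.1 X.2

lemma Hs_mono (h : M ≤ N) : Hs μ M G ≤ Hs μ N G := Hs_le fun _ hX => le_Hs (hX.mono h)

lemma Hs_anti (hM : M ≤ m0) (hG : G ≤ m0) (h : G' ≤ G) : Hs μ M G ≤ Hs μ M G' :=
  Hs_le fun _ hX => (ent_anti hG h (hX.mono hM).1).trans (le_Hs hX)

lemma Hs_zero (hG : G ≤ m0) (h : M ≤ G) : Hs μ M G = 0 :=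
  le_antisymm (Hs_le fun _ hX => (ent_eq_zero hG (hX.mono h).1).le) bot_le

lemma Hs_T {T : Ω → Ω} (hT : MeasurePreserving T μ μ) (hM : M ≤ m0) (hG : G ≤ m0) :
    Hs μ (M.comap T) (G.comap T) = Hs μ M G := by
  apply le_antisymm
  · apply Hs_le
    rintro X ⟨hX, B, hB⟩
    obtain ⟨Y, hY, hXY⟩ := Measurable.exists_eq_measurable_comp (mY := M) (f := T) hX
    have hBY : BM M (fun x => min (Y x) B) :=
      ⟨hY.min measurable_const, B, fun x => min_le_right _ _⟩
    have : X = (fun x => min (Y x) B) ∘ T := by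
      ext x
      have := hB x
      rw [hXY] at this ⊢
      simp at this ⊢
      exact this
    rw [this, ent_comp_T hT hG (hBY.mono hM).1]
    exact le_Hs hBY
  · apply Hs_le
    rintro X hX
    rw [← ent_comp_T hT hG (hX.mono hM).1]
    apply le_Hs
    obtain ⟨B, hB⟩ := hX.2
    exact ⟨hX.1.comp (comap_measurable T), B, fun x => hB _⟩

lemma negMulLog_bd {x : ℝ} (h0 : 0 ≤ x) : Real.negMulLog x ≤ 1 := by
  rcases h0.eq_or_lt with rfl | h
  · simp
  · have := Real.one_sub_inv_le_log_of_pos h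
    unfold Real.negMulLog
    have h2 : x * (1 - x⁻¹) ≤ x * Real.log x := by gcongr
    rw [mul_sub, mul_inv_cancel₀ h.ne'] at h2
    linarith

lemma ent_eq_sum (hG : G ≤ m0) {X : Ω → ℕ} (hX : Measurable X) {B : ℕ} (hB : ∀ x, X x ≤ B) :
    ent μ X G = ∑ k ∈ Finset.range (B+1),
      ∫⁻ x, ENNReal.ofReal (Real.negMulLog (cpr μ G (X ⁻¹' {k}) x)) ∂μ := by
  rw [ent_eq_tsum hG hX]
  apply tsum_eq_sum
  intro k hk
  have : X ⁻¹' {k} = ∅ := by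
    ext x
    simp at hk ⊢
    have := hB x
    omega
  rw [this]
  simp only [cpr, indicator_empty]
  have : (μ[(fun _ => (0:ℝ)) | G]) = 0 := condExp_zero
  rw [this]; simp

lemma ent_lt_top (hG : G ≤ m0) {X : Ω → ℕ} (hX : BM m0 X) : ent μ X G < ∞ := by
  obtain ⟨hXm, B, hB⟩ := hX
  rw [ent_eq_sum hG hXm hB]
  apply ENNReal.sum_lt_top.2
  intro k _
  calc _ ≤ ∫⁻ x, 1 ∂μ := by
        apply lintegral_mono_ae
        filter_upwards [cpr_nonneg (μ := μ) (G := G) (X ⁻¹' {k})] with x hx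
        rw [← ENNReal.ofReal_one]
        exact ENNReal.ofReal_le_ofReal (negMulLog_bd hx)
    _ < ∞ := by simp

lemma ctbl_gen {t : Set Ω} (ht : MeasurableSet[G ⊔ N] t) :
    ∃ C : Set (Set Ω), C.Countable ∧ (∀ s ∈ C, MeasurableSet[N] s) ∧
      MeasurableSet[G ⊔ MeasurableSpace.generateFrom C] t := by
  let K : MeasurableSpace Ω :=
    { MeasurableSet' := fun t => ∃ C : Set (Set Ω), C.Countable ∧ (∀ s ∈ C, MeasurableSet[N] s) ∧
        MeasurableSet[G ⊔ MeasurableSpace.generateFrom C] t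
      measurableSet_empty := ⟨∅, countable_empty, by simp, @MeasurableSet.empty _ (_)⟩
      measurableSet_compl := by
        rintro t ⟨C, h1, h2, h3⟩
        exact ⟨C, h1, h2, h3.compl⟩
      measurableSet_iUnion := by
        intro t h
        choose C h1 h2 h3 using h
        refine ⟨⋃ n, C n, countable_iUnion h1, ?_, ?_⟩
        · intro s hs
          obtain ⟨n, hn⟩ := mem_iUnion.1 hs
          exact h2 n s hn
        · refine @MeasurableSet.iUnion _ _ (_) _ _ fun n => ?_
          have : G ⊔ MeasurableSpace.generateFrom (C n)
              ≤ G ⊔ MeasurableSpace.generateFrom (⋃ n, C n) :=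
            sup_le_sup_left (MeasurableSpace.generateFrom_mono (subset_iUnion C n)) _
          exact this _ (h3 n) }
  have hG : G ≤ K := fun t h => ⟨∅, countable_empty, by simp, (le_sup_left : G ≤ _) _ h⟩
  have hN : N ≤ K := fun t h => ⟨{t}, countable_singleton t, by simpa using h,
    (le_sup_right : _ ≤ G ⊔ MeasurableSpace.generateFrom {t}) _
      (MeasurableSpace.measurableSet_generateFrom rfl)⟩
  exact sup_le hG hN _ ht

lemma ctbl_gen_fun {f : ℕ → Ω → ℝ} (hf : ∀ k, Measurable[G ⊔ N] (f k)) :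
    ∃ s : ℕ → Set Ω, (∀ j, MeasurableSet[N] (s j)) ∧
      ∀ k, Measurable[G ⊔ MeasurableSpace.generateFrom (range s)] (f k) := by
  choose C h1 h2 h3 using fun p : ℕ × ℚ => ctbl_gen (hf p.1 (measurableSet_Iio (a := (p.2 : ℝ))))
  have hc : (insert ∅ (⋃ p, C p)).Countable := (countable_iUnion h1).insert _
  obtain ⟨s, hs⟩ := hc.exists_eq_range (insert_nonempty _ _)
  refine ⟨s, ?_, ?_⟩
  · intro j
    have : s j ∈ insert ∅ (⋃ p, C p) := hs ▸ mem_range_self j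
    rcases this with h | h
    · rw [h]; exact @MeasurableSet.empty _ (_)
    · obtain ⟨n, hn⟩ := mem_iUnion.1 h
      exact h2 n _ hn
  · intro k
    rw [← hs, BorelSpace.measurable_eq (α := ℝ), Real.borel_eq_generateFrom_Iio_rat]
    refine @measurable_generateFrom _ _ (_) _ _ ?_
    intro t ht
    obtain ⟨a, rfl⟩ := by simpa using ht
    have : G ⊔ MeasurableSpace.generateFrom (C (k, a))
      ≤ G ⊔ MeasurableSpace.generateFrom (insert ∅ (⋃ p, C p)) :=
      sup_le_sup_left (MeasurableSpace.generateFrom_mono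
        ((subset_iUnion C (k,a)).trans (subset_insert _ _))) _
    exact this _ (h3 (k, a))

/-- finite coding of the first `n` sets. -/
def code (s : ℕ → Set Ω) (n : ℕ) : Ω → ℕ := fun x =>
  open Classical in ((Fintype.equivFin (Fin n → Bool)) (fun j => decide (x ∈ s j))).val

lemma code_BM {s : ℕ → Set Ω} (hs : ∀ j, MeasurableSet[N] (s j)) (n : ℕ) : BM N (code s n) := by
  classical
  refine ⟨?_, Fintype.card (Fin n → Bool), fun x => (Fin.is_lt _).le⟩
  have h1 : Measurable[N] (fun x => fun j : Fin n => decide (x ∈ s j)) := by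
    refine @measurable_pi_lambda _ _ _ (_) _ _ fun j => ?_
    refine @measurable_to_bool _ (_) _ ?_
    have : (fun x => decide (x ∈ s j)) ⁻¹' {true} = s j := by ext; simp
    rw [this]; exact hs j
  have h2 : Measurable (fun v : Fin n → Bool => ((Fintype.equivFin (Fin n → Bool)) v).val) :=
    measurable_of_countable _
  convert h2.comp h1 using 1
  ext x; simp only [code, comp_apply]

lemma code_mem {s : ℕ → Set Ω} {n j : ℕ} (h : j < n) : MeasurableSet[sg (code s n)] (s j) := by
  classical
  refine ⟨{k | ∃ v : Fin n → Bool, v ⟨j, h⟩ = true ∧ (Fintype.equivFin (Fin n → Bool) v).val = k},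
    trivial, ?_⟩
  ext x
  constructor
  · rintro ⟨v, hv, hk⟩
    have := (Fintype.equivFin (Fin n → Bool)).injective (Fin.ext hk)
    rw [this] at hv
    simpa using hv
  · intro hx
    exact ⟨_, by simpa using hx, rfl⟩

lemma code_mono (s : ℕ → Set Ω) {a b : ℕ} (h : a ≤ b) : sg (code s a) ≤ sg (code s b) :=
  (code_BM (N := sg (code s b)) (s := fun j => if j < b then s j else ∅) (fun j => by
    by_cases hj : j < b
    · simp only [hj, if_true]; exact code_mem hj
    · simp only [hj, if_false]; exact @MeasurableSet.empty _ (_)) a).sg_le.trans' (by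
    have : code (fun j => if j < b then s j else ∅) a = code s a := by
      ext x
      unfold code
      congr! 4 with j
      have : (j:ℕ) < b := j.2.trans_le h
      simp [this]
    rw [this])

/-- Approximation of a conditioning σ-algebra by finite partitions. -/
lemma lemP (hG : G ≤ m0) (hN : N ≤ m0) {X : Ω → ℕ} (hX : BM m0 X) {ε : ℝ≥0∞} (hε : ε ≠ 0) :
    ∃ Y, BM N Y ∧ ent μ X (G ⊔ sg Y) ≤ ent μ X (G ⊔ N) + ε := by
  have hGN : G ⊔ N ≤ m0 := sup_le hG hN
  obtain ⟨s, hs, hf⟩ := ctbl_gen_fun (G := G) (N := N)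
    (f := fun k => cpr μ (G ⊔ N) (X ⁻¹' {k})) (fun k => cpr_meas _)
  have hsg : ∀ n, sg (code s n) ≤ N := fun n => (code_BM hs n).sg_le
  let F : Filtration ℕ m0 :=
    { seq := fun n => G ⊔ sg (code s n)
      mono' := fun a b hab => sup_le_sup_left (code_mono s hab) _
      le' := fun n => sup_le hG ((hsg n).trans hN) }
  have hFN : (⨆ n, F n) ≤ G ⊔ N := iSup_le fun n => sup_le_sup_left (hsg n) _
  have hFs : G ⊔ MeasurableSpace.generateFrom (range s) ≤ ⨆ n, F n := by
    apply sup_le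
    · exact le_trans (le_sup_left : G ≤ F 0) (le_iSup (fun n => F n) 0)
    · apply MeasurableSpace.generateFrom_le
      rintro _ ⟨j, rfl⟩
      exact (le_iSup (fun n => F n) (j+1)) _ ((le_sup_right : sg (code s (j+1)) ≤ F (j+1)) _
        (code_mem (Nat.lt_succ_self j)))
  obtain ⟨hXm, B, hB⟩ := hX
  have hconv : ∀ k, ∀ᵐ x ∂μ, Tendsto (fun n => cpr μ (F n) (X ⁻¹' {k}) x) atTop
      (𝓝 (cpr μ (G ⊔ N) (X ⁻¹' {k}) x)) := by
    intro k
    have h1 := tendsto_ae_condExp (μ := μ) (ℱ := F) ((X ⁻¹' {k}).indicator (fun _ => (1:ℝ)))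
    have h2 : μ[μ[(X ⁻¹' {k}).indicator (fun _ => (1:ℝ)) | G ⊔ N] | ⨆ n, F n] =ᵐ[μ]
        μ[(X ⁻¹' {k}).indicator (fun _ => (1:ℝ)) | ⨆ n, F n] :=
      condExp_condExp_of_le hFN hGN
    have h3 : μ[μ[(X ⁻¹' {k}).indicator (fun _ => (1:ℝ)) | G ⊔ N] | ⨆ n, F n] =
        μ[(X ⁻¹' {k}).indicator (fun _ => (1:ℝ)) | G ⊔ N] :=
      condExp_of_stronglyMeasurable (hFN.trans hGN)
        ((hf k).mono hFs le_rfl).stronglyMeasurable integrable_condExp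
    rw [h3] at h2
    filter_upwards [h1, h2] with x a b
    unfold cpr
    rw [b]; exact a
  have hlim : Tendsto (fun n => ent μ X (F n)) atTop (𝓝 (ent μ X (G ⊔ N))) := by
    have e1 : ∀ n, ent μ X (F n) = _ := fun n => ent_eq_sum (F.le n) hXm hB
    simp only [e1]
    rw [ent_eq_sum hGN hXm hB]
    apply tendsto_finsetSum
    intro k _
    apply tendsto_lintegral_of_dominated_convergence (fun _ => 1)
    · intro n
      exact (Real.continuous_negMulLog.measurable.comp (cpr_meas0 (F.le n) _)).ennreal_ofReal
    · intro n
      filter_upwards [cpr_nonneg (μ := μ) (G := F n) (X ⁻¹' {k})] with x hx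
      rw [← ENNReal.ofReal_one]
      exact ENNReal.ofReal_le_ofReal (negMulLog_bd hx)
    · simp
    · filter_upwards [hconv k] with x hx
      exact ENNReal.tendsto_ofReal ((Real.continuous_negMulLog.tendsto _).comp hx)
  have hfin : ent μ X (G ⊔ N) < ∞ := ent_lt_top hGN ⟨hXm, B, hB⟩
  have hlt : ent μ X (G ⊔ N) < ent μ X (G ⊔ N) + ε := ENNReal.lt_add_right hfin.ne hε
  obtain ⟨n, hn⟩ := (hlim.eventually (gt_mem_nhds hlt)).exists
  exact ⟨code s n, code_BM hs n, hn.le⟩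

/-- chain rule -/
lemma Hs_chain (hM : M ≤ m0) (hN : N ≤ m0) (hG : G ≤ m0) :
    Hs μ (M ⊔ N) G = Hs μ N G + Hs μ M (N ⊔ G) := by
  have hNG : N ⊔ G ≤ m0 := sup_le hN hG
  apply le_antisymm
  · apply Hs_le
    intro Z hZ
    have hZ0 : BM m0 Z := hZ.mono (sup_le hM hN)
    refine ENNReal.le_of_forall_pos_le_add fun ε hε _ => ?_
    have hδ : (ε / 3 : ℝ≥0∞) ≠ 0 := by
      simp [hε.ne']
    obtain ⟨X, hX, h1⟩ := lemP (μ := μ) (sup_le hG hN) hM hZ0 hδ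
    have hX0 := hX.mono hM
    have hsX : sg X ≤ m0 := hX0.sg_le
    obtain ⟨Y, hY, h2⟩ := lemP (μ := μ) (sup_le hG hsX) hN hZ0 hδ
    obtain ⟨Y', hY', h3⟩ := lemP (μ := μ) hG hN hX0 hδ
    have hYY := hY.join hY'
    have hYY0 := hYY.mono hN
    have hsY : sg (join Y Y') ≤ m0 := hYY0.sg_le
    have e0 : ent μ Z (G ⊔ N ⊔ M) = 0 :=
      ent_eq_zero (sup_le (sup_le hG hN) hM) (hZ.mono (sup_le le_sup_right
        (le_sup_right.trans le_sup_left))).1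
    rw [e0, zero_add] at h1
    have e1 : ent μ Z (G ⊔ sg X ⊔ N) ≤ ε / 3 := by
      rw [sup_assoc, sup_comm (sg X), ← sup_assoc]; exact h1
    have e2 : ent μ Z G ≤ ent μ (join (join Y Y') (join X Z)) G :=
      ent_comp_le hG hZ0.1 (hYY0.join (hX0.join hZ0)).1 (fun n => n.unpair.2.unpair.2)
        (fun x => by simp [join])
    rw [ent_join hG hYY0.1 (hX0.join hZ0).1, ent_join (sup_le hsY hG) hX0.1 hZ0.1] at e2
    have e3 : ent μ X (sg (join Y Y') ⊔ G) ≤ ent μ X (G ⊔ N) + ε / 3 := by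
      refine le_trans (ent_anti (sup_le hsY hG) ?_ hX0.1) h3
      exact sup_le le_sup_right ((sg_join_right Y Y').trans le_sup_left)
    have e4 : ent μ Z (sg X ⊔ (sg (join Y Y') ⊔ G)) ≤ ε / 3 + ε / 3 := by
      refine le_trans (ent_anti (sup_le hsX (sup_le hsY hG)) ?_ hZ0.1) (h2.trans (by gcongr))
      exact sup_le (sup_le (le_sup_right.trans le_sup_right) le_sup_left)
        ((sg_join_left Y Y').trans (le_sup_left.trans le_sup_right))
    have e5 : ent μ (join Y Y') G ≤ Hs μ N G := le_Hs hYY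
    have e6 : ent μ X (G ⊔ N) ≤ Hs μ M (N ⊔ G) := by rw [sup_comm]; exact le_Hs hX
    calc ent μ Z G ≤ Hs μ N G + ((Hs μ M (N ⊔ G) + ε / 3) + (ε / 3 + ε / 3)) := by
          refine e2.trans ?_
          gcongr
          exact e3.trans (by gcongr)
      _ = Hs μ N G + Hs μ M (N ⊔ G) + ((ε / 3 + ε / 3) + ε / 3) := by ring
      _ = _ := by rw [ENNReal.add_thirds]
  · apply ENNReal.iSup_add_iSup_le
    rintro ⟨Y, hY⟩ ⟨X, hX⟩
    have hY0 := hY.mono hN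
    have hX0 := hX.mono hM
    calc ent μ Y G + ent μ X (N ⊔ G) ≤ ent μ Y G + ent μ X (sg Y ⊔ G) := by
          gcongr
          exact ent_anti hNG (sup_le_sup_right hY.sg_le _) hX0.1
      _ = ent μ (join Y X) G := (ent_join hG hY0.1 hX0.1).symm
      _ ≤ _ := le_Hs ((hY.mono le_sup_right).join (hX.mono le_sup_left))

lemma Hs_approx (hM : M ≤ m0) (hG : G ≤ m0) (hfin : Hs μ M G ≠ ∞) {ε : ℝ≥0∞} (hε : ε ≠ 0) :
    ∃ Z, BM M Z ∧ Hs μ M (sg Z ⊔ G) ≤ ε := by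
  by_cases h0 : Hs μ M G = 0
  · refine ⟨fun _ => 0, ⟨measurable_const, 0, fun _ => le_rfl⟩, ?_⟩
    have hh : BM m0 (fun _ : Ω => 0) := ⟨measurable_const, 0, fun _ => le_rfl⟩
    refine (Hs_anti hM (sup_le hh.sg_le hG) le_sup_right).trans ?_
    rw [h0]; exact bot_le
  obtain ⟨⟨Z, hZ⟩, h⟩ := lt_iSup_iff.1 (show Hs μ M G - ε < ⨆ X : {X : Ω → ℕ // BM M X}, ent μ X.1 G
    from ENNReal.sub_lt_self hfin h0 hε)
  refine ⟨Z, hZ, ?_⟩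
  have hc := Hs_chain (μ := μ) hM (hZ.sg_le.trans hM) hG
  rw [sup_eq_left.2 hZ.sg_le] at hc
  have h1 : ent μ Z G ≤ Hs μ (sg Z) G := le_Hs hZ.self
  have h2 : Hs μ M G ≤ Hs μ (sg Z) G + ε := by
    have := tsub_le_iff_right.1 (h.le.trans h1)
    exact this
  have h3 : Hs μ (sg Z) G ≠ ∞ := ((Hs_mono hZ.sg_le).trans_lt hfin.lt_top).ne
  rw [hc] at h2
  exact (ENNReal.add_le_add_iff_left h3).1 h2

lemma Hs_ent {E : Type*} [Countable E] [MeasurableSpace E] [MeasurableSingletonClass E]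
    (hG : G ≤ m0) {X : Ω → E} (hX : Measurable X) :
    Hs μ (MeasurableSpace.comap X inferInstance) G = ent μ X G := by
  apply le_antisymm
  · apply Hs_le
    intro Y hY
    obtain ⟨f, -, hf⟩ := Measurable.exists_eq_measurable_comp (f := X) hY.1
    exact ent_comp_le hG (hY.mono hX.comap_le).1 hX f (fun x => congrFun hf x)
  · obtain ⟨enc, henc⟩ := Countable.exists_injective_nat E
    let Y : ℕ → Ω → ℕ := fun n x => min (enc (X x)) n
    have hY : ∀ n, BM (MeasurableSpace.comap X inferInstance) (Y n) := fun n =>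
      ⟨((measurable_of_countable (fun e => min (enc e) n)).comp (comap_measurable X)),
        n, fun x => min_le_right _ _⟩
    have hpt : ∀ x, ∀ᶠ n in atTop, pI μ (Y n) G x = pI μ X G x := by
      intro x
      filter_upwards [eventually_gt_atTop (enc (X x))] with n hn
      unfold pI
      congr 1
      ext y
      simp only [Y, mem_preimage, mem_singleton_iff]
      constructor
      · intro h
        apply henc
        omega
      · intro h; rw [h]
    calc ent μ X G = ∫⁻ x, liminf (fun n => ENNReal.ofReal (- Real.log (pI μ (Y n) G x))) atTop ∂μ := by
          unfold ent
          congr 1; ext x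
          symm
          apply Tendsto.liminf_eq
          apply tendsto_const_nhds.congr'
          filter_upwards [hpt x] with n hn
          rw [hn]
      _ ≤ liminf (fun n => ∫⁻ x, ENNReal.ofReal (- Real.log (pI μ (Y n) G x)) ∂μ) atTop :=
          lintegral_liminf_le fun n => (pI_meas hG ((hY n).mono hX.comap_le).1).log.neg.ennreal_ofReal
      _ ≤ Hs μ (MeasurableSpace.comap X inferInstance) G := by
          refine liminf_le_of_le (by isBoundedDefault) fun b hb => ?_
          obtain ⟨n, hn⟩ := hb.exists
          exact hn.trans (le_Hs (hY n))

end EntAux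

namespace EntAux

set_option linter.unusedSectionVars false

variable {Ω : Type*} {A L ξ G G' N M : MeasurableSpace Ω} {m0 : MeasurableSpace Ω}
variable {μ : Measure Ω} [IsProbabilityMeasure μ]

/-- pull back by the iterate. -/
@[reducible] def it (T : Ω → Ω) (M : MeasurableSpace Ω) (n : ℕ) : MeasurableSpace Ω := M.comap (T^[n])

/-- dynamical join. -/
@[reducible] def Jn (T : Ω → Ω) (M : MeasurableSpace Ω) : ℕ → MeasurableSpace Ω
  | 0 => ⊥
  | n + 1 => Jn T M n ⊔ it T M n

variable {T : Ω → Ω}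

lemma it_succ (n : ℕ) : it T M (n+1) = (it T M n).comap T := by
  unfold it; rw [MeasurableSpace.comap_comp, Function.iterate_succ]

lemma it_succ' (n : ℕ) : it T M (n+1) = it T (M.comap T) n := by
  unfold it; rw [MeasurableSpace.comap_comp, Function.iterate_succ']

lemma it_zero : it T M 0 = M := by
  unfold it; exact MeasurableSpace.comap_id

lemma it_mono (h : M ≤ N) (n : ℕ) : it T M n ≤ it T N n := MeasurableSpace.comap_mono h

lemma it_sup (n : ℕ) : it T (M ⊔ N) n = it T M n ⊔ it T N n := MeasurableSpace.comap_sup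

lemma comap_T_le (hT : Measurable T) (hM : M ≤ m0) : M.comap T ≤ m0 :=
  (MeasurableSpace.comap_mono hM).trans hT.comap_le

lemma it_le (hT : Measurable T) (hM : M ≤ m0) (n : ℕ) : it T M n ≤ m0 :=
  comap_T_le (hT.iterate n) hM

lemma Jn_le (hT : Measurable T) (hM : M ≤ m0) (n : ℕ) : Jn T M n ≤ m0 := by
  induction n with
  | zero => exact bot_le
  | succ n ih => exact sup_le ih (it_le hT hM n)

lemma Jn_mono (h : M ≤ N) (n : ℕ) : Jn T M n ≤ Jn T N n := by
  induction n with
  | zero => exact bot_le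
  | succ n ih => exact sup_le_sup ih (it_mono h n)

lemma Jn_succ' (n : ℕ) : Jn T M (n+1) = M ⊔ (Jn T M n).comap T := by
  induction n with
  | zero => simp [Jn, it_zero, MeasurableSpace.comap_bot]
  | succ n ih =>
    have : Jn T M (n+2) = Jn T M (n+1) ⊔ it T M (n+1) := rfl
    rw [this, ih, it_succ, sup_assoc, ← MeasurableSpace.comap_sup]; rw [← ih]

lemma Hs_it (hT : MeasurePreserving T μ μ) (hM : M ≤ m0) (hG : G ≤ m0) (n : ℕ) :
    Hs μ (it T M n) (it T G n) = Hs μ M G := Hs_T (hT.iterate n) hM hG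

section main

lemma mul_tsub_le {n : ℕ} {u b x : ℝ≥0∞} (h : n * u ≤ n * b + x) : n * (u - b) ≤ x := by
  rw [ENNReal.mul_sub (by simp)]
  exact tsub_le_iff_left.2 h

/-- conditions relating the σ-algebras. -/
structure Sys (A L ξ : MeasurableSpace Ω) (m0 : MeasurableSpace Ω) (μ : Measure Ω) (T : Ω → Ω)
    (c : ℝ≥0∞) : Prop where
  hT : MeasurePreserving T μ μ
  hA : A ≤ m0
  hξ : ξ ≤ m0
  hLA : L ≤ A
  hLT : L.comap T ≤ L
  h1 : A ≤ A.comap T ⊔ (ξ ⊔ L)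
  h2 : A.comap T ≤ A ⊔ (ξ ⊔ L)
  hc : ∀ Z, BM m0 Z → ∀ a, (∀ n : ℕ, n * a ≤ Hs μ (Jn T (sg Z) n) ⊥) → a ≤ c

variable {c : ℝ≥0∞}

lemma Sys.step1 (S : Sys A L ξ m0 μ T c) : Hs μ L (L.comap T) ≤ c := by
  have hL := S.hLA.trans S.hA
  have hTm := S.hT.measurable
  apply Hs_le
  intro l hl
  have hl0 := hl.mono hL
  apply (le_Hs hl.self).trans
  apply S.hc l hl0
  intro n
  induction n with
  | zero => simp
  | succ n ih =>
    have hJ : Jn T (sg l) n ≤ L := by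
      clear ih
      induction n with
      | zero => exact bot_le
      | succ n ih =>
        rw [Jn_succ']
        exact sup_le hl.sg_le ((MeasurableSpace.comap_mono ih).trans S.hLT)
    have hJ0 := hJ.trans hL
    rw [Jn_succ', Hs_chain hl0.sg_le (comap_T_le hTm hJ0) bot_le]
    have e : Hs μ ((Jn T (sg l) n).comap T) ⊥ = Hs μ (Jn T (sg l) n) ⊥ := by
      rw [← Hs_T S.hT hJ0 bot_le, MeasurableSpace.comap_bot]
    rw [e, sup_bot_eq]
    push_cast
    rw [add_mul, one_mul]
    gcongr
    exact Hs_anti hl0.sg_le (comap_T_le hTm hL) (MeasurableSpace.comap_mono hJ)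


lemma Sys.hη (S : Sys A L ξ m0 μ T c) : ξ ⊔ L ≤ m0 := sup_le S.hξ (S.hLA.trans S.hA)

lemma Sys.hA1 (S : Sys A L ξ m0 μ T c) : A.comap T ≤ m0 := comap_T_le S.hT.measurable S.hA

lemma Sys.u1_eq (S : Sys A L ξ m0 μ T c) : Hs μ (ξ ⊔ L) (A.comap T) = Hs μ L (A.comap T) + Hs μ ξ (L ⊔ A.comap T) :=
  Hs_chain S.hξ (S.hLA.trans S.hA) S.hA1

lemma Sys.u1_le (S : Sys A L ξ m0 μ T c) : Hs μ (ξ ⊔ L) (A.comap T) ≤ c + Hs μ ξ (L ⊔ A.comap T) := by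
  rw [S.u1_eq]
  gcongr
  exact (Hs_anti (S.hLA.trans S.hA) S.hA1 (MeasurableSpace.comap_mono S.hLA)).trans S.step1

lemma Sys.H2_eq (S : Sys A L ξ m0 μ T c) : Hs μ (ξ ⊔ L) A = Hs μ ξ A := by
  rw [Hs_chain S.hξ (S.hLA.trans S.hA) S.hA, Hs_zero S.hA S.hLA, zero_add, sup_eq_right.2 S.hLA]

lemma Sys.hAe (S : Sys A L ξ m0 μ T c) (n : ℕ) : it T (ξ ⊔ L) n ⊔ it T A (n+1) = it T (ξ ⊔ L) n ⊔ it T A n := by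
  rw [it_succ', ← it_sup, ← it_sup]
  congr 1
  apply le_antisymm
  · exact sup_le le_sup_left (S.h2.trans (sup_comm _ _).le)
  · exact sup_le le_sup_left (S.h1.trans (sup_comm _ _).le)

lemma Sys.hAE (S : Sys A L ξ m0 μ T c) (n : ℕ) : A ≤ Jn T (ξ ⊔ L) n ⊔ it T A n := by
  induction n with
  | zero => rw [it_zero]; exact le_sup_right
  | succ n ih =>
    refine ih.trans ?_
    change _ ≤ (Jn T (ξ ⊔ L) n ⊔ it T (ξ ⊔ L) n) ⊔ it T A (n+1)
    rw [sup_assoc, S.hAe]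
    exact sup_le_sup_left le_sup_right _

lemma Sys.u_succ (S : Sys A L ξ m0 μ T c) (n : ℕ) : Hs μ (Jn T (ξ ⊔ L) (n+1)) (it T A (n+1)) =
    Hs μ (ξ ⊔ L) (A.comap T) + Hs μ (Jn T (ξ ⊔ L) n) (it T (ξ ⊔ L) n ⊔ it T A n) := by
  have hTm := S.hT.measurable
  change Hs μ (Jn T (ξ ⊔ L) n ⊔ it T (ξ ⊔ L) n) _ = _
  rw [Hs_chain (Jn_le hTm S.hη n) (it_le hTm S.hη n) (it_le hTm S.hA _), S.hAe, it_succ',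
    Hs_it S.hT S.hη S.hA1]

lemma Sys.fwd1 (S : Sys A L ξ m0 μ T c) (n : ℕ) : n * Hs μ (ξ ⊔ L) (A.comap T) ≤
    n * Hs μ (ξ ⊔ L) A + Hs μ (Jn T (ξ ⊔ L) n) (it T A n) := by
  have hTm := S.hT.measurable
  induction n with
  | zero => simp
  | succ n ih =>
    have e : Hs μ (Jn T (ξ ⊔ L) n) (it T A n) ≤
        Hs μ (ξ ⊔ L) A + Hs μ (Jn T (ξ ⊔ L) n) (it T (ξ ⊔ L) n ⊔ it T A n) := by
      rw [← Hs_it S.hT S.hη S.hA n, ← Hs_chain (Jn_le hTm S.hη n) (it_le hTm S.hη n)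
        (it_le hTm S.hA _)]
      exact Hs_mono le_sup_left
    rw [S.u_succ]
    push_cast
    calc _ = (n : ℝ≥0∞) * Hs μ (ξ ⊔ L) (A.comap T) + Hs μ (ξ ⊔ L) (A.comap T) := by ring
      _ ≤ (n * Hs μ (ξ ⊔ L) A + (Hs μ (ξ ⊔ L) A + Hs μ (Jn T (ξ ⊔ L) n)
          (it T (ξ ⊔ L) n ⊔ it T A n))) + Hs μ (ξ ⊔ L) (A.comap T) := by
          gcongr
          exact ih.trans (by gcongr)
      _ = _ := by ring

lemma Sys.fwd2 (S : Sys A L ξ m0 μ T c) {Z : Ω → ℕ} (hZ : BM (ξ ⊔ L) Z) {ε : ℝ≥0∞}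
    (h : Hs μ (ξ ⊔ L) (sg Z ⊔ A.comap T) ≤ ε) (n : ℕ) :
    Hs μ (Jn T (ξ ⊔ L) n) (Jn T (sg Z) n ⊔ it T A n) ≤ n * ε := by
  have hTm := S.hT.measurable
  have hZ0 : sg Z ≤ m0 := hZ.sg_le.trans S.hη
  have hE := Jn_le hTm S.hη
  have hJ := Jn_le hTm hZ0
  have hA := it_le hTm S.hA
  induction n with
  | zero => rw [Hs_zero (sup_le (hJ 0) (hA 0)) bot_le]; exact bot_le
  | succ n ih =>
    rw [Jn_succ' (M := ξ ⊔ L)]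
    have hG : Jn T (sg Z) (n+1) ⊔ it T A (n+1) ≤ m0 := sup_le (hJ _) (hA _)
    have hTE := comap_T_le hTm (hE n)
    rw [Hs_chain S.hη hTE hG]
    have e1 : Hs μ ((Jn T (ξ ⊔ L) n).comap T) (Jn T (sg Z) (n+1) ⊔ it T A (n+1)) ≤ n * ε := by
      refine le_trans (Hs_anti hTE hG ?_) ((Hs_T S.hT (hE n) (sup_le (hJ n) (hA n))).le.trans ih)
      rw [MeasurableSpace.comap_sup, it_succ, Jn_succ']
      exact sup_le_sup_right le_sup_right _
    have e2 : Hs μ (ξ ⊔ L) ((Jn T (ξ ⊔ L) n).comap T ⊔ (Jn T (sg Z) (n+1) ⊔ it T A (n+1))) ≤ ε := by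
      refine le_trans (Hs_anti S.hη (sup_le hTE hG) ?_) h
      apply sup_le
      · rw [Jn_succ']
        exact le_trans (le_trans le_sup_left le_sup_left) le_sup_right
      · refine (MeasurableSpace.comap_mono (S.hAE n)).trans ?_
        rw [MeasurableSpace.comap_sup, ← it_succ]
        exact sup_le_sup_left le_sup_right _
    push_cast
    rw [add_mul, one_mul]
    gcongr

lemma Sys.fwd (S : Sys A L ξ m0 μ T c) (hfin : Hs μ (ξ ⊔ L) (A.comap T) ≠ ∞) :
    Hs μ (ξ ⊔ L) (A.comap T) ≤ c + Hs μ (ξ ⊔ L) A := by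
  have hTm := S.hT.measurable
  refine ENNReal.le_of_forall_pos_le_add fun ε hε _ => ?_
  have hε' : (ε : ℝ≥0∞) ≠ 0 := by simp [hε.ne']
  obtain ⟨Z, hZ, h⟩ := Hs_approx S.hη S.hA1 hfin hε'
  have hZ0 : sg Z ≤ m0 := hZ.sg_le.trans S.hη
  have key : Hs μ (ξ ⊔ L) (A.comap T) - (Hs μ (ξ ⊔ L) A + ε) ≤ c := by
    apply S.hc Z (hZ.mono S.hη)
    intro n
    apply mul_tsub_le
    refine (S.fwd1 n).trans ?_
    rw [mul_add, add_assoc]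
    gcongr
    calc _ ≤ Hs μ (Jn T (ξ ⊔ L) n ⊔ Jn T (sg Z) n) (it T A n) := Hs_mono le_sup_left
      _ = Hs μ (Jn T (sg Z) n) (it T A n) + _ :=
          Hs_chain (Jn_le hTm S.hη n) (Jn_le hTm hZ0 n) (it_le hTm S.hA n)
      _ ≤ Hs μ (Jn T (sg Z) n) ⊥ + n * ε := by
          gcongr
          · exact Hs_anti (Jn_le hTm hZ0 n) (it_le hTm S.hA n) bot_le
          · exact S.fwd2 hZ h n
      _ = _ := add_comm _ _
  rw [add_assoc]
  exact tsub_le_iff_right.1 key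

lemma Sys.bwd1 (S : Sys A L ξ m0 μ T c) {Z : Ω → ℕ} (hZ : BM (ξ ⊔ L) Z) (n : ℕ) :
    n * Hs μ (sg Z) A + Hs μ (Jn T (ξ ⊔ L) n) (it T A n) ≤
      Hs μ (Jn T (sg Z) n) A + n * Hs μ (ξ ⊔ L) (A.comap T) := by
  have hTm := S.hT.measurable
  have hZ0 : sg Z ≤ m0 := hZ.sg_le.trans S.hη
  have hE := Jn_le hTm S.hη
  have hJ := Jn_le hTm hZ0
  have hA := it_le hTm S.hA
  have hη := it_le hTm S.hη
  have hζ := it_le hTm hZ0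
  induction n with
  | zero => rw [Jn, Hs_zero (hA 0) bot_le]; simp
  | succ n ih =>
    have e1 : Hs μ (Jn T (sg Z) n) A + Hs μ (it T (sg Z) n) (Jn T (ξ ⊔ L) n ⊔ it T A n) ≤
        Hs μ (Jn T (sg Z) (n+1)) A := by
      change _ ≤ Hs μ (Jn T (sg Z) n ⊔ it T (sg Z) n) A
      rw [sup_comm (Jn T (sg Z) n), Hs_chain (hζ n) (hJ n) S.hA]
      gcongr
      exact Hs_anti (hζ n) (sup_le (hE n) (hA n))
        (sup_le ((Jn_mono hZ.sg_le n).trans le_sup_left) (S.hAE n))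
    have e2 : Hs μ (sg Z) A + Hs μ (Jn T (ξ ⊔ L) n) (it T (ξ ⊔ L) n ⊔ it T A n) ≤
        Hs μ (Jn T (ξ ⊔ L) n) (it T A n) +
          Hs μ (it T (sg Z) n) (Jn T (ξ ⊔ L) n ⊔ it T A n) := by
      rw [← Hs_chain (hζ n) (hE n) (hA n), sup_comm (it T (sg Z) n), Hs_chain (hE n) (hζ n) (hA n),
        Hs_it S.hT hZ0 S.hA]
      gcongr
      exact Hs_anti (hE n) (sup_le (hη n) (hA n)) (sup_le_sup_right (it_mono hZ.sg_le n) _)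
    rw [S.u_succ]
    push_cast
    calc _ = n * Hs μ (sg Z) A + (Hs μ (sg Z) A + Hs μ (Jn T (ξ ⊔ L) n)
            (it T (ξ ⊔ L) n ⊔ it T A n)) + Hs μ (ξ ⊔ L) (A.comap T) := by ring
      _ ≤ n * Hs μ (sg Z) A + (Hs μ (Jn T (ξ ⊔ L) n) (it T A n) +
          Hs μ (it T (sg Z) n) (Jn T (ξ ⊔ L) n ⊔ it T A n)) + Hs μ (ξ ⊔ L) (A.comap T) := by
          gcongr
      _ = (n * Hs μ (sg Z) A + Hs μ (Jn T (ξ ⊔ L) n) (it T A n)) +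
          Hs μ (it T (sg Z) n) (Jn T (ξ ⊔ L) n ⊔ it T A n) + Hs μ (ξ ⊔ L) (A.comap T) := by ring
      _ ≤ (Hs μ (Jn T (sg Z) n) A + n * Hs μ (ξ ⊔ L) (A.comap T)) +
          Hs μ (it T (sg Z) n) (Jn T (ξ ⊔ L) n ⊔ it T A n) + Hs μ (ξ ⊔ L) (A.comap T) := by
          gcongr
      _ = (Hs μ (Jn T (sg Z) n) A + Hs μ (it T (sg Z) n) (Jn T (ξ ⊔ L) n ⊔ it T A n)) +
          (n + 1) * Hs μ (ξ ⊔ L) (A.comap T) := by ring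
      _ ≤ _ := by gcongr

lemma Sys.bwd (S : Sys A L ξ m0 μ T c) : Hs μ (ξ ⊔ L) A ≤ c + Hs μ (ξ ⊔ L) (A.comap T) := by
  apply Hs_le
  intro Z hZ
  have hTm := S.hT.measurable
  have hZ0 : sg Z ≤ m0 := hZ.sg_le.trans S.hη
  apply (le_Hs hZ.self).trans
  apply tsub_le_iff_right.1
  apply S.hc Z (hZ.mono S.hη)
  intro n
  apply mul_tsub_le
  refine le_trans (le_trans le_self_add (S.bwd1 hZ n)) ?_
  rw [add_comm]
  gcongr
  exact Hs_anti (Jn_le hTm hZ0 n) S.hA bot_le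

theorem Sys.main (S : Sys A L ξ m0 μ T c) (hc : c ≠ ∞) (h : Hs μ ξ (L ⊔ A.comap T) ≠ ∞) :
    Hs μ ξ A ≠ ∞ ∧ Hs μ ξ (L ⊔ A.comap T) ≤ c + Hs μ ξ A := by
  have hu : Hs μ (ξ ⊔ L) (A.comap T) ≠ ∞ :=
    (S.u1_le.trans_lt (ENNReal.add_lt_top.2 ⟨hc.lt_top, h.lt_top⟩)).ne
  rw [← S.H2_eq]
  refine ⟨(S.bwd.trans_lt (ENNReal.add_lt_top.2 ⟨hc.lt_top, hu.lt_top⟩)).ne, ?_⟩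
  refine le_trans ?_ (S.fwd hu)
  rw [S.u1_eq]
  exact le_add_self

end main
end EntAux

namespace EntAux

set_option linter.unusedSectionVars false

lemma ent_bot {Ω κ : Type*} {m0 : MeasurableSpace Ω} {μ : Measure Ω} [IsProbabilityMeasure μ]
    [Countable κ] [MeasurableSpace κ] [MeasurableSingletonClass κ] {X : Ω → κ} (hX : Measurable X) :
    ent μ X ⊥ = ∑' k, ENNReal.ofReal (Real.negMulLog (μ (X ⁻¹' {k})).toReal) := by
  rw [ent_eq_tsum bot_le hX]
  congr 1; ext k
  have : cpr μ ⊥ (X ⁻¹' {k}) = fun _ => (μ (X ⁻¹' {k})).toReal := by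
    unfold cpr
    rw [condExp_bot, integral_indicator (hX (measurableSet_singleton k))]
    simp [measureReal_def]
  rw [this]; simp

lemma claimD {Ω : Type*} {m0 : MeasurableSpace Ω} {μ : Measure Ω} [IsProbabilityMeasure μ]
    {T : Ω → Ω} (hT : Measurable T) (Z : Ω → ℕ) (hZ : BM m0 Z) (a : ℝ≥0∞)
    (h : ∀ n : ℕ, n * a ≤ Hs μ (Jn T (sg Z) n) ⊥) : a ≤ ksEnt μ T := by
  let P : ℕ → Set Ω := fun n => Z ⁻¹' {n}
  have hP : IsPartition P :=
    { meas := fun n => hZ.1 (measurableSet_singleton n)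
      disj := by
        intro i j hij
        rw [Function.onFun, Set.disjoint_left]
        intro x hx hx'
        exact hij (hx.symm.trans hx')
      cover := by ext x; simp [P] }
  have hfin : partEnt μ P ≠ ⊤ := by
    have : partEnt μ P = ent μ Z ⊥ := (ent_bot hZ.1).symm
    rw [this]; exact (ent_lt_top bot_le hZ).ne
  unfold ksEnt
  refine le_trans ?_ (le_iSup_of_le P (le_iSup_of_le hP (le_iSup_of_le hfin le_rfl)))
  unfold dynEnt
  refine le_iInf fun n => ?_
  rw [ENNReal.le_div_iff_mul_le (by left; simp) (by left; simp)]
  let X : Ω → (Fin (n+1) → ℕ) := fun x i => Z (T^[i] x)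
  have hX : Measurable X := measurable_pi_lambda _ fun i => hZ.1.comp (hT.iterate i)
  have e1 : ent μ X ⊥ = ∑' k : Fin (n + 1) → ℕ,
      ENNReal.ofReal (Real.negMulLog (μ (refinePart T P (n + 1) k)).toReal) := by
    rw [ent_bot hX]
    congr 1; ext k
    have : X ⁻¹' {k} = refinePart T P (n+1) k := by
      ext x; simp [refinePart, P, X, funext_iff]
    rw [this]
  rw [← e1, ← Hs_ent bot_le hX, mul_comm]
  have := h (n+1)
  push_cast at this
  refine this.trans (Hs_mono ?_)
  have aux : ∀ j, j ≤ n+1 → Jn T (sg Z) j ≤ MeasurableSpace.comap X inferInstance := by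
    intro j
    induction j with
    | zero => intro _; exact bot_le
    | succ j ih =>
      intro hj
      refine sup_le (ih (by omega)) ?_
      have : it T (sg Z) j = MeasurableSpace.comap (fun x => X x ⟨j, by omega⟩) inferInstance := by
        unfold it; rw [MeasurableSpace.comap_comp]; rfl
      rw [this]
      exact ((measurable_pi_apply _).comp (comap_measurable X)).comap_le
  exact aux _ le_rfl

section ifs

variable {q : ℕ} {E Λ : Type*} [MeasurableSpace Λ] (S : RandomCIFS q E Λ)

lemma x0_mem : S.x0 ∈ S.X := S.X_conn.nonempty.some_mem

lemma word_maps (l : Λ) (ω : ℕ → E) (n : ℕ) : MapsTo (word S.θ S.φ l ω n) S.X S.X := by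
  induction n generalizing l ω with
  | zero => exact fun x hx => hx
  | succ n ih => exact (S.φ_mapsX _ _).comp (ih _ _)

lemma word_dist (l : Λ) (ω : ℕ → E) (n : ℕ) {x y : Pt q} (hx : x ∈ S.X) (hy : y ∈ S.X) :
    dist (word S.θ S.φ l ω n x) (word S.θ S.φ l ω n y) ≤ S.s ^ n * dist x y := by
  induction n generalizing l ω with
  | zero => simp [word]
  | succ n ih =>
    have h := (S.φ_lip (ω 0) l).dist_le_mul _ (word_maps S (S.θ l) (shift ω) n hx) _
      (word_maps S (S.θ l) (shift ω) n hy)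
    rw [Real.coe_toNNReal _ S.s_mem.1.le] at h
    refine h.trans ?_
    rw [pow_succ', mul_assoc]
    exact mul_le_mul_of_nonneg_left (ih _ _) S.s_mem.1.le

lemma word_add (l : Λ) (ω : ℕ → E) (n k : ℕ) :
    ∃ y ∈ S.X, word S.θ S.φ l ω (n + k) S.x0 = word S.θ S.φ l ω n y := by
  induction n generalizing l ω with
  | zero => exact ⟨_, word_maps S l ω k (x0_mem S), by simp [word]⟩
  | succ n ih =>
    obtain ⟨y, hy, h⟩ := ih (S.θ l) (shift ω)
    refine ⟨y, hy, ?_⟩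
    rw [Nat.add_right_comm]
    simp only [word, comp_apply, h]

lemma proj_tendsto (l : Λ) (ω : ℕ → E) :
    Tendsto (fun n => word S.θ S.φ l ω n S.x0) atTop (𝓝 (S.projMap l ω)) := by
  have hc : CauchySeq (fun n => word S.θ S.φ l ω n S.x0) := by
    refine cauchySeq_of_le_tendsto_0' (fun n => S.s ^ n * Metric.diam S.X) ?_ ?_
    · intro n m hnm
      obtain ⟨k, rfl⟩ := Nat.exists_eq_add_of_le hnm
      obtain ⟨y, hy, h⟩ := word_add S l ω n k
      rw [h]
      refine (word_dist S l ω n (x0_mem S) hy).trans ?_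
      have := S.s_mem.1.le
      gcongr
      exact dist_le_diam_of_mem S.X_cpt.isBounded (x0_mem S) hy
    · have := (tendsto_pow_atTop_nhds_zero_of_lt_one S.s_mem.1.le S.s_mem.2).mul_const
        (Metric.diam S.X)
      simpa using this
  exact (cauchySeq_tendsto_of_complete hc).elim fun a ha => by
    have : S.projMap l ω = a := ha.limUnder_eq
    rw [this]; exact ha

lemma proj_mem (l : Λ) (ω : ℕ → E) : S.projMap l ω ∈ S.X :=
  S.X_cpt.isClosed.mem_of_tendsto (proj_tendsto S l ω)
    (Eventually.of_forall fun n => word_maps S l ω n (x0_mem S))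

lemma proj_rec (l : Λ) (ω : ℕ → E) :
    S.projMap l ω = S.φ (ω 0) l (S.projMap (S.θ l) (shift ω)) := by
  have h1 := (proj_tendsto S l ω).comp (tendsto_add_atTop_nat 1)
  have h2 := proj_tendsto S (S.θ l) (shift ω)
  have hcont := (S.φ_lip (ω 0) l).continuousOn _ (proj_mem S (S.θ l) (shift ω))
  have h3 : Tendsto (fun n => word S.θ S.φ (S.θ l) (shift ω) n S.x0) atTop
      (𝓝[S.X] (S.projMap (S.θ l) (shift ω))) :=
    tendsto_nhdsWithin_iff.2 ⟨h2, Eventually.of_forall fun n => word_maps S _ _ n (x0_mem S)⟩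
  exact tendsto_nhds_unique h1 (hcont.tendsto.comp h3)

variable [Countable E] [MeasurableSpace E] [MeasurableSingletonClass E]

lemma phi_joint : Measurable (fun p : E × (Λ × Pt q) => S.φ p.1 p.2.1 p.2.2) :=
  measurable_from_prod_countable_right fun e => S.φ_meas e

lemma Tmap_meas : Measurable S.Tmap := by
  refine (S.θ_meas.comp measurable_fst).prodMk ?_
  exact measurable_pi_lambda _ fun n => (measurable_pi_apply (n+1)).comp measurable_snd

lemma word_meas (n : ℕ) (x : Pt q) :
    Measurable (fun p : Λ × (ℕ → E) => word S.θ S.φ p.1 p.2 n x) := by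
  induction n with
  | zero => exact measurable_const
  | succ n ih =>
    have h0 : Measurable (fun p : Λ × (ℕ → E) => p.2 0) :=
      (measurable_pi_apply 0).comp measurable_snd
    exact (phi_joint S).comp (h0.prodMk (measurable_fst.prodMk (ih.comp (Tmap_meas S))))

lemma proj_meas : Measurable (fun p : Λ × (ℕ → E) => S.projMap p.1 p.2) :=
  measurable_of_tendsto_metrizable (fun n => word_meas S n S.x0)
    (tendsto_pi_nhds.2 fun p => proj_tendsto S p.1 p.2)

/-- first coordinate. -/
def fc (p : Λ × (ℕ → E)) : E := p.2 0

lemma fc_meas : Measurable (fc : Λ × (ℕ → E) → E) :=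
  (measurable_pi_apply 0).comp measurable_snd

/-- σ-algebra of the first coordinate. -/
@[reducible] def xi : MeasurableSpace (Λ × (ℕ → E)) := MeasurableSpace.comap fc inferInstance

/-- A measurable description of the image of closed sets. -/
lemma img_set (e : E) {F : Set (Pt q)} (hF : IsClosed F) :
    ∃ V : Set (Λ × Pt q), MeasurableSet V ∧
      ∀ l y, (l, y) ∈ V ↔ y ∈ S.φ e l '' (F ∩ S.X) := by
  by_cases hne : (F ∩ S.X).Nonempty
  · have : Nonempty (F ∩ S.X : Set (Pt q)) := hne.to_subtype
    let d : ℕ → (F ∩ S.X : Set (Pt q)) := TopologicalSpace.denseSeq _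
    have hd : DenseRange d := TopologicalSpace.denseRange_denseSeq _
    have hcpt : IsCompact (F ∩ S.X) := S.X_cpt.inter_left hF
    refine ⟨{p | ⨅ n, edist (S.φ e p.1 (d n)) p.2 = 0}, ?_, ?_⟩
    · have : Measurable (fun p : Λ × Pt q => ⨅ n, edist (S.φ e p.1 (d n)) p.2) := by
        refine Measurable.iInf fun n => ?_
        have h1 : Measurable (fun p : Λ × Pt q => S.φ e p.1 (d n)) :=
          (S.φ_meas e).comp (measurable_fst.prodMk measurable_const)
        exact h1.edist measurable_snd
      exact this (measurableSet_singleton 0)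
    · intro l y
      have hlip := S.φ_lip e l
      have hK : IsCompact (S.φ e l '' (F ∩ S.X)) :=
        hcpt.image_of_continuousOn (hlip.continuousOn.mono inter_subset_right)
      constructor
      · intro h
        rw [← hK.isClosed.closure_eq, mem_closure_iff_infEDist_zero]
        refine le_antisymm ?_ bot_le
        rw [← (show ⨅ n, edist (S.φ e l (d n)) y = 0 from h)]
        refine le_iInf fun n => ?_
        rw [edist_comm]
        exact infEDist_le_edist_of_mem (mem_image_of_mem _ (d n).2)
      · rintro ⟨z, hz, rfl⟩
        change ⨅ n, edist (S.φ e l (d n)) (S.φ e l z) = 0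
        refine le_antisymm ?_ bot_le
        refine le_of_forall_gt fun ε hε => ?_
        obtain ⟨_, ⟨n, rfl⟩, hn⟩ := EMetric.mem_closure_iff.1 (hd ⟨z, hz⟩) ε hε
        refine lt_of_le_of_lt (iInf_le _ n) (lt_of_le_of_lt ?_ hn)
        refine (hlip (d n).2.2 hz.2).trans ?_
        rw [edist_comm]
        have : (S.s.toNNReal : ℝ≥0∞) ≤ 1 := by
          rw [ENNReal.coe_le_one_iff]
          exact Real.toNNReal_le_one.2 S.s_mem.2.le
        calc _ ≤ 1 * edist z (d n : Pt q) := by gcongr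
          _ = _ := one_mul _
  · refine ⟨∅, MeasurableSet.empty, ?_⟩
    rw [not_nonempty_iff_eq_empty.1 hne]
    simp

lemma alg_eq : algLpi S.projMap = (algL : MeasurableSpace (Λ × (ℕ → E))) ⊔
    MeasurableSpace.comap (fun p : Λ × (ℕ → E) => S.projMap p.1 p.2) inferInstance :=
  MeasurableSpace.comap_prodMk _ _

lemma algT_eq : algLpiT S.θ S.projMap =
    (algL : MeasurableSpace (Λ × (ℕ → E))) ⊔ (algLpi S.projMap).comap S.Tmap := by
  have h1 : algLpiT S.θ S.projMap = (algL : MeasurableSpace (Λ × (ℕ → E))) ⊔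
    MeasurableSpace.comap (fun p : Λ × (ℕ → E) => S.projMap (S.θ p.1) (shift p.2)) inferInstance :=
    MeasurableSpace.comap_prodMk _ _
  have h2 : (algL : MeasurableSpace (Λ × (ℕ → E))).comap S.Tmap ≤ algL := by
    unfold algL
    rw [MeasurableSpace.comap_comp]
    exact (S.θ_meas.comp (comap_measurable Prod.fst)).comap_le
  rw [h1, alg_eq, MeasurableSpace.comap_sup, ← sup_assoc, sup_eq_left.2 h2,
    MeasurableSpace.comap_comp]
  rfl

lemma sys (μ : Measure (Λ × (ℕ → E))) [IsProbabilityMeasure μ]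
    (hinv : MeasurePreserving S.Tmap μ μ) :
    Sys (algLpi S.projMap) algL xi inferInstance μ S.Tmap (ksEnt μ S.Tmap) where
  hT := hinv
  hA := (measurable_fst.prodMk (proj_meas S)).comap_le
  hξ := fc_meas.comap_le
  hLA := by rw [alg_eq]; exact le_sup_left
  hLT := by
    unfold algL
    rw [MeasurableSpace.comap_comp]
    exact (S.θ_meas.comp (comap_measurable Prod.fst)).comap_le
  h1 := by
    rw [alg_eq]
    refine sup_le (le_sup_right.trans le_sup_right) ?_
    set K : MeasurableSpace (Λ × (ℕ → E)) := (algL ⊔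
      MeasurableSpace.comap (fun p : Λ × (ℕ → E) => S.projMap p.1 p.2) inferInstance).comap S.Tmap
        ⊔ (xi ⊔ algL) with hK
    have m1 : Measurable[K] (Prod.fst : Λ × (ℕ → E) → Λ) :=
      (comap_measurable _).mono (show algL ≤ K from le_sup_right.trans le_sup_right) le_rfl
    have m2 : Measurable[K] (fc : Λ × (ℕ → E) → E) :=
      (comap_measurable _).mono (show xi ≤ K from le_sup_left.trans le_sup_right) le_rfl
    have m3 : Measurable[K] (fun p : Λ × (ℕ → E) => S.projMap (S.θ p.1) (shift p.2)) := by
      have := (comap_measurable (fun p : Λ × (ℕ → E) => S.projMap p.1 p.2)).comp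
        (comap_measurable (m := MeasurableSpace.comap
          (fun p : Λ × (ℕ → E) => S.projMap p.1 p.2) inferInstance) S.Tmap)
      refine Measurable.mono this ?_ le_rfl
      exact (MeasurableSpace.comap_mono le_sup_right).trans le_sup_left
    have m4 := (phi_joint S).comp (m2.prodMk (m1.prodMk m3))
    have : (fun p : Λ × (ℕ → E) => S.projMap p.1 p.2) =
      (fun p : E × (Λ × Pt q) => S.φ p.1 p.2.1 p.2.2) ∘
        (fun p : Λ × (ℕ → E) => (fc p, p.1, S.projMap (S.θ p.1) (shift p.2))) := by
      ext1 p; exact proj_rec S p.1 p.2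
    rw [this]
    exact m4.comap_le
  h2 := by
    set K : MeasurableSpace (Λ × (ℕ → E)) := algLpi S.projMap ⊔ (xi ⊔ algL) with hK
    rw [alg_eq, MeasurableSpace.comap_sup]
    have hLT : (algL : MeasurableSpace (Λ × (ℕ → E))).comap S.Tmap ≤ algL := by
      unfold algL
      rw [MeasurableSpace.comap_comp]
      exact (S.θ_meas.comp (comap_measurable Prod.fst)).comap_le
    refine sup_le (hLT.trans (show algL ≤ K from le_sup_right.trans le_sup_right)) ?_
    rw [MeasurableSpace.comap_comp]
    have m2 : Measurable[K] (fc : Λ × (ℕ → E) → E) :=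
      (comap_measurable _).mono (show xi ≤ K from le_sup_left.trans le_sup_right) le_rfl
    have m1 : Measurable[K] (fun p : Λ × (ℕ → E) => (p.1, S.projMap p.1 p.2)) :=
      (comap_measurable _).mono (show algLpi S.projMap ≤ K from le_sup_left) le_rfl
    have m3 : Measurable[K] (fun p : Λ × (ℕ → E) => S.projMap (S.θ p.1) (shift p.2)) := by
      refine @measurable_of_isClosed _ _ _ _ _ K _ fun F hF => ?_
      choose V hV hVe using fun e => img_set S e hF
      have : (fun p : Λ × (ℕ → E) => S.projMap (S.θ p.1) (shift p.2)) ⁻¹' F =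
          ⋃ e, (fc ⁻¹' {e} ∩ (fun p : Λ × (ℕ → E) => (p.1, S.projMap p.1 p.2)) ⁻¹' V e) := by
        ext p
        simp only [mem_preimage, mem_iUnion, mem_inter_iff, mem_singleton_iff, exists_eq_left', hVe]
        rw [proj_rec S p.1 p.2]
        have hX := proj_mem S (S.θ p.1) (shift p.2)
        constructor
        · intro h
          exact ⟨_, ⟨h, hX⟩, rfl⟩
        · rintro ⟨z, hz, h⟩
          have := S.φ_inj (p.2 0) p.1 (S.X_sub_W hz.2) (S.X_sub_W hX) h
          rw [← this]; exact hz.1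
      rw [this]
      exact @MeasurableSet.iUnion _ _ K _ _ fun e =>
        @MeasurableSet.inter _ K _ _ (m2 (measurableSet_singleton e)) (m1 (hV e))
    exact m3.comap_le
  hc := fun Z hZ a h => claimD hinv.measurable Z hZ a h

lemma condEnt_eq (μ : Measure (Λ × (ℕ → E))) [IsProbabilityMeasure μ]
    {G : MeasurableSpace (Λ × (ℕ → E))} (hG : G ≤ Prod.instMeasurableSpace) :
    condEntCyl μ G = (Hs μ xi G).toReal := by
  unfold xi
  rw [Hs_ent hG fc_meas]
  have e : ∀ p, condInfoCyl μ G p = - Real.log (pI μ fc G p) := fun p => rfl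
  unfold condEntCyl
  simp only [e]
  rw [integral_eq_lintegral_of_nonneg_ae]
  · rfl
  · filter_upwards [pI_pos (μ := μ) hG fc_meas, pI_le_one (μ := μ) hG fc_meas] with p h1 h2
    exact neg_nonneg.2 (Real.log_nonpos h1.le h2)
  · exact (pI_meas hG fc_meas).log.neg.aestronglyMeasurable

end ifs
end EntAux

/-- **Theorem (upper bound for the random projectional entropy).**
For any random countable conformal IFS `S` and any `(θ×σ)`-invariant probability `μ`
on `Λ × E^∞` with marginal `m` on `Λ`, one has `h_μ(S) ≤ h(μ)`, where `h(μ)` is the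
Kolmogorov–Sinai entropy of `μ` with respect to `θ×σ`. -/
theorem projEnt_le_ksEnt
    {q : ℕ} {E Λ : Type*} [MeasurableSpace Λ]
    [Countable E] [MeasurableSpace E] [MeasurableSingletonClass E]
    (S : RandomCIFS q E Λ)
    (μ : Measure (Λ × (ℕ → E))) [IsProbabilityMeasure μ]
    (hinv : MeasurePreserving S.Tmap μ μ)
    (hmarg : μ.map Prod.fst = S.m) :
    (projEnt S.θ S.projMap μ : EReal) ≤ (ksEnt μ S.Tmap : EReal) := by
  have hS := EntAux.sys S μ hinv
  have hL := hS.hLA.trans hS.hA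
  have hB : algLpiT S.θ S.projMap ≤ Prod.instMeasurableSpace := by
    rw [EntAux.algT_eq]; exact sup_le hL hS.hA1
  by_cases hc : ksEnt μ S.Tmap = ∞
  · rw [hc]; simp
  unfold projEnt
  rw [EntAux.condEnt_eq μ hB, EntAux.condEnt_eq μ hS.hA, EntAux.algT_eq]
  by_cases h1 : EntAux.Hs μ EntAux.xi (algL ⊔ (algLpi S.projMap).comap S.Tmap) = ∞
  · rw [h1, ENNReal.toReal_top, zero_sub]
    refine le_trans ?_ (EReal.coe_ennreal_nonneg _)
    rw [← EReal.coe_zero, EReal.coe_le_coe_iff]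
    exact neg_nonpos.2 ENNReal.toReal_nonneg
  obtain ⟨h2, h⟩ := hS.main hc h1
  have h3 := ENNReal.toReal_mono (ENNReal.add_ne_top.2 ⟨hc, h2⟩) h
  rw [ENNReal.toReal_add hc h2] at h3
  rw [← EReal.coe_ennreal_toReal hc, EReal.coe_le_coe_iff]
  linarith
end
end

section
/- Let φ₁^λ(x) = (x+λ)/(x+λ+1) and φ₂(x) = x/(x+1) on [0,1], and for λ > 0 let ν_λ be the unique Borel probability measure on [0,1] satisfying ν_λ = (1/2)(φ₁^λ)_*ν_λ + (1/2)(φ₂)_*ν_λ. Then for Lebesgue-almost every λ ∈ [(√3−1)/2, 1/2], the pointwise dimension (equivalently the Hausdorff dimension) of ν_λ is strictly larger than 1/25. -/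
open MeasureTheory Filter Set Metric Function Topology
open scoped ENNReal NNReal

noncomputable section

namespace RandomCF

/-- `φ₁^λ(x) = (x+λ)/(x+λ+1)`. -/
def φ₁ (l x : ℝ) : ℝ := (x + l) / (x + l + 1)

/-- `φ₂(x) = x/(x+1)`. -/
def φ₂ (x : ℝ) : ℝ := x / (x + 1)

end RandomCF

open RandomCF

namespace Lyo

/-- the additive parameter of the letter `b` -/
def par (l : ℝ) (b : Bool) : ℝ := if b then l else 0

/-- the map attached to the letter `b` -/
def Phi (l : ℝ) (b : Bool) (x : ℝ) : ℝ := (x + par l b) / (x + par l b + 1)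

/-- the shift -/
def sh (ω : ℕ → Bool) : ℕ → Bool := fun n => ω (n + 1)

/-- finite compositions -/
def W (l : ℝ) : (ℕ → Bool) → ℕ → ℝ → ℝ
  | _, 0, x => x
  | ω, n + 1, x => Phi l (ω 0) (W l (sh ω) n x)

/-- the coding map -/
def pr (l : ℝ) (ω : ℕ → Bool) : ℝ := ⨆ n, W l ω n 0

lemma par_nonneg {l : ℝ} (hl : 0 ≤ l) (b : Bool) : 0 ≤ par l b := by
  unfold par; split_ifs <;> simp [hl]

lemma par_le {l : ℝ} (hl : 0 ≤ l) (b : Bool) : par l b ≤ l := by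
  unfold par; split_ifs <;> simp [hl]

lemma par_mono {l l' : ℝ} (h : l ≤ l') (b : Bool) : par l b ≤ par l' b := by
  unfold par; split_ifs <;> simp [h]

lemma Phi_sub {l l' : ℝ} (hl : 0 ≤ l) (hl' : 0 ≤ l') (b : Bool) (b' : Bool) {x y : ℝ}
    (hx : 0 ≤ x) (hy : 0 ≤ y) :
    Phi l b x - Phi l' b' y = ((x + par l b) - (y + par l' b')) /
      ((1 + par l b + x) * (1 + par l' b' + y)) := by
  have h1 := par_nonneg hl b
  have h2 := par_nonneg hl' b'
  unfold Phi
  have a1 : x + par l b + 1 ≠ 0 := by positivity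
  have a2 : y + par l' b' + 1 ≠ 0 := by positivity
  have a3 : 1 + par l b + x ≠ 0 := by positivity
  have a4 : 1 + par l' b' + y ≠ 0 := by positivity
  field_simp
  ring

lemma Phi_mem {l : ℝ} (hl : 0 ≤ l) (b : Bool) {x : ℝ} (hx : x ∈ Icc (0:ℝ) 1) :
    Phi l b x ∈ Icc (0:ℝ) 1 := by
  have h1 := par_nonneg hl b
  have h0 := hx.1
  unfold Phi
  constructor
  · positivity
  · rw [div_le_one (by positivity)]; linarith

lemma Phi_mono {l l' : ℝ} (hl : 0 ≤ l) (hll : l ≤ l') (b : Bool) {x y : ℝ} (hx : 0 ≤ x)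
    (hxy : x ≤ y) : Phi l b x ≤ Phi l' b y := by
  have := Phi_sub (hl.trans hll) hl b b (hx.trans hxy) hx
  have h1 := par_nonneg hl b
  have h2 := par_mono hll b
  have h3 : 0 ≤ Phi l' b y - Phi l b x := by
    rw [this]
    apply div_nonneg
    · linarith
    · have : 0 ≤ 1 + par l' b + y := by linarith
      have : 0 ≤ 1 + par l b + x := by linarith
      positivity
  linarith

lemma W_mem {l : ℝ} (hl : 0 ≤ l) (n : ℕ) : ∀ (ω : ℕ → Bool) {x : ℝ}, x ∈ Icc (0:ℝ) 1 →
    W l ω n x ∈ Icc (0:ℝ) 1 := by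
  induction n with
  | zero => intro ω x hx; exact hx
  | succ n ih => intro ω x hx; exact Phi_mem hl _ (ih _ hx)

lemma zero_mem : (0:ℝ) ∈ Icc (0:ℝ) 1 := by simp

lemma W_mono {l l' : ℝ} (hl : 0 ≤ l) (hll : l ≤ l') (n : ℕ) : ∀ (ω : ℕ → Bool) {x y : ℝ},
    x ∈ Icc (0:ℝ) 1 → y ∈ Icc (0:ℝ) 1 → x ≤ y → W l ω n x ≤ W l' ω n y := by
  induction n with
  | zero => intro ω x y _ _ h; exact h
  | succ n ih =>
    intro ω x y hx hy h
    exact Phi_mono hl hll _ (W_mem hl n _ hx).1 (ih _ hx hy h)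

lemma W_succ' (l : ℝ) (n : ℕ) : ∀ (ω : ℕ → Bool) (x : ℝ),
    W l ω (n + 1) x = W l ω n (Phi l (ω n) x) := by
  induction n with
  | zero => intro ω x; rfl
  | succ n ih =>
    intro ω x
    change Phi l (ω 0) (W l (sh ω) (n + 1) x) = Phi l (ω 0) (W l (sh ω) n (Phi l (ω (n+1)) x))
    rw [ih]; rfl

lemma W_mono_n {l : ℝ} (hl : 0 ≤ l) (ω : ℕ → Bool) : Monotone fun n => W l ω n 0 := by
  apply monotone_nat_of_le_succ
  intro n
  rw [W_succ']
  exact W_mono hl le_rfl n ω zero_mem (Phi_mem hl _ zero_mem) (Phi_mem hl _ zero_mem).1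

lemma W_bdd {l : ℝ} (hl : 0 ≤ l) (ω : ℕ → Bool) : BddAbove (range fun n => W l ω n 0) := by
  refine ⟨1, ?_⟩
  rintro _ ⟨n, rfl⟩
  exact (W_mem hl n ω zero_mem).2

lemma W_tendsto {l : ℝ} (hl : 0 ≤ l) (ω : ℕ → Bool) :
    Tendsto (fun n => W l ω n 0) atTop (𝓝 (pr l ω)) :=
  tendsto_atTop_ciSup (W_mono_n hl ω) (W_bdd hl ω)

lemma pr_mem {l : ℝ} (hl : 0 ≤ l) (ω : ℕ → Bool) : pr l ω ∈ Icc (0:ℝ) 1 :=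
  isClosed_Icc.mem_of_tendsto (W_tendsto hl ω) (Eventually.of_forall fun n => W_mem hl n ω zero_mem)

lemma pr_eq {l : ℝ} (hl : 0 ≤ l) (ω : ℕ → Bool) : pr l ω = Phi l (ω 0) (pr l (sh ω)) := by
  have h1 := (W_tendsto hl ω).comp (tendsto_add_atTop_nat 1)
  refine tendsto_nhds_unique h1 ?_
  have h2 := W_tendsto hl (sh ω)
  have h3 := par_nonneg hl (ω 0)
  have h4 := (pr_mem hl (sh ω)).1
  exact (h2.add_const _).div ((h2.add_const _).add_const _) (by positivity)

lemma pr_W {l : ℝ} (hl : 0 ≤ l) (n : ℕ) : ∀ (ω : ℕ → Bool),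
    pr l ω = W l ω n (pr l (sh^[n] ω)) := by
  induction n with
  | zero => intro ω; rfl
  | succ n ih =>
    intro ω
    rw [pr_eq hl, ih (sh ω)]
    rfl

lemma W_congr (l : ℝ) (n : ℕ) : ∀ (ω τ : ℕ → Bool) (x : ℝ), (∀ i < n, ω i = τ i) →
    W l ω n x = W l τ n x := by
  induction n with
  | zero => intros; rfl
  | succ n ih =>
    intro ω τ x h
    change Phi l (ω 0) (W l (sh ω) n x) = Phi l (τ 0) (W l (sh τ) n x)
    rw [h 0 (by omega), ih (sh ω) (sh τ) x (fun i hi => h (i+1) (by omega))]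

lemma W_diam {l : ℝ} (hl : 0 ≤ l) (n : ℕ) : ∀ (ω : ℕ → Bool) {x y : ℝ},
    x ∈ Icc (0:ℝ) 1 → y ∈ Icc (0:ℝ) 1 → |W l ω n x - W l ω n y| ≤ 1 / ((n:ℝ) + 1) := by
  induction n with
  | zero =>
    intro ω x y hx hy
    change |x - y| ≤ _
    rw [abs_le]
    simp only [Nat.cast_zero, zero_add, div_one]
    constructor <;> linarith [hx.1, hx.2, hy.1, hy.2]
  | succ n ih =>
    intro ω x y hx hy
    change |Phi l (ω 0) (W l (sh ω) n x) - Phi l (ω 0) (W l (sh ω) n y)| ≤ _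
    have hX := (W_mem hl n (sh ω) hx).1
    have hY := (W_mem hl n (sh ω) hy).1
    have hd := ih (sh ω) hx hy
    set X := W l (sh ω) n x
    set Y := W l (sh ω) n y
    have hp := par_nonneg hl (ω 0)
    rw [Phi_sub hl hl _ _ hX hY, abs_div, abs_of_pos (a := (1 + par l (ω 0) + X) * _) (by positivity)]
    have e : X + par l (ω 0) - (Y + par l (ω 0)) = X - Y := by ring
    rw [e]
    have hden : 1 + |X - Y| ≤ (1 + par l (ω 0) + X) * (1 + par l (ω 0) + Y) := by
      have : |X - Y| ≤ X + Y := by rw [abs_le]; constructor <;> linarith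
      nlinarith [mul_nonneg hX hY, mul_nonneg hp hX, mul_nonneg hp hY, mul_nonneg hp hp]
    have hn : (0:ℝ) < (n:ℝ) + 1 := by positivity
    have hd' : |X - Y| * ((n:ℝ) + 1) ≤ 1 := by
      rwa [le_div_iff₀ hn] at hd
    rw [div_le_div_iff₀ (by positivity) (by positivity)]
    push_cast
    nlinarith [abs_nonneg (X - Y)]

lemma pr_close {l : ℝ} (hl : 0 ≤ l) (n : ℕ) (ω : ℕ → Bool) {x : ℝ} (hx : x ∈ Icc (0:ℝ) 1) :
    |W l ω n x - pr l ω| ≤ 1 / ((n:ℝ) + 1) := by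
  rw [pr_W hl n ω]
  exact W_diam hl n ω hx (pr_mem hl _)

/-- minus log of the derivative -/
def G (l : ℝ) (ω : ℕ → Bool) : ℝ := 2 * Real.log (1 + par l (ω 0) + pr l (sh ω))

/-- Birkhoff sums of `G` -/
def S (l : ℝ) (ω : ℕ → Bool) (n : ℕ) : ℝ := ∑ k ∈ Finset.range n, G l (sh^[k] ω)

/-- harmonic numbers -/
def Hn (n : ℕ) : ℝ := ∑ k ∈ Finset.range n, 1 / ((k:ℝ) + 1)

lemma S_succ (l : ℝ) (ω : ℕ → Bool) (n : ℕ) : S l ω (n + 1) = G l ω + S l (sh ω) n := by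
  unfold S
  rw [Finset.sum_range_succ', add_comm]
  rfl

lemma Hn_succ (n : ℕ) : Hn (n + 1) = Hn n + 1 / ((n:ℝ) + 1) := by
  unfold Hn; rw [Finset.sum_range_succ]

lemma abs_log_sub_log_le {x y : ℝ} (hx : 1 ≤ x) (hy : 1 ≤ y) :
    |Real.log x - Real.log y| ≤ |x - y| := by
  have key : ∀ a b : ℝ, 1 ≤ a → a ≤ b → Real.log b - Real.log a ≤ b - a := by
    intro a b ha hab
    have ha0 : 0 < a := by linarith
    have hb0 : 0 < b := by linarith
    rw [← Real.log_div (by positivity) (by positivity)]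
    have := Real.log_le_sub_one_of_pos (x := b / a) (by positivity)
    refine this.trans ?_
    have : b / a - 1 = (b - a) / a := by field_simp
    rw [this]
    exact div_le_self (by linarith) ha
  rcases le_total x y with h | h
  · rw [abs_sub_comm, abs_sub_comm x y, abs_of_nonneg (by linarith : 0 ≤ y - x),
      abs_of_nonneg (sub_nonneg.2 (Real.log_le_log (by linarith) h))]
    exact key _ _ hx h
  · rw [abs_of_nonneg (by linarith : 0 ≤ x - y),
      abs_of_nonneg (sub_nonneg.2 (Real.log_le_log (by linarith) h))]
    exact key _ _ hy h

lemma W_dist {l : ℝ} (hl : 0 ≤ l) (n : ℕ) : ∀ (ω : ℕ → Bool) {x y : ℝ},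
    x ∈ Icc (0:ℝ) 1 → y ∈ Icc (0:ℝ) 1 →
    |x - y| * Real.exp (- S l ω n - 2 * Hn n) ≤ |W l ω n x - W l ω n y| ∧
    |W l ω n x - W l ω n y| ≤ |x - y| * Real.exp (- S l ω n + 2 * Hn n) := by
  induction n with
  | zero =>
    intro ω x y hx hy
    simp [S, Hn, W]
  | succ n ih =>
    intro ω x y hx hy
    change _ ≤ |Phi l (ω 0) (W l (sh ω) n x) - Phi l (ω 0) (W l (sh ω) n y)| ∧
      |Phi l (ω 0) (W l (sh ω) n x) - Phi l (ω 0) (W l (sh ω) n y)| ≤ _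
    have hX := (W_mem hl n (sh ω) hx).1
    have hY := (W_mem hl n (sh ω) hy).1
    have hcX := pr_close hl n (sh ω) hx
    have hcY := pr_close hl n (sh ω) hy
    obtain ⟨h1, h2⟩ := ih (sh ω) hx hy
    rw [S_succ, Hn_succ]
    have hpp := (pr_mem hl (sh ω)).1
    unfold G
    set X := W l (sh ω) n x
    set Y := W l (sh ω) n y
    set p := pr l (sh ω)
    have hp := par_nonneg hl (ω 0)
    set a := par l (ω 0)
    have e : X + a - (Y + a) = X - Y := by ring
    rw [Phi_sub hl hl _ _ hX hY, abs_div, abs_of_pos (a := (1 + a + X) * _) (by positivity), e]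
    have lX := abs_log_sub_log_le (x := 1 + a + X) (y := 1 + a + p) (by linarith) (by linarith)
    have lY := abs_log_sub_log_le (x := 1 + a + Y) (y := 1 + a + p) (by linarith) (by linarith)
    rw [show 1 + a + X - (1 + a + p) = X - p by ring] at lX
    rw [show 1 + a + Y - (1 + a + p) = Y - p by ring] at lY
    have lX' := abs_le.1 (lX.trans hcX)
    have lY' := abs_le.1 (lY.trans hcY)
    have hE : |X - Y| / ((1 + a + X) * (1 + a + Y)) =
        |X - Y| * Real.exp (- (Real.log (1 + a + X) + Real.log (1 + a + Y))) := by
      rw [Real.exp_neg, Real.exp_add, Real.exp_log (by positivity), Real.exp_log (by positivity)]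
      rfl
    rw [hE]
    set δ : ℝ := 1 / ((n:ℝ) + 1)
    constructor
    · calc |x - y| * Real.exp (-(2 * Real.log (1 + a + p) + S l (sh ω) n) - 2 * (Hn n + δ))
          = |x - y| * Real.exp (- S l (sh ω) n - 2 * Hn n) *
            Real.exp (- (2 * Real.log (1 + a + p)) - 2 * δ) := by
              rw [mul_assoc, ← Real.exp_add]; ring_nf
        _ ≤ _ := by
              apply mul_le_mul h1 _ (by positivity) (by positivity)
              apply Real.exp_le_exp.2
              linarith [lX'.2, lY'.2]
    · calc |X - Y| * Real.exp (-(Real.log (1 + a + X) + Real.log (1 + a + Y)))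
          ≤ |x - y| * Real.exp (- S l (sh ω) n + 2 * Hn n) *
            Real.exp (- (2 * Real.log (1 + a + p)) + 2 * δ) := by
              apply mul_le_mul h2 _ (by positivity) (by positivity)
              apply Real.exp_le_exp.2
              linarith [lX'.1, lY'.1]
        _ = _ := by
              rw [mul_assoc, ← Real.exp_add]; ring_nf

lemma G_nonneg {l : ℝ} (hl : 0 ≤ l) (ω : ℕ → Bool) : 0 ≤ G l ω := by
  have := par_nonneg hl (ω 0)
  have := (pr_mem hl (sh ω)).1
  exact mul_nonneg (by norm_num) (Real.log_nonneg (by linarith))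

lemma G_le {l : ℝ} (hl : 0 ≤ l) (ω : ℕ → Bool) : G l ω ≤ 2 * (l + 1) := by
  have h1 := par_nonneg hl (ω 0)
  have h2 := (pr_mem hl (sh ω))
  have h3 := Real.log_le_sub_one_of_pos (x := 1 + par l (ω 0) + pr l (sh ω)) (by linarith [h2.1])
  have h4 := par_le hl (ω 0)
  unfold G
  linarith [h2.2]

lemma pr_mono {l l' : ℝ} (hl : 0 ≤ l) (hll : l ≤ l') (ω : ℕ → Bool) : pr l ω ≤ pr l' ω :=
  le_of_tendsto_of_tendsto' (W_tendsto hl ω) (W_tendsto (hl.trans hll) ω)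
    fun n => W_mono hl hll n ω zero_mem zero_mem le_rfl

lemma G_mono {l l' : ℝ} (hl : 0 ≤ l) (hll : l ≤ l') (ω : ℕ → Bool) : G l ω ≤ G l' ω := by
  have h1 := par_nonneg hl (ω 0)
  have h2 := (pr_mem hl (sh ω)).1
  have h3 := par_mono hll (ω 0)
  have h4 := pr_mono hl hll (sh ω)
  unfold G
  apply mul_le_mul_of_nonneg_left _ (by norm_num)
  apply Real.log_le_log <;> linarith

lemma S_mono {l l' : ℝ} (hl : 0 ≤ l) (hll : l ≤ l') (ω : ℕ → Bool) (n : ℕ) :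
    S l ω n ≤ S l' ω n := Finset.sum_le_sum fun _ _ => G_mono hl hll _

lemma W_lip {l l' : ℝ} (hl : 0.366 ≤ l) (hll : l ≤ l') (n : ℕ) : ∀ (ω : ℕ → Bool),
    W l' ω n 0 - W l ω n 0 ≤ 1.16 * (l' - l) := by
  have hl0 : (0:ℝ) ≤ l := le_trans (by norm_num) hl
  induction n with
  | zero => intro ω; simp only [W]; nlinarith
  | succ n ih =>
    intro ω
    change Phi l' (ω 0) (W l' (sh ω) n 0) - Phi l (ω 0) (W l (sh ω) n 0) ≤ _
    have h := ih (sh ω)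
    have hX := (W_mem (hl0.trans hll) n (sh ω) zero_mem).1
    have hY := (W_mem hl0 n (sh ω) zero_mem).1
    set X := W l' (sh ω) n 0
    set Y := W l (sh ω) n 0
    rw [Phi_sub (hl0.trans hll) hl0 _ _ hX hY]
    cases ω 0 with
    | false =>
      simp only [par]
      rw [div_le_iff₀ (by simp; positivity)]
      simp
      have : 1 ≤ (1 + X) * (1 + Y) := by nlinarith [mul_nonneg hX hY]
      nlinarith [mul_nonneg (sub_nonneg.2 hll) (sub_nonneg.2 this)]
    | true =>
      simp only [par, if_true]
      have hl'0 := hl0.trans hll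
      rw [div_le_iff₀ (by positivity)]
      have : 1.86595 ≤ (1 + l' + X) * (1 + l + Y) := by
        have h1 : 1.366 ≤ 1 + l' + X := by linarith
        have h2 : 1.366 ≤ 1 + l + Y := by linarith
        nlinarith
      nlinarith [mul_nonneg (sub_nonneg.2 hll) (sub_nonneg.2 this)]

lemma pr_lip {l l' : ℝ} (hl : 0.366 ≤ l) (hll : l ≤ l') (ω : ℕ → Bool) :
    pr l' ω - pr l ω ≤ 1.16 * (l' - l) := by
  have hl0 : (0:ℝ) ≤ l := le_trans (by norm_num) hl
  exact le_of_tendsto' ((W_tendsto (hl0.trans hll) ω).sub (W_tendsto hl0 ω))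
    fun n => W_lip hl hll n ω

lemma G_lip {l l' : ℝ} (hl : 0.366 ≤ l) (hll : l ≤ l') (ω : ℕ → Bool) :
    G l' ω ≤ G l ω + 5 * (l' - l) := by
  have hl0 : (0:ℝ) ≤ l := le_trans (by norm_num) hl
  have h1 := par_nonneg hl0 (ω 0)
  have h2 := (pr_mem hl0 (sh ω)).1
  have h3 := par_mono hll (ω 0)
  have h4 := pr_mono hl0 hll (sh ω)
  have h5 := pr_lip hl hll (sh ω)
  have h6 : par l' (ω 0) - par l (ω 0) ≤ l' - l := by unfold par; split_ifs <;> simp [hll]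
  have h7 := abs_log_sub_log_le (x := 1 + par l' (ω 0) + pr l' (sh ω))
    (y := 1 + par l (ω 0) + pr l (sh ω)) (by linarith) (by linarith)
  have h8 := (abs_le.1 h7).2
  rw [abs_of_nonneg (by linarith)] at h8
  unfold G
  linarith

lemma W_half {l : ℝ} (hl : 0 ≤ l) (hl2 : l ≤ 1/2) (n : ℕ) : ∀ (ω : ℕ → Bool),
    W l ω n 0 ≤ 1/2 := by
  induction n with
  | zero => intro ω; simp [W]
  | succ n ih =>
    intro ω
    change Phi l (ω 0) (W l (sh ω) n 0) ≤ _
    have h := ih (sh ω)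
    have hY := (W_mem hl n (sh ω) zero_mem).1
    have hp := par_nonneg hl (ω 0)
    have hp' := par_le hl (ω 0)
    unfold Phi
    rw [div_le_iff₀ (by positivity)]
    linarith

lemma pr_half {l : ℝ} (hl : 0 ≤ l) (hl2 : l ≤ 1/2) (ω : ℕ → Bool) : pr l ω ≤ 1/2 :=
  le_of_tendsto' (W_tendsto hl ω) fun n => W_half hl hl2 n ω

/-- transversality, one ordering -/
lemma transv_aux {l₁ l₂ t : ℝ} (h1 : 0.366 ≤ l₁) (h12 : l₁ ≤ l₂) (h2 : l₂ ≤ 1/2)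
    (ω τ : ℕ → Bool) (hω : ω 0 = true) (hτ : τ 0 = false)
    (ht₁ : |pr l₁ ω - pr l₁ τ| ≤ t) (ht₂ : |pr l₂ ω - pr l₂ τ| ≤ t) : l₂ - l₁ ≤ 100 * t := by
  have h10 : (0:ℝ) ≤ l₁ := le_trans (by norm_num) h1
  have h20 : (0:ℝ) ≤ l₂ := h10.trans h12
  have key : ∀ l : ℝ, 0 ≤ l → l ≤ 1/2 → |pr l ω - pr l τ| ≤ t →
      |pr l (sh ω) + l - pr l (sh τ)| ≤ 5 * t := by
    intro l hl hl2 h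
    have a0 := pr_mem hl (sh ω)
    have b0 := pr_mem hl (sh τ)
    rw [pr_eq hl ω, pr_eq hl τ, hω, hτ, Phi_sub hl hl _ _ a0.1 b0.1] at h
    simp only [par, if_true, Bool.false_eq_true, if_false, add_zero] at h
    have := a0.1
    have := b0.1
    rw [abs_div, abs_of_pos (a := (1 + l + _) * _) (by positivity), div_le_iff₀ (by positivity)] at h
    refine h.trans ?_
    have ht0 : 0 ≤ t := by
      by_contra hc
      push Not at hc
      have : t * ((1 + l + pr l (sh ω)) * (1 + pr l (sh τ))) < 0 :=
        mul_neg_of_neg_of_pos hc (by positivity)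
      linarith [abs_nonneg (pr l (sh ω) + l - pr l (sh τ))]
    rw [mul_comm]
    apply mul_le_mul_of_nonneg_right _ ht0
    nlinarith [a0.2, b0.2]
  have k1 := abs_le.1 (key l₁ h10 (h12.trans h2) ht₁)
  have k2 := abs_le.1 (key l₂ h20 h2 ht₂)
  by_cases hη : 0.01 < 5 * t
  · linarith
  push Not at hη
  have a1 := (pr_mem h10 (sh ω)).1
  have a2 := (pr_mem h20 (sh ω)).1
  have am := pr_mono h10 h12 (sh ω)
  have c1 := (pr_mem h10 (sh (sh τ)))
  have c2 := (pr_mem h20 (sh (sh τ)))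
  have cm := pr_mono h10 h12 (sh (sh τ))
  have cl := pr_lip h1 h12 (sh (sh τ))
  have ch := pr_half h10 (h12.trans h2) (sh (sh τ))
  rw [pr_eq h10 (sh τ)] at k1
  rw [pr_eq h20 (sh τ)] at k2
  cases hb : sh τ 0 with
  | false =>
    exfalso
    rw [hb] at k1
    have : Phi l₁ false (pr l₁ (sh (sh τ))) ≤ 1/3 := by
      simp only [Phi, par, Bool.false_eq_true, if_false, add_zero]
      have := c1.1
      rw [div_le_iff₀ (by positivity)]
      linarith
    linarith [k1.1]
  | true =>
    rw [hb] at k1 k2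
    have hsub := Phi_sub h20 h10 true true c2.1 c1.1
    simp only [par, if_true] at hsub
    set c := pr l₁ (sh (sh τ))
    set c' := pr l₂ (sh (sh τ))
    have e1 : 1 - Phi l₁ true c = 1 / (1 + l₁ + c) := by
      have := c1.1
      simp only [Phi, par, if_true]; field_simp; ring
    have e2 : 1 - Phi l₂ true c' = 1 / (1 + l₂ + c') := by
      have := c2.1
      simp only [Phi, par, if_true]; field_simp; ring
    have e3 : Phi l₂ true c' - Phi l₁ true c =
        (c' + l₂ - (c + l₁)) * ((1 - Phi l₁ true c) * (1 - Phi l₂ true c')) := by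
      rw [hsub, e1, e2]
      have := c1.1
      have := c2.1
      field_simp
    have p1 : 0 ≤ 1 - Phi l₁ true c := by
      rw [e1]; have := c1.1; positivity
    have p2 : 0 ≤ 1 - Phi l₂ true c' := by
      rw [e2]; have := c2.1; positivity
    have q1 : 1 - Phi l₁ true c ≤ 0.644 := by linarith [k1.2]
    have q2 : 1 - Phi l₂ true c' ≤ 0.644 := by linarith [k2.2]
    have q3 : (1 - Phi l₁ true c) * (1 - Phi l₂ true c') ≤ 0.644 * 0.644 :=
      mul_le_mul q1 q2 p2 (by norm_num)
    have q4 : Phi l₂ true c' - Phi l₁ true c ≤ 0.9 * (l₂ - l₁) := by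
      rw [e3]
      calc (c' + l₂ - (c + l₁)) * ((1 - Phi l₁ true c) * (1 - Phi l₂ true c'))
          ≤ (2.16 * (l₂ - l₁)) * (0.644 * 0.644) :=
            mul_le_mul (by linarith) q3 (mul_nonneg p1 p2) (by linarith)
        _ ≤ _ := by nlinarith
    linarith [k1.1, k1.2, k2.1, k2.2]

lemma transv {l₁ l₂ t : ℝ} (h1 : 0.366 ≤ l₁) (h1' : l₁ ≤ 1/2) (h2 : 0.366 ≤ l₂) (h2' : l₂ ≤ 1/2)
    (ω τ : ℕ → Bool) (h : ω 0 ≠ τ 0)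
    (ht₁ : |pr l₁ ω - pr l₁ τ| ≤ t) (ht₂ : |pr l₂ ω - pr l₂ τ| ≤ t) : |l₁ - l₂| ≤ 100 * t := by
  have main : ∀ ω τ : ℕ → Bool, ω 0 = true → τ 0 = false → |pr l₁ ω - pr l₁ τ| ≤ t →
      |pr l₂ ω - pr l₂ τ| ≤ t → |l₁ - l₂| ≤ 100 * t := by
    intro ω τ hω hτ ht₁ ht₂
    rcases le_total l₁ l₂ with h12 | h12
    · rw [abs_sub_comm, abs_of_nonneg (by linarith)]
      exact transv_aux h1 h12 h2' ω τ hω hτ ht₁ ht₂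
    · rw [abs_of_nonneg (by linarith)]
      exact transv_aux h2 h12 h1' ω τ hω hτ ht₂ ht₁
  cases hω : ω 0 <;> cases hτ : τ 0
  · simp [hω, hτ] at h
  · exact main τ ω hτ hω (by rwa [abs_sub_comm]) (by rwa [abs_sub_comm])
  · exact main ω τ hω hτ ht₁ ht₂
  · simp [hω, hτ] at h

end Lyo

namespace Lyo

open ProbabilityTheory

/-- fair coin -/
def coin : Measure Bool := (2 : ℝ≥0∞)⁻¹ • Measure.dirac true + (2 : ℝ≥0∞)⁻¹ • Measure.dirac false

instance : IsProbabilityMeasure coin := ⟨by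
  simp [coin, ENNReal.inv_two_add_inv_two]⟩

/-- Bernoulli measure -/
def P : Measure (ℕ → Bool) := Measure.infinitePi fun _ => coin

instance : IsProbabilityMeasure P := by unfold P; infer_instance

/-- prepend a letter -/
def cns (b : Bool) (ω : ℕ → Bool) : ℕ → Bool
  | 0 => b
  | n + 1 => ω n

lemma sh_cns (b : Bool) (ω : ℕ → Bool) : sh (cns b ω) = ω := rfl

lemma measurable_cns : Measurable fun p : Bool × (ℕ → Bool) => cns p.1 p.2 := by
  rw [measurable_pi_iff]
  intro n
  cases n with
  | zero => exact measurable_fst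
  | succ n => exact (measurable_pi_apply n).comp measurable_snd

lemma measurable_cns' (b : Bool) : Measurable fun ω : ℕ → Bool => cns b ω :=
  measurable_cns.comp (measurable_const.prodMk measurable_id)

lemma measurable_sh : Measurable sh := by
  rw [measurable_pi_iff]
  intro n
  exact measurable_pi_apply (n + 1)

lemma P_cons : (coin.prod P).map (fun p => cns p.1 p.2) = P := by
  apply Measure.eq_infinitePi
  intro s t ht
  classical
  obtain ⟨N, hN⟩ : ∃ N, s ⊆ Finset.range (N + 1) := by
    refine ⟨s.sup id, fun i hi => ?_⟩
    have : id i ≤ s.sup id := Finset.le_sup hi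
    simp only [id] at this
    exact Finset.mem_range.2 (by omega)
  let t' : ℕ → Set Bool := fun i => if i ∈ s then t i else univ
  have h1 : Set.pi (s : Set ℕ) t = Set.pi (Finset.range (N + 1) : Finset ℕ) t' := by
    ext x
    simp only [Set.mem_pi, Finset.mem_coe, t']
    constructor
    · intro h i _
      split_ifs with hi
      · exact h i hi
      · trivial
    · intro h i hi
      have := h i (hN hi)
      rwa [if_pos hi] at this
  have h2 : ∏ i ∈ s, coin (t i) = ∏ i ∈ Finset.range (N + 1), coin (t' i) := by
    rw [← Finset.prod_subset hN (f := fun i => coin (t' i))]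
    · apply Finset.prod_congr rfl
      intro i hi
      simp [t', hi]
    · intro i _ hi
      have : t' i = univ := by simp only [t', hi, if_false]
      rw [this]
      exact measure_univ
  have ht' : ∀ i, MeasurableSet (t' i) := fun i => MeasurableSet.of_discrete
  rw [h1, h2, Measure.map_apply measurable_cns
    (MeasurableSet.pi (Finset.countable_toSet _) (fun i _ => ht' i))]
  have h3 : (fun p : Bool × (ℕ → Bool) => cns p.1 p.2) ⁻¹'
      (Set.pi (Finset.range (N + 1) : Finset ℕ) t') =
      t' 0 ×ˢ Set.pi (Finset.range N : Finset ℕ) (fun i => t' (i + 1)) := by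
    ext ⟨b, ω⟩
    simp only [mem_preimage, Set.mem_pi, Finset.mem_coe, Finset.mem_range, mem_prod]
    constructor
    · intro h
      exact ⟨h 0 (by omega), fun i hi => h (i + 1) (by omega)⟩
    · rintro ⟨h0, h⟩ i hi
      cases i with
      | zero => exact h0
      | succ i => exact h i (by omega)
  rw [h3, Measure.prod_prod, Finset.prod_range_succ', mul_comm]
  congr 1
  exact Measure.infinitePi_pi _ (fun i _ => ht' _)

lemma lintegral_P {F : (ℕ → Bool) → ℝ≥0∞} (hF : Measurable F) :
    ∫⁻ ω, F ω ∂P = 2⁻¹ * ∫⁻ ω, F (cns true ω) ∂P + 2⁻¹ * ∫⁻ ω, F (cns false ω) ∂P := by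
  conv_lhs => rw [← P_cons]
  rw [lintegral_map hF measurable_cns, lintegral_prod (fun a : Bool × (ℕ → Bool) => F (cns a.1 a.2))
    (hF.comp measurable_cns).aemeasurable]
  simp [coin]

lemma mp_sh : MeasurePreserving sh P P := by
  refine ⟨measurable_sh, ?_⟩
  conv_lhs => rw [← P_cons]
  rw [Measure.map_map measurable_sh measurable_cns]
  have : (sh ∘ fun p : Bool × (ℕ → Bool) => cns p.1 p.2) = Prod.snd := by
    funext p; rfl
  rw [this, Measure.map_snd_prod, measure_univ, one_smul]

lemma P_cyl (ω : ℕ → Bool) (n : ℕ) : P {τ | ∀ i < n, τ i = ω i} = (2⁻¹ : ℝ≥0∞) ^ n := by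
  have h : {τ : ℕ → Bool | ∀ i < n, τ i = ω i} =
      Set.pi (Finset.range n : Finset ℕ) (fun i => {ω i}) := by
    ext τ; simp [Set.mem_pi]
  rw [h]
  unfold P
  rw [Measure.infinitePi_pi _ (fun i _ => MeasurableSet.of_discrete)]
  have : ∀ b : Bool, coin {b} = 2⁻¹ := by
    intro b; cases b <;> simp [coin]
  simp [this]

lemma measurableSet_cyl (ω : ℕ → Bool) (n : ℕ) : MeasurableSet {τ : ℕ → Bool | ∀ i < n, τ i = ω i} := by
  have h : {τ : ℕ → Bool | ∀ i < n, τ i = ω i} =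
      Set.pi (Finset.range n : Finset ℕ) (fun i => {ω i}) := by
    ext τ; simp [Set.mem_pi]
  rw [h]
  exact MeasurableSet.pi (Finset.countable_toSet _) (fun i _ => MeasurableSet.of_discrete)

lemma measurable_par : Measurable fun p : ℝ × Bool => par p.1 p.2 := by
  unfold par
  refine Measurable.ite ?_ measurable_fst measurable_const
  exact measurable_snd (MeasurableSet.of_discrete (s := {true}))

lemma measurable_Phi : Measurable fun p : ℝ × Bool × ℝ => Phi p.1 p.2.1 p.2.2 := by
  unfold Phi
  have h : Measurable fun p : ℝ × Bool × ℝ => par p.1 p.2.1 :=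
    measurable_par.comp (measurable_fst.prodMk (measurable_fst.comp measurable_snd))
  have h2 : Measurable fun p : ℝ × Bool × ℝ => p.2.2 := measurable_snd.comp measurable_snd
  exact (h2.add h).div ((h2.add h).add_const 1)

lemma measurable_W (n : ℕ) :
    Measurable fun p : ℝ × (ℕ → Bool) × ℝ => W p.1 p.2.1 n p.2.2 := by
  induction n with
  | zero => exact measurable_snd.comp measurable_snd
  | succ n ih =>
    have hw : Measurable fun p : ℝ × (ℕ → Bool) × ℝ => p.2.1 := measurable_fst.comp measurable_snd
    have h1 : Measurable fun p : ℝ × (ℕ → Bool) × ℝ => W p.1 (sh p.2.1) n p.2.2 :=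
      ih.comp (measurable_fst.prodMk ((measurable_sh.comp hw).prodMk
        (measurable_snd.comp measurable_snd)))
    exact measurable_Phi.comp (measurable_fst.prodMk
      (((measurable_pi_apply 0).comp hw).prodMk h1))

lemma measurable_pr : Measurable fun p : ℝ × (ℕ → Bool) => pr p.1 p.2 := by
  unfold pr
  apply Measurable.iSup
  intro n
  exact (measurable_W n).comp (measurable_fst.prodMk (measurable_snd.prodMk measurable_const))

lemma measurable_pr' (l : ℝ) : Measurable (pr l) :=
  measurable_pr.comp (measurable_const.prodMk measurable_id)

lemma measurable_G (l : ℝ) : Measurable (G l) := by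
  unfold G
  apply Measurable.const_mul
  apply Measurable.log
  apply Measurable.add
  · exact (measurable_par.comp (measurable_const.prodMk (measurable_pi_apply 0))).const_add 1
  · exact (measurable_pr' l).comp measurable_sh

lemma measurable_S (l : ℝ) (n : ℕ) : Measurable fun ω => S l ω n := by
  unfold S
  apply Finset.measurable_sum
  intro k _
  exact (measurable_G l).comp (measurable_sh.iterate k)

/-- the Lyapunov exponent -/
def chi (l : ℝ) : ℝ := ∫ ω, G l ω ∂P

lemma integrable_G {l : ℝ} (hl : 0 ≤ l) : Integrable (G l) P := by
  refine Integrable.of_bound (measurable_G l).aestronglyMeasurable (2 * (l + 1))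
    (Eventually.of_forall fun ω => ?_)
  rw [Real.norm_eq_abs, abs_of_nonneg (G_nonneg hl ω)]
  exact G_le hl ω

lemma chi_le {l : ℝ} (hl : 0 ≤ l) : chi l ≤ 2 * (l + 1) := by
  have := integral_mono (integrable_G hl) (integrable_const (μ := P) (2 * (l + 1))) (G_le hl)
  simpa [chi] using this

lemma chi_nonneg {l : ℝ} (hl : 0 ≤ l) : 0 ≤ chi l := integral_nonneg (G_nonneg hl)

lemma chi_lip {l l' : ℝ} (hl : 0.366 ≤ l) (hll : l ≤ l') : chi l' ≤ chi l + 5 * (l' - l) := by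
  have hl0 : (0:ℝ) ≤ l := le_trans (by norm_num) hl
  have := integral_mono (integrable_G (hl0.trans hll))
    ((integrable_G hl0).add (integrable_const (μ := P) (5 * (l' - l)))) (G_lip hl hll)
  simp only [Pi.add_apply] at this
  rw [integral_add (integrable_G hl0) (integrable_const _)] at this
  simpa [chi] using this

lemma chi_pos {l : ℝ} (hl : 0 < l) : 0 < chi l := by
  have hm := measurableSet_cyl (fun _ => true) 1
  have hlog : 0 < Real.log (1 + l) := Real.log_pos (by linarith)
  have hle : ∀ ω, ({τ : ℕ → Bool | ∀ i < 1, τ i = true}.indicator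
      (fun _ => 2 * Real.log (1 + l))) ω ≤ G l ω := by
    intro ω
    by_cases h : ω ∈ {τ : ℕ → Bool | ∀ i < 1, τ i = true}
    · rw [indicator_of_mem h]
      have h0 : ω 0 = true := h 0 (by omega)
      have := (pr_mem hl.le (sh ω)).1
      unfold G
      rw [h0]
      simp only [par, if_true]
      have := Real.log_le_log (x := 1 + l) (y := 1 + l + pr l (sh ω)) (by linarith) (by linarith)
      linarith
    · rw [indicator_of_notMem h]
      exact G_nonneg hl.le ω
  have := integral_mono ((integrable_const (μ := P) (2 * Real.log (1 + l))).indicator hm)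
    (integrable_G hl.le) hle
  rw [integral_indicator_const _ hm] at this
  have h2 := P_cyl (fun _ => true) 1
  simp only [Measure.real, h2] at this
  have h3 : (((2:ℝ≥0∞)⁻¹ ^ 1).toReal) = 1/2 := by simp
  rw [h3] at this
  unfold chi
  simp only [smul_eq_mul] at this
  linarith

lemma sh_iter (k : ℕ) : ∀ (ω : ℕ → Bool) (i : ℕ), (sh^[k] ω) i = ω (i + k) := by
  induction k with
  | zero => intro ω i; rfl
  | succ k ih =>
    intro ω i
    rw [iterate_succ_apply, ih]
    change ω _ = _
    congr 1

lemma pr_agree {l : ℝ} (hl : 0 ≤ l) (n : ℕ) (ω τ : ℕ → Bool) (h : ∀ i < n, ω i = τ i) :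
    |pr l ω - pr l τ| ≤ 1 / ((n:ℝ) + 1) := by
  rw [pr_W hl n ω, pr_W hl n τ, W_congr l n ω τ _ h]
  exact W_diam hl n τ (pr_mem hl _) (pr_mem hl _)

lemma S_agree {l : ℝ} (hl : 0 ≤ l) (n : ℕ) : ∀ (ω τ : ℕ → Bool), (∀ i < n, ω i = τ i) →
    |S l ω n - S l τ n| ≤ 2 * Hn n := by
  induction n with
  | zero => intro ω τ _; simp [S, Hn]
  | succ n ih =>
    intro ω τ h
    have h1 := ih (sh ω) (sh τ) (fun i hi => h (i+1) (by omega))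
    have h2 := pr_agree hl n (sh ω) (sh τ) (fun i hi => h (i+1) (by omega))
    rw [S_succ, S_succ, Hn_succ]
    have h3 : |G l ω - G l τ| ≤ 2 * (1 / ((n:ℝ) + 1)) := by
      unfold G
      rw [h 0 (by omega)]
      have a := par_nonneg hl (τ 0)
      have b := (pr_mem hl (sh ω)).1
      have c := (pr_mem hl (sh τ)).1
      have := abs_log_sub_log_le (x := 1 + par l (τ 0) + pr l (sh ω))
        (y := 1 + par l (τ 0) + pr l (sh τ)) (by linarith) (by linarith)
      rw [← mul_sub, abs_mul, abs_two]
      apply mul_le_mul_of_nonneg_left _ (by norm_num)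
      refine this.trans ?_
      have e : 1 + par l (τ 0) + pr l (sh ω) - (1 + par l (τ 0) + pr l (sh τ)) =
        pr l (sh ω) - pr l (sh τ) := by ring
      rw [e]
      exact h2
    calc |G l ω + S l (sh ω) n - (G l τ + S l (sh τ) n)|
        = |(G l ω - G l τ) + (S l (sh ω) n - S l (sh τ) n)| := by ring_nf
      _ ≤ |G l ω - G l τ| + |S l (sh ω) n - S l (sh τ) n| := abs_add_le _ _
      _ ≤ _ := by linarith

/-- truncation -/
def trunc (m : ℕ) (ω : ℕ → Bool) : ℕ → Bool := fun i => if i < m then ω i else false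

lemma S_add (l : ℝ) (ω : ℕ → Bool) (a b : ℕ) : S l ω (a + b) = S l ω a + S l (sh^[a] ω) b := by
  unfold S
  rw [Finset.sum_range_add]
  congr 1
  apply Finset.sum_congr rfl
  intro k _
  rw [add_comm, iterate_add_apply]

lemma S_mul (l : ℝ) (ω : ℕ → Bool) (m N : ℕ) :
    S l ω (N * m) = ∑ j ∈ Finset.range N, S l (sh^[j * m] ω) m := by
  induction N with
  | zero => simp [S]
  | succ N ih => rw [Nat.succ_mul, S_add, ih, Finset.sum_range_succ]

/-- block variables -/
def X (l : ℝ) (m j : ℕ) (ω : ℕ → Bool) : ℝ := S l (trunc m (sh^[j * m] ω)) m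

lemma measurable_trunc (m : ℕ) : Measurable (trunc m) := by
  rw [measurable_pi_iff]
  intro i
  by_cases h : i < m
  · simp only [trunc, h, if_true]; exact measurable_pi_apply i
  · simp only [trunc, h, if_false]; exact measurable_const

lemma measurable_X (l : ℝ) (m j : ℕ) : Measurable (X l m j) :=
  (measurable_S l m).comp ((measurable_trunc m).comp (measurable_sh.iterate _))

lemma S_nonneg {l : ℝ} (hl : 0 ≤ l) (ω : ℕ → Bool) (n : ℕ) : 0 ≤ S l ω n :=
  Finset.sum_nonneg fun _ _ => G_nonneg hl _

lemma S_le {l : ℝ} (hl : 0 ≤ l) (ω : ℕ → Bool) (n : ℕ) : S l ω n ≤ n * (2 * (l + 1)) := by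
  have : S l ω n ≤ ∑ k ∈ Finset.range n, 2 * (l + 1) :=
    Finset.sum_le_sum fun _ _ => G_le hl _
  simpa using this

lemma integrable_S {l : ℝ} (hl : 0 ≤ l) (n : ℕ) {f : (ℕ → Bool) → (ℕ → Bool)}
    (hf : Measurable f) : Integrable (fun ω => S l (f ω) n) P := by
  refine Integrable.of_bound ((measurable_S l n).comp hf).aestronglyMeasurable (n * (2 * (l + 1)))
    (Eventually.of_forall fun ω => ?_)
  rw [Real.norm_eq_abs, abs_of_nonneg (S_nonneg hl _ _)]
  exact S_le hl _ _

lemma indep_X (l : ℝ) (m : ℕ) {i j : ℕ} (hij : i ≠ j) : IndepFun (X l m i) (X l m j) P := by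
  have h0 : iIndepFun (fun (i : ℕ) (ω : ℕ → Bool) => ω i) P :=
    iIndepFun_infinitePi (P := fun _ : ℕ => coin) (X := fun _ => id) (fun _ => measurable_id)
  let I : ℕ → Finset ℕ := fun j => Finset.Ico (j * m) (j * m + m)
  have hdis : Disjoint (I i) (I j) := by
    rw [Finset.disjoint_left]
    intro a ha hb
    simp only [I, Finset.mem_Ico] at ha hb
    rcases lt_or_gt_of_ne hij with h | h
    · have : (i + 1) * m ≤ j * m := Nat.mul_le_mul_right m h
      rw [Nat.succ_mul] at this
      omega
    · have : (j + 1) * m ≤ i * m := Nat.mul_le_mul_right m h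
      rw [Nat.succ_mul] at this
      omega
  have h1 := h0.indepFun_finset (I i) (I j) hdis (fun i => measurable_pi_apply i)
  let F : (j : ℕ) → (I j → Bool) → ℝ := fun j z =>
    S l (fun k => if h : k < m then z ⟨k + j * m, by simp only [I, Finset.mem_Ico]; omega⟩ else false) m
  have hX : ∀ j, X l m j = F j ∘ (fun ω (k : I j) => ω k) := by
    intro j
    funext ω
    simp only [X, F, comp]
    congr 1
    funext k
    by_cases hk : k < m
    · simp only [trunc, hk, if_true, dif_pos]
      rw [sh_iter]
    · simp [trunc, hk]
  rw [hX i, hX j]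
  exact h1.comp (measurable_of_finite _) (measurable_of_finite _)

lemma ident_X (l : ℝ) (m j : ℕ) : IdentDistrib (X l m j) (X l m 0) P P := by
  refine ⟨(measurable_X l m j).aemeasurable, (measurable_X l m 0).aemeasurable, ?_⟩
  have h : ∀ j, P.map (X l m j) = P.map (fun ω => S l (trunc m ω) m) := by
    intro j
    have h1 : X l m j = (fun ω => S l (trunc m ω) m) ∘ sh^[j * m] := rfl
    have h2 : Measurable fun ω => S l (trunc m ω) m :=
      (measurable_S l m).comp (measurable_trunc m)
    rw [h1, ← Measure.map_map h2
      (measurable_sh.iterate _), (mp_sh.iterate _).map_eq]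
  rw [h, h]

lemma integral_S {l : ℝ} (hl : 0 ≤ l) (n : ℕ) : ∫ ω, S l ω n ∂P = n * chi l := by
  unfold S
  rw [integral_finsetSum]
  · have : ∀ k, ∫ ω, G l (sh^[k] ω) ∂P = chi l := by
      intro k
      have h := (mp_sh.iterate k)
      unfold chi
      conv_rhs => rw [← h.map_eq]
      rw [integral_map h.measurable.aemeasurable (measurable_G l).aestronglyMeasurable]
    simp [this]
  · intro k _
    exact (mp_sh.iterate k).integrable_comp_of_integrable (integrable_G hl)

lemma Hn_nonneg (n : ℕ) : 0 ≤ Hn n := Finset.sum_nonneg fun _ _ => by positivity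

lemma tendsto_Hn : Tendsto (fun n : ℕ => Hn n / n) atTop (𝓝 0) := by
  have := (tendsto_one_div_add_atTop_nhds_zero_nat (𝕜 := ℝ)).cesaro
  refine this.congr fun n => ?_
  unfold Hn
  rw [div_eq_inv_mul]

lemma trunc_agree (m : ℕ) (ω : ℕ → Bool) : ∀ i < m, ω i = trunc m ω i := by
  intro i hi; simp [trunc, hi]

lemma lln {l : ℝ} (hl : 0 ≤ l) :
    ∀ᵐ ω ∂P, Tendsto (fun n : ℕ => S l ω n / n) atTop (𝓝 (chi l)) := by
  have h1 : ∀ m, ∀ᵐ ω ∂P, Tendsto (fun n : ℕ => (∑ i ∈ Finset.range n, X l m i ω) / n) atTop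
      (𝓝 (P[X l m 0])) := fun m =>
    strong_law_ae_real (X l m) (integrable_S hl m ((measurable_trunc m).comp (measurable_sh.iterate _)))
      (fun i j hij => indep_X l m hij) (ident_X l m)
  rw [← ae_all_iff] at h1
  filter_upwards [h1] with ω hω
  rw [Metric.tendsto_atTop]
  intro ε hε
  have hH := (tendsto_Hn.eventually (gt_mem_nhds (show (0:ℝ) < ε / 12 by positivity))).and
    (eventually_ge_atTop 1)
  obtain ⟨m, hm, hm1⟩ := hH.exists
  have hm0 : (0:ℝ) < m := by exact_mod_cast hm1
  set κ := P[X l m 0] with hκ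
  set B := 2 * (l + 1) with hB
  have hB0 : 0 ≤ B := by positivity
  have hκ' : |κ - m * chi l| ≤ 2 * Hn m := by
    have i1 : Integrable (X l m 0) P :=
      integrable_S hl m ((measurable_trunc m).comp (measurable_sh.iterate _))
    have i2 : Integrable (fun ω => S l ω m) P := integrable_S hl m measurable_id
    rw [hκ, ← integral_S hl m, ← integral_sub i1 i2]
    have := norm_integral_le_of_norm_le_const (μ := P)
      (f := fun ω => X l m 0 ω - S l ω m) (C := 2 * Hn m) (Eventually.of_forall fun ω => by
        rw [Real.norm_eq_abs, abs_sub_comm]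
        have := S_agree hl m ω (trunc m ω) (trunc_agree m ω)
        simpa [X] using this)
    simpa using this
  have hdiv : Tendsto (fun n : ℕ => n / m) atTop atTop := Nat.tendsto_div_const_atTop (by omega)
  have hA := (Metric.tendsto_atTop.1 ((hω m).comp hdiv)) (ε / 3) (by positivity)
  obtain ⟨N₁, hN₁⟩ := hA
  obtain ⟨N₂, hN₂⟩ := exists_nat_gt (2 * m * B / (ε / 3))
  refine ⟨max (max N₁ N₂) m, fun n hn => ?_⟩
  have hn1 : N₁ ≤ n := le_trans (le_max_left _ _) (le_trans (le_max_left _ _) hn)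
  have hn2 : N₂ ≤ n := le_trans (le_max_right _ _) (le_trans (le_max_left _ _) hn)
  have hn3 : m ≤ n := le_trans (le_max_right _ _) hn
  have hn0 : (0:ℝ) < n := by exact_mod_cast (by omega : 0 < n)
  have h2 := hN₁ n hn1
  simp only [comp, Real.dist_eq] at h2 ⊢
  set N := n / m with hNdef
  have hNpos : 0 < N := Nat.div_pos hn3 (by omega)
  have hNR : (0:ℝ) < N := by exact_mod_cast hNpos
  set A := ∑ i ∈ Finset.range N, X l m i ω with hAdef
  have hNm : N * m ≤ n := Nat.div_mul_le_self n m
  have hNmR : (N:ℝ) * m ≤ n := by exact_mod_cast hNm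
  have hr : n - N * m < m := by
    have := Nat.mod_lt n (show m > 0 by omega)
    have h := Nat.div_add_mod n m
    rw [mul_comm, ← hNdef] at h
    clear_value N
    omega
  have hrR : (n:ℝ) - N * m ≤ m := by
    have : ((n - N * m : ℕ) : ℝ) ≤ m := by exact_mod_cast hr.le
    rw [Nat.cast_sub hNm] at this
    push_cast at this
    exact this
  -- pieces
  have p1 : |S l ω n - S l ω (N * m)| ≤ m * B := by
    have e : S l ω n = S l ω (N * m) + S l (sh^[N * m] ω) (n - N * m) := by
      rw [← S_add]; congr 1; omega
    rw [e, add_sub_cancel_left, abs_of_nonneg (S_nonneg hl _ _)]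
    refine (S_le hl _ _).trans ?_
    apply mul_le_mul_of_nonneg_right _ hB0
    exact_mod_cast hr.le
  have p2 : |S l ω (N * m) - A| ≤ N * (2 * Hn m) := by
    rw [S_mul, hAdef, ← Finset.sum_sub_distrib]
    refine (Finset.abs_sum_le_sum_abs _ _).trans ?_
    have : ∑ j ∈ Finset.range N, |S l (sh^[j * m] ω) m - X l m j ω| ≤
        ∑ j ∈ Finset.range N, 2 * Hn m :=
      Finset.sum_le_sum fun j _ => S_agree hl m _ _ (trunc_agree m _)
    simpa using this
  have p3 : |A - N * κ| ≤ N * (ε / 3) := by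
    have e : A - N * κ = N * (A / N - κ) := by field_simp
    rw [e, abs_mul, abs_of_pos hNR]
    exact mul_le_mul_of_nonneg_left h2.le hNR.le
  have p4 : |N * κ - N * m * chi l| ≤ N * (2 * Hn m) := by
    have e : N * κ - N * m * chi l = N * (κ - m * chi l) := by ring
    rw [e, abs_mul, abs_of_pos hNR]
    exact mul_le_mul_of_nonneg_left hκ' hNR.le
  have p5 : |N * m * chi l - n * chi l| ≤ m * B := by
    have e : N * m * chi l - n * chi l = - ((n - N * m) * chi l) := by ring
    rw [e, abs_neg, abs_of_nonneg (mul_nonneg (by linarith) (chi_nonneg hl))]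
    exact mul_le_mul hrR (chi_le hl) (chi_nonneg hl) hm0.le
  have hHm : Hn m ≤ m * (ε / 12) := by
    rw [div_lt_iff₀ hm0] at hm
    linarith
  have q1 : (N:ℝ) * (2 * Hn m) ≤ n * (ε / 6) := by
    calc (N:ℝ) * (2 * Hn m) ≤ N * (2 * (m * (ε / 12))) := by gcongr
      _ = (N * m) * (ε / 6) := by ring
      _ ≤ _ := by gcongr
  have q2 : (N:ℝ) * (ε / 3) ≤ n * (ε / 3) := by
    have : (N:ℝ) ≤ n := by
      exact_mod_cast Nat.div_le_self n m
    gcongr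
  have q3 : 2 * m * B < n * (ε / 3) := by
    have : 2 * m * B / (ε / 3) < n := lt_of_lt_of_le hN₂ (by exact_mod_cast hn2)
    rwa [div_lt_iff₀ (by positivity)] at this
  have tot : |S l ω n - n * chi l| < n * ε := by
    rw [abs_lt]
    rw [abs_le] at p1 p2 p3 p4 p5
    constructor <;> linarith [p1.1, p1.2, p2.1, p2.2, p3.1, p3.2, p4.1, p4.2, p5.1, p5.2]
  have e : S l ω n / n - chi l = (S l ω n - n * chi l) / n := by field_simp
  rw [e, abs_div, abs_of_pos hn0, div_lt_iff₀ hn0, mul_comm ε]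
  exact tot

end Lyo

namespace Lyo

lemma W_cns (l : ℝ) (b : Bool) (ω : ℕ → Bool) (n : ℕ) (x : ℝ) :
    W l (cns b ω) (n + 1) x = Phi l b (W l ω n x) := rfl

lemma measurable_Phi' (l : ℝ) (b : Bool) : Measurable (Phi l b) :=
  measurable_Phi.comp (measurable_const.prodMk (measurable_const.prodMk measurable_id))

lemma measurable_W' (l : ℝ) (n : ℕ) : Measurable fun p : ℝ × (ℕ → Bool) => W l p.2 n p.1 :=
  (measurable_W n).comp (measurable_const.prodMk (measurable_snd.prodMk measurable_fst))

lemma nu_step {l : ℝ} (ν : Measure ℝ) [IsProbabilityMeasure ν]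
    (hself : ν = (2 : ℝ≥0∞)⁻¹ • ν.map (Phi l true) + (2 : ℝ≥0∞)⁻¹ • ν.map (Phi l false))
    (n : ℕ) : ∀ F : ℝ → ℝ≥0∞, Measurable F →
      ∫⁻ x, ∫⁻ ω, F (W l ω n x) ∂P ∂ν = ∫⁻ x, F x ∂ν := by
  induction n with
  | zero => intro F hF; simp [W]
  | succ n ih =>
    intro F hF
    have h1 : ∀ x, ∫⁻ ω, F (W l ω (n + 1) x) ∂P =
        2⁻¹ * ∫⁻ ω, F (Phi l true (W l ω n x)) ∂P + 2⁻¹ * ∫⁻ ω, F (Phi l false (W l ω n x)) ∂P := by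
      intro x
      rw [lintegral_P (F := fun ω => F (W l ω (n + 1) x))
        (hF.comp ((measurable_W' l (n+1)).comp (measurable_const.prodMk measurable_id)))]
      rfl
    simp_rw [h1]
    have hm : ∀ b, Measurable fun x => ∫⁻ ω, F (Phi l b (W l ω n x)) ∂P := by
      intro b
      exact Measurable.lintegral_prod_right'
        (f := fun p : ℝ × (ℕ → Bool) => F (Phi l b (W l p.2 n p.1)))
        (hF.comp ((measurable_Phi' l b).comp (measurable_W' l n)))
    rw [lintegral_add_left ((hm true).const_mul _), lintegral_const_mul _ (hm true),
      lintegral_const_mul _ (hm false), ih (fun y => F (Phi l true y)) (hF.comp (measurable_Phi' l _)),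
      ih (fun y => F (Phi l false y)) (hF.comp (measurable_Phi' l _))]
    conv_rhs => rw [hself]
    rw [lintegral_add_measure, lintegral_smul_measure, lintegral_smul_measure,
      lintegral_map hF (measurable_Phi' l _), lintegral_map hF (measurable_Phi' l _)]
    rfl

lemma nu_eq {l : ℝ} (hl : 0 ≤ l) (ν : Measure ℝ) [IsProbabilityMeasure ν]
    (hsupp : ν (Set.Icc (0 : ℝ) 1)ᶜ = 0)
    (hself : ν = (2 : ℝ≥0∞)⁻¹ • ν.map (Phi l true) + (2 : ℝ≥0∞)⁻¹ • ν.map (Phi l false)) :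
    ν = P.map (pr l) := by
  apply ext_of_forall_lintegral_eq_of_IsFiniteMeasure
  intro f
  have hf : Measurable fun x => (f x : ℝ≥0∞) := measurable_coe_nnreal_ennreal.comp f.continuous.measurable
  rw [lintegral_map hf (measurable_pr' l)]
  have h1 : ∀ n, ∫⁻ p, (f (W l p.2 n p.1) : ℝ≥0∞) ∂(ν.prod P) = ∫⁻ x, f x ∂ν := by
    intro n
    rw [← nu_step ν hself n (fun x => (f x : ℝ≥0∞)) hf]
    exact lintegral_prod (fun p : ℝ × (ℕ → Bool) => (f (W l p.2 n p.1) : ℝ≥0∞))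
      (hf.comp (measurable_W' l n)).aemeasurable
  have h2 : ∫⁻ p, (f (pr l p.2) : ℝ≥0∞) ∂(ν.prod P) = ∫⁻ ω, (f (pr l ω) : ℝ≥0∞) ∂P := by
    rw [lintegral_prod (fun p : ℝ × (ℕ → Bool) => (f (pr l p.2) : ℝ≥0∞))
      (hf.comp ((measurable_pr' l).comp measurable_snd)).aemeasurable]
    simp
  have hae : ∀ᵐ p ∂(ν.prod P), p.1 ∈ Icc (0:ℝ) 1 := by
    have : ∀ᵐ x ∂ν, x ∈ Icc (0:ℝ) 1 := by
      rw [ae_iff]; exact hsupp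
    exact Measure.quasiMeasurePreserving_fst.ae this
  have h3 : Tendsto (fun n => ∫⁻ p, (f (W l p.2 n p.1) : ℝ≥0∞) ∂(ν.prod P)) atTop
      (𝓝 (∫⁻ p, (f (pr l p.2) : ℝ≥0∞) ∂(ν.prod P))) := by
    apply tendsto_lintegral_of_dominated_convergence (fun _ => (nndist f 0 : ℝ≥0∞))
    · intro n; exact hf.comp (measurable_W' l n)
    · intro n
      refine Eventually.of_forall fun p => ?_
      exact ENNReal.coe_le_coe.2 (BoundedContinuousFunction.NNReal.upper_bound f _)
    · simp
    · filter_upwards [hae] with p hp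
      have : Tendsto (fun n => W l p.2 n p.1) atTop (𝓝 (pr l p.2)) := by
        rw [tendsto_iff_dist_tendsto_zero]
        refine squeeze_zero (fun _ => dist_nonneg) (fun n => ?_)
          (tendsto_one_div_add_atTop_nhds_zero_nat (𝕜 := ℝ))
        rw [Real.dist_eq]
        exact pr_close hl n p.2 hp
      exact ENNReal.tendsto_coe.2 ((f.continuous.tendsto _).comp this)
  simp_rw [h1] at h3
  rw [h2] at h3
  exact tendsto_nhds_unique tendsto_const_nhds h3

/-- close pairs at scale `exp (-k)` -/
def Z (k : ℕ) : Set (ℝ × (ℕ → Bool) × (ℕ → Bool)) :=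
  {p | |pr p.1 p.2.1 - pr p.1 p.2.2| < Real.exp (-(k:ℝ))}

lemma measurableSet_Z (k : ℕ) : MeasurableSet (Z k) := by
  have h1 : Measurable fun p : ℝ × (ℕ → Bool) × (ℕ → Bool) => pr p.1 p.2.1 :=
    measurable_pr.comp (measurable_fst.prodMk (measurable_fst.comp measurable_snd))
  have h2 : Measurable fun p : ℝ × (ℕ → Bool) × (ℕ → Bool) => pr p.1 p.2.2 :=
    measurable_pr.comp (measurable_fst.prodMk (measurable_snd.comp measurable_snd))
  exact measurableSet_lt (by simpa using (h1.sub h2).norm) measurable_const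

/-- mass of the ball of radius `exp (-k)` -/
def A (k : ℕ) (l : ℝ) (ω : ℕ → Bool) : ℝ≥0∞ :=
  P {τ | |pr l ω - pr l τ| < Real.exp (-(k:ℝ))}

lemma measurable_A (k : ℕ) : Measurable fun p : ℝ × (ℕ → Bool) => A k p.1 p.2 := by
  have hZ : MeasurableSet {q : (ℝ × (ℕ → Bool)) × (ℕ → Bool) | (q.1.1, q.1.2, q.2) ∈ Z k} :=
    (by fun_prop : Measurable fun q : (ℝ × (ℕ → Bool)) × (ℕ → Bool) => (q.1.1, q.1.2, q.2))
      (measurableSet_Z k)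
  exact measurable_measure_prodMk_left (ν := P) hZ

lemma A_swap (k : ℕ) (ω : ℕ → Bool) (m : Measure ℝ) [SFinite m] :
    ∫⁻ l, A k l ω ∂m = ∫⁻ τ, m {l | |pr l ω - pr l τ| < Real.exp (-(k:ℝ))} ∂P := by
  have hZ : MeasurableSet {q : ℝ × (ℕ → Bool) | (q.1, ω, q.2) ∈ Z k} :=
    (by fun_prop : Measurable fun q : ℝ × (ℕ → Bool) => (q.1, ω, q.2))
      (measurableSet_Z k)
  have h1 := Measure.prod_apply (μ := m) (ν := P) hZ
  have h2 := Measure.prod_apply_symm (μ := m) (ν := P) hZ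
  exact h1.symm.trans h2

lemma pair_est {q γ C r s : ℝ} (hq2 : q ≤ 1/2) (hr : 0 < r) (hs0 : 0 < s) (hs1 : s < 1)
    (hγ : 0 < γ)
    (ω : ℕ → Bool) (hω : ∀ n, S q ω n + 2 * Hn n ≤ C + γ * n) (τ : ℕ → Bool) :
    volume.restrict (Icc 0.366 q) {l | |pr l ω - pr l τ| < r} ≤
      ∑' n : ℕ, {τ | ∀ i < n, τ i = ω i}.indicator
        (fun _ => ENNReal.ofReal ((100 * r * Real.exp (C + γ * n)) ^ s)) τ := by
  by_cases hτ : τ = ω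
  · subst hτ
    have h0 : ENNReal.ofReal ((100 * r * Real.exp C) ^ s) ≠ 0 := by
      have : 0 < (100 * r * Real.exp C) ^ s := by positivity
      simpa using this
    have h1 : ∑' n : ℕ, ENNReal.ofReal ((100 * r * Real.exp C) ^ s) = ⊤ :=
      ENNReal.tsum_const_eq_top_of_ne_zero h0
    refine le_top.trans (h1.symm.le.trans (ENNReal.tsum_le_tsum fun n => ?_))
    rw [indicator_of_mem (by simp)]
    apply ENNReal.ofReal_le_ofReal
    have : C ≤ C + γ * n := by nlinarith [mul_nonneg hγ.le (Nat.cast_nonneg (α := ℝ) n)]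
    gcongr
  have hex : ∃ n, τ n ≠ ω n := by
    by_contra hc
    push Not at hc
    exact hτ (funext hc)
  classical
  let n := Nat.find hex
  have hn : τ n ≠ ω n := Nat.find_spec hex
  have hag : ∀ i < n, τ i = ω i := fun i hi => not_not.1 (Nat.find_min hex hi)
  refine le_trans ?_ (ENNReal.le_tsum n)
  rw [indicator_of_mem (by exact hag)]
  set t := r * Real.exp (C + γ * n) with ht
  have ht0 : 0 < t := by positivity
  have e : 100 * r * Real.exp (C + γ * n) = 100 * t := by rw [ht]; ring
  rw [e]
  have hsm : MeasurableSet {l : ℝ | |pr l ω - pr l τ| < r} := by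
    have h1 : Measurable fun l : ℝ => pr l ω := measurable_pr.comp (measurable_id.prodMk measurable_const)
    have h2 : Measurable fun l : ℝ => pr l τ := measurable_pr.comp (measurable_id.prodMk measurable_const)
    exact measurableSet_lt (by simpa using (h1.sub h2).norm) measurable_const
  rw [Measure.restrict_apply hsm]
  have hkey : ∀ l ∈ {l | |pr l ω - pr l τ| < r} ∩ Icc 0.366 q,
      |pr l (sh^[n] ω) - pr l (sh^[n] τ)| ≤ t := by
    rintro l ⟨hl, hl1, hl2⟩
    have hl0 : (0:ℝ) ≤ l := le_trans (by norm_num) hl1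
    have hd := (W_dist hl0 n ω (pr_mem hl0 (sh^[n] ω)) (pr_mem hl0 (sh^[n] τ))).1
    rw [← pr_W hl0 n ω, ← W_congr l n τ ω _ hag, ← pr_W hl0 n τ] at hd
    have hS := S_mono hl0 hl2 ω n
    have h3 : Real.exp (-(C + γ * n)) ≤ Real.exp (-S l ω n - 2 * Hn n) := by
      apply Real.exp_le_exp.2
      linarith [hω n]
    have h4 : |pr l (sh^[n] ω) - pr l (sh^[n] τ)| * Real.exp (-(C + γ * n)) < r :=
      lt_of_le_of_lt (mul_le_mul_of_nonneg_left h3 (abs_nonneg _)) (lt_of_le_of_lt hd hl)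
    rw [Real.exp_neg, ← div_eq_mul_inv, div_lt_iff₀ (Real.exp_pos _)] at h4
    exact h4.le
  have hne : (sh^[n] ω) 0 ≠ (sh^[n] τ) 0 := by
    rw [sh_iter, sh_iter, zero_add]; exact hn.symm
  have hv1 : volume ({l | |pr l ω - pr l τ| < r} ∩ Icc 0.366 q) ≤ ENNReal.ofReal (100 * t) := by
    refine (Real.volume_le_diam _).trans ?_
    apply ediam_le
    intro x hx y hy
    rw [edist_dist, Real.dist_eq]
    apply ENNReal.ofReal_le_ofReal
    exact transv hx.2.1 (hx.2.2.trans hq2) hy.2.1 (hy.2.2.trans hq2) _ _ hne (hkey x hx) (hkey y hy)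
  have hv2 : volume ({l | |pr l ω - pr l τ| < r} ∩ Icc 0.366 q) ≤ ENNReal.ofReal 1 := by
    refine (measure_mono inter_subset_right).trans ?_
    rw [Real.volume_Icc]
    apply ENNReal.ofReal_le_ofReal
    linarith
  by_cases h1 : 100 * t ≤ 1
  · refine hv1.trans (ENNReal.ofReal_le_ofReal ?_)
    have := Real.rpow_le_rpow_of_exponent_ge (x := 100 * t) (by positivity) h1 hs1.le
    rwa [Real.rpow_one] at this
  · refine hv2.trans (ENNReal.ofReal_le_ofReal ?_)
    push Not at h1
    exact Real.one_le_rpow h1.le hs0.le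

lemma int_est {q γ C s : ℝ} (hq2 : q ≤ 1/2) (hs0 : 0 < s) (hs1 : s < 1)
    (hγ : 0 < γ) (k : ℕ)
    (ω : ℕ → Bool) (hω : ∀ n, S q ω n + 2 * Hn n ≤ C + γ * n) :
    ∫⁻ l in Icc 0.366 q, A k l ω ≤
      (ENNReal.ofReal ((100 * Real.exp C) ^ s) *
        ∑' n : ℕ, (ENNReal.ofReal (Real.exp (γ * s) / 2)) ^ n) * ENNReal.ofReal (Real.exp (-s * k)) := by
  rw [A_swap k ω]
  refine (lintegral_mono fun τ => pair_est hq2 (Real.exp_pos (-(k:ℝ))) hs0 hs1 hγ ω hω τ).trans ?_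
  rw [lintegral_tsum (fun n => (measurable_const.indicator (measurableSet_cyl ω n)).aemeasurable)]
  simp_rw [lintegral_indicator_const (measurableSet_cyl ω _), P_cyl]
  rw [mul_assoc, mul_comm (∑' n : ℕ, _), ← mul_assoc, ← ENNReal.tsum_mul_left]
  apply le_of_eq
  congr 1
  funext n
  rw [← ENNReal.ofReal_mul (by positivity), ← ENNReal.ofReal_pow (by positivity),
    ← ENNReal.ofReal_mul (by positivity)]
  have h2 : ((2:ℝ≥0∞)⁻¹) ^ n = ENNReal.ofReal ((1/2) ^ n) := by
    rw [ENNReal.ofReal_pow (by norm_num)]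
    congr 1
    rw [one_div, ENNReal.ofReal_inv_of_pos (by norm_num)]
    simp
  rw [h2, ← ENNReal.ofReal_mul (by positivity)]
  congr 1
  have e1 : (100 * Real.exp (-(k:ℝ)) * Real.exp (C + γ * n)) =
      (100 * Real.exp C) * Real.exp (-(k:ℝ) + γ * n) := by
    rw [Real.exp_add, Real.exp_add]; ring
  rw [e1, Real.mul_rpow (by positivity) (by positivity), ← Real.exp_mul]
  have e2 : Real.exp ((-(k:ℝ) + γ * n) * s) = Real.exp (-s * k) * Real.exp (γ * s) ^ n := by
    rw [← Real.exp_nat_mul, ← Real.exp_add]; ring_nf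
  rw [e2, div_pow, div_pow, one_pow]
  ring

lemma ae_bound {q γ : ℝ} (hq : 0 ≤ q) (hγ : chi q < γ) :
    ∀ᵐ ω ∂P, ∃ C : ℕ, ∀ n, S q ω n + 2 * Hn n ≤ C + γ * n := by
  filter_upwards [lln hq] with ω hω
  have h1 : Tendsto (fun n : ℕ => S q ω n / n + 2 * (Hn n / n)) atTop (𝓝 (chi q + 2 * 0)) :=
    hω.add (tendsto_Hn.const_mul 2)
  rw [mul_zero, add_zero] at h1
  have h2 := (h1.eventually (gt_mem_nhds hγ)).and (eventually_ge_atTop 1)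
  have h3 : ∀ᶠ n : ℕ in atTop, S q ω n + 2 * Hn n - γ * n ≤ 0 := by
    filter_upwards [h2] with n hn
    have hn0 : (0:ℝ) < n := by exact_mod_cast hn.2
    have h4 := hn.1
    have e : S q ω n / n + 2 * (Hn n / n) = (S q ω n + 2 * Hn n) / n := by ring
    rw [e, div_lt_iff₀ hn0] at h4
    linarith
  have h4 : BddAbove (range fun n : ℕ => S q ω n + 2 * Hn n - γ * n) :=
    (Filter.isBoundedUnder_of_eventually_le h3).bddAbove_range
  obtain ⟨B, hB⟩ := h4
  obtain ⟨C, hC⟩ := exists_nat_ge B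
  refine ⟨C, fun n => ?_⟩
  have : S q ω n + 2 * Hn n - γ * n ≤ B := hB ⟨n, rfl⟩
  linarith

lemma measurable_sumA (s : ℝ) : Measurable fun p : ℝ × (ℕ → Bool) =>
    ∑' k : ℕ, ENNReal.ofReal (Real.exp (s * k)) * A k p.1 p.2 :=
  Measurable.tsum fun k => (measurable_A k).const_mul _

lemma measurable_A_left (k : ℕ) (ω : ℕ → Bool) : Measurable fun l : ℝ => A k l ω :=
  Measurable.of_uncurry_right (f := A k) (measurable_A k)

lemma measurable_A_right (k : ℕ) (l : ℝ) : Measurable fun ω => A k l ω :=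
  Measurable.of_uncurry_left (f := A k) (measurable_A k)

lemma measurable_sumA_right (s l : ℝ) : Measurable fun ω : ℕ → Bool =>
    ∑' k : ℕ, ENNReal.ofReal (Real.exp (s * k)) * A k l ω :=
  Measurable.tsum fun k => (measurable_A_right k l).const_mul _

lemma sum_est {q s s' : ℝ} (ω : ℕ → Bool) (K : ℝ≥0∞)
    (h : ∀ k : ℕ, ∫⁻ l in Icc 0.366 q, A k l ω ≤ K * ENNReal.ofReal (Real.exp (-s' * k))) :
    ∫⁻ l in Icc 0.366 q, ∑' k : ℕ, ENNReal.ofReal (Real.exp (s * k)) * A k l ω ≤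
      K * ∑' k : ℕ, (ENNReal.ofReal (Real.exp (s - s'))) ^ k := by
  have hmA : ∀ k, Measurable fun l => A k l ω := fun k => measurable_A_left k ω
  rw [lintegral_tsum fun k => ((hmA k).const_mul _).aemeasurable, ← ENNReal.tsum_mul_left]
  apply ENNReal.tsum_le_tsum
  intro k
  rw [lintegral_const_mul _ (hmA k)]
  refine (mul_le_mul' le_rfl (h k)).trans ?_
  rw [mul_left_comm, ← ENNReal.ofReal_mul (by positivity), ← Real.exp_add,
    ← ENNReal.ofReal_pow (by positivity), ← Real.exp_nat_mul]
  apply le_of_eq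
  congr 3
  ring

set_option maxHeartbeats 800000 in
lemma lower {q s : ℝ} (hq1 : 0.366 ≤ q) (hq2 : q ≤ 1/2) (hs0 : 0 < s) (hs1 : s < 1)
    (hs : s * chi q < Real.log 2) :
    ∀ᵐ l ∂(volume.restrict (Icc 0.366 q)), ∀ᵐ ω ∂P,
      ∑' k : ℕ, ENNReal.ofReal (Real.exp (s * k)) * A k l ω < ⊤ := by
  have hq0 : (0:ℝ) < q := lt_of_lt_of_le (by norm_num) hq1
  have hchi := chi_pos hq0
  obtain ⟨s', hs's, hs'2⟩ : ∃ s', s < s' ∧ s' < min 1 (Real.log 2 / chi q) :=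
    exists_between (lt_min hs1 (by rwa [lt_div_iff₀ hchi]))
  have hs'1 : s' < 1 := lt_of_lt_of_le hs'2 (min_le_left _ _)
  have hs'3 : s' < Real.log 2 / chi q := lt_of_lt_of_le hs'2 (min_le_right _ _)
  rw [lt_div_iff₀ hchi] at hs'3
  have hs'0 : 0 < s' := hs0.trans hs's
  obtain ⟨γ, hγ1, hγ2⟩ : ∃ γ, chi q < γ ∧ γ < Real.log 2 / s' :=
    exists_between (by rw [lt_div_iff₀ hs'0]; linarith)
  rw [lt_div_iff₀ hs'0] at hγ2
  have hγ0 : 0 < γ := hchi.trans hγ1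
  have hρ : Real.exp (γ * s') / 2 < 1 := by
    rw [div_lt_one (by norm_num)]
    calc Real.exp (γ * s') < Real.exp (Real.log 2) := Real.exp_lt_exp.2 hγ2
      _ = 2 := Real.exp_log (by norm_num)
  let Om : ℕ → Set (ℕ → Bool) := fun C => {ω | ∀ n, S q ω n + 2 * Hn n ≤ C + γ * n}
  have hOm : ∀ C, MeasurableSet (Om C) := by
    intro C
    have : Om C = ⋂ n : ℕ, {ω | S q ω n + 2 * Hn n ≤ C + γ * n} := by
      ext ω; simp [Om]
    rw [this]
    exact MeasurableSet.iInter fun n =>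
      measurableSet_le ((measurable_S q n).add_const _) measurable_const
  have main : ∀ C : ℕ, ∀ᵐ l ∂(volume.restrict (Icc 0.366 q)), ∀ᵐ ω ∂(P.restrict (Om C)),
      ∑' k : ℕ, ENNReal.ofReal (Real.exp (s * k)) * A k l ω < ⊤ := by
    intro C
    set K := (ENNReal.ofReal ((100 * Real.exp C) ^ s') *
        ∑' n : ℕ, (ENNReal.ofReal (Real.exp (γ * s') / 2)) ^ n) with hK
    have hKtop : K ≠ ⊤ := by
      apply ENNReal.mul_ne_top ENNReal.ofReal_ne_top
      rw [ENNReal.tsum_geometric]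
      apply ENNReal.inv_ne_top.2
      refine (tsub_pos_iff_lt.2 ?_).ne'
      rw [← ENNReal.ofReal_one]
      exact (ENNReal.ofReal_lt_ofReal_iff (by norm_num)).2 hρ
    have hfin : ∫⁻ l in Icc 0.366 q, ∫⁻ ω, ∑' k : ℕ, ENNReal.ofReal (Real.exp (s * k)) * A k l ω
        ∂(P.restrict (Om C)) ≠ ⊤ := by
      rw [lintegral_lintegral_swap (f := fun l ω => ∑' k : ℕ, ENNReal.ofReal (Real.exp (s * k)) * A k l ω)
        (measurable_sumA s).aemeasurable]
      have hb : ∀ ω ∈ Om C, ∫⁻ l in Icc 0.366 q, ∑' k : ℕ, ENNReal.ofReal (Real.exp (s * k)) * A k l ω ≤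
          K * ∑' k : ℕ, (ENNReal.ofReal (Real.exp (s - s'))) ^ k := by
        intro ω hω
        exact sum_est ω K (fun k => int_est hq2 hs'0 hs'1 hγ0 k ω hω)
      refine ne_top_of_le_ne_top ?_ (setLIntegral_mono measurable_const hb)
      rw [setLIntegral_const]
      apply ENNReal.mul_ne_top _ (measure_ne_top _ _)
      apply ENNReal.mul_ne_top hKtop
      rw [ENNReal.tsum_geometric]
      apply ENNReal.inv_ne_top.2
      refine (tsub_pos_iff_lt.2 ?_).ne'
      rw [← ENNReal.ofReal_one]
      apply (ENNReal.ofReal_lt_ofReal_iff (by norm_num)).2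
      rw [Real.exp_lt_one_iff]
      linarith
    have hmeas : Measurable fun l => ∫⁻ ω, ∑' k : ℕ, ENNReal.ofReal (Real.exp (s * k)) * A k l ω
        ∂(P.restrict (Om C)) := Measurable.lintegral_prod_right' (measurable_sumA s)
    filter_upwards [ae_lt_top hmeas hfin] with l hl
    exact ae_lt_top (measurable_sumA_right s l) hl.ne
  rw [← ae_all_iff] at main
  filter_upwards [main] with l hl
  have hl' : ∀ C, ∀ᵐ ω ∂P, ω ∈ Om C →
      ∑' k : ℕ, ENNReal.ofReal (Real.exp (s * k)) * A k l ω < ⊤ := fun C =>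
    (ae_restrict_iff' (hOm C)).1 (hl C)
  rw [← ae_all_iff] at hl'
  filter_upwards [hl', ae_bound hq0.le hγ1] with ω h1 h2
  obtain ⟨C, hC⟩ := h2
  exact h1 C hC

lemma lower_all : ∀ᵐ l ∂(volume.restrict (Icc (0.366:ℝ) (1/2))), ∀ s : ℚ, 0 < (s:ℝ) → (s:ℝ) < 1 →
    (s:ℝ) * chi l < Real.log 2 → ∀ᵐ ω ∂P,
      ∑' k : ℕ, ENNReal.ofReal (Real.exp ((s:ℝ) * k)) * A k l ω < ⊤ := by
  have h1 : ∀ q s : ℚ, ∀ᵐ l : ℝ, 0.366 ≤ (q:ℝ) → (q:ℝ) ≤ 1/2 → 0 < (s:ℝ) → (s:ℝ) < 1 →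
      (s:ℝ) * chi q < Real.log 2 → l ∈ Icc (0.366:ℝ) q → ∀ᵐ ω ∂P,
      ∑' k : ℕ, ENNReal.ofReal (Real.exp ((s:ℝ) * k)) * A k l ω < ⊤ := by
    intro q s
    by_cases h : 0.366 ≤ (q:ℝ) ∧ (q:ℝ) ≤ 1/2 ∧ 0 < (s:ℝ) ∧ (s:ℝ) < 1 ∧ (s:ℝ) * chi q < Real.log 2
    · obtain ⟨a, b, c, d, e⟩ := h
      have := (ae_restrict_iff' measurableSet_Icc).1 (lower a b c d e)
      filter_upwards [this] with l hl _ _ _ _ _ hm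
      exact hl hm
    · refine Eventually.of_forall fun l a b c d e => ?_
      exact absurd ⟨a, b, c, d, e⟩ h
  have h2 : ∀ᵐ l : ℝ, l ≠ 1/2 := by
    rw [ae_iff]; simp
  rw [ae_restrict_iff' measurableSet_Icc]
  have h1' := ae_all_iff.2 fun q => ae_all_iff.2 fun s => h1 q s
  filter_upwards [h1', h2] with l hl hne hmem s hs0 hs1 hs
  have hlt : l < 1/2 := lt_of_le_of_ne hmem.2 hne
  obtain ⟨q, hq1, hq2⟩ := exists_rat_btwn (show l < min (1/2) (l + (Real.log 2 - s * chi l) / 5) by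
    apply lt_min hlt
    linarith)
  have hq3 := lt_of_lt_of_le hq2 (min_le_left _ _)
  have hq4 := lt_of_lt_of_le hq2 (min_le_right _ _)
  refine hl q s (hmem.1.trans hq1.le) hq3.le hs0 hs1 ?_ ⟨hmem.1, hq1.le⟩
  have := chi_lip hmem.1 hq1.le
  nlinarith

lemma upper {l γ : ℝ} (hl : 0 ≤ l) (hγ : γ < chi l) :
    ∀ᵐ ω ∂P, ∀ᶠ n : ℕ in atTop, ∀ τ, (∀ i < n, τ i = ω i) →
      |pr l ω - pr l τ| < Real.exp (- (γ * n)) := by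
  filter_upwards [lln hl] with ω hω
  have h1 : Tendsto (fun n : ℕ => S l ω n / n - 2 * (Hn n / n)) atTop (𝓝 (chi l - 2 * 0)) :=
    hω.sub (tendsto_Hn.const_mul 2)
  rw [mul_zero, sub_zero] at h1
  filter_upwards [h1.eventually (lt_mem_nhds hγ), eventually_ge_atTop 1] with n hn hn1 τ hτ
  have hn0 : (0:ℝ) < n := by exact_mod_cast hn1
  have e : S l ω n / n - 2 * (Hn n / n) = (S l ω n - 2 * Hn n) / n := by ring
  rw [e, lt_div_iff₀ hn0] at hn
  have hd := (W_dist hl n ω (pr_mem hl (sh^[n] ω)) (pr_mem hl (sh^[n] τ))).2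
  rw [← pr_W hl n ω, ← W_congr l n τ ω _ hτ, ← pr_W hl n τ] at hd
  refine hd.trans_lt ?_
  have a := pr_mem hl (sh^[n] ω)
  have b := pr_mem hl (sh^[n] τ)
  have hab : |pr l (sh^[n] ω) - pr l (sh^[n] τ)| ≤ 1 := by
    rw [abs_le]; constructor <;> linarith [a.1, a.2, b.1, b.2]
  calc _ ≤ 1 * Real.exp (-S l ω n + 2 * Hn n) := by gcongr
    _ < _ := by
      rw [one_mul]
      apply Real.exp_lt_exp.2
      linarith

end Lyo

namespace Lyo

lemma seq_to_full {m : ℝ → ℝ} {d : ℝ} (hm : Monotone m) (hpos : ∀ r, 0 < r → 0 < m r)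
    (h1 : ∀ r, m r ≤ 1)
    (h : Tendsto (fun k : ℕ => -Real.log (m (Real.exp (-(k:ℝ)))) / k) atTop (𝓝 d)) :
    Tendsto (fun r => Real.log (m r) / Real.log r) (𝓝[>] 0) (𝓝 d) := by
  let g : ℝ → ℝ := fun u => -Real.log (m (Real.exp (-u)))
  have hg : Monotone g := by
    intro u v huv
    have : m (Real.exp (-v)) ≤ m (Real.exp (-u)) := hm (Real.exp_le_exp.2 (by linarith))
    have := Real.log_le_log (hpos _ (Real.exp_pos _)) this
    simp only [g]; linarith
  have hg0 : ∀ u, 0 ≤ g u := by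
    intro u
    have := Real.log_nonpos (hpos _ (Real.exp_pos (-u))).le (h1 (Real.exp (-u)))
    simp only [g]; linarith
  have hlim : Tendsto (fun u : ℝ => g u / u) atTop (𝓝 d) := by
    have a1 : Tendsto (fun u : ℝ => g (⌊u⌋₊ : ℝ) / (⌊u⌋₊ : ℝ) * ((⌊u⌋₊ : ℝ) / u)) atTop (𝓝 (d * 1)) :=
      (h.comp tendsto_nat_floor_atTop).mul (tendsto_nat_floor_div_atTop (R := ℝ))
    have a2 : Tendsto (fun u : ℝ => g (⌈u⌉₊ : ℝ) / (⌈u⌉₊ : ℝ) * ((⌈u⌉₊ : ℝ) / u)) atTop (𝓝 (d * 1)) :=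
      (h.comp tendsto_nat_ceil_atTop).mul (tendsto_nat_ceil_div_atTop (R := ℝ))
    rw [mul_one] at a1 a2
    refine tendsto_of_tendsto_of_tendsto_of_le_of_le' a1 a2 ?_ ?_
    · filter_upwards [eventually_ge_atTop 1] with u hu
      have hf : (0:ℝ) < ⌊u⌋₊ := by exact_mod_cast Nat.floor_pos.2 hu
      rw [div_mul_div_cancel₀ hf.ne']
      have := hg (Nat.floor_le (by linarith : (0:ℝ) ≤ u))
      gcongr
    · filter_upwards [eventually_ge_atTop 1] with u hu
      have hf : (0:ℝ) < ⌈u⌉₊ := by exact_mod_cast Nat.ceil_pos.2 (by linarith)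
      rw [div_mul_div_cancel₀ hf.ne']
      have := hg (Nat.le_ceil u)
      gcongr
  have hc := hlim.comp (tendsto_neg_atBot_atTop.comp Real.tendsto_log_nhdsGT_zero)
  refine hc.congr' ?_
  filter_upwards [self_mem_nhdsWithin] with r hr
  simp only [g, comp_apply, neg_neg]
  rw [Real.exp_log hr, neg_div_neg_eq]

lemma A_le_one (k : ℕ) (l : ℝ) (ω : ℕ → Bool) : A k l ω ≤ 1 := prob_le_one

lemma A_ne_top (k : ℕ) (l : ℝ) (ω : ℕ → Bool) : A k l ω ≠ ⊤ :=
  ne_top_of_le_ne_top ENNReal.one_ne_top (A_le_one k l ω)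

lemma A_ge {k n : ℕ} {l : ℝ} {ω : ℕ → Bool}
    (h : ∀ τ, (∀ i < n, τ i = ω i) → |pr l ω - pr l τ| < Real.exp (-(k:ℝ))) :
    (1/2 : ℝ) ^ n ≤ (A k l ω).toReal := by
  have h1 : (2⁻¹ : ℝ≥0∞) ^ n ≤ A k l ω := by
    rw [← P_cyl ω n]
    exact measure_mono fun τ hτ => h τ hτ
  have := ENNReal.toReal_mono (A_ne_top k l ω) h1
  simpa using this

lemma A_pos {l : ℝ} (hl : 0 ≤ l) (k : ℕ) (ω : ℕ → Bool) : 0 < (A k l ω).toReal := by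
  obtain ⟨n, hn⟩ := exists_nat_one_div_lt (Real.exp_pos (-(k:ℝ)))
  refine lt_of_lt_of_le (by positivity) (A_ge (n := n) fun τ hτ => ?_)
  exact (pr_agree hl n ω τ fun i hi => (hτ i hi).symm).trans_lt hn

lemma A_ball (k : ℕ) (l : ℝ) (ω : ℕ → Bool) :
    (P.map (pr l)) (ball (pr l ω) (Real.exp (-(k:ℝ)))) = A k l ω := by
  rw [Measure.map_apply (measurable_pr' l) measurableSet_ball]
  unfold A
  congr 1
  ext τ
  simp only [mem_preimage, mem_ball, Real.dist_eq, mem_setOf_eq]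
  rw [abs_sub_comm]

instance (l : ℝ) : IsProbabilityMeasure (P.map (pr l)) :=
  Measure.isProbabilityMeasure_map (measurable_pr' l).aemeasurable

lemma bes_aux (ν : Measure ℝ) [IsProbabilityMeasure ν] : ∀ᵐ x ∂ν, ∃ c : ℝ, 0 < c ∧
    ∀ᶠ k : ℕ in atTop, c * Real.exp (-(k:ℝ)) ≤ (ν (ball x (Real.exp (-(k:ℝ))))).toReal := by
  filter_upwards [Besicovitch.ae_tendsto_rnDeriv volume ν, Measure.rnDeriv_lt_top volume ν] with x hx hfin
  set D : ℝ := ((volume : Measure ℝ).rnDeriv ν x).toReal + 1 with hD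
  have hD0 : 0 < D := by positivity
  refine ⟨1 / D, by positivity, ?_⟩
  have hlt : (volume : Measure ℝ).rnDeriv ν x < ENNReal.ofReal D := by
    rw [← ENNReal.ofReal_toReal hfin.ne]
    exact (ENNReal.ofReal_lt_ofReal_iff hD0).2 (by linarith)
  have hev := hx.eventually (gt_mem_nhds hlt)
  have hr : Tendsto (fun k : ℕ => Real.exp (-(k:ℝ)) / 2) atTop (𝓝[>] 0) := by
    rw [tendsto_nhdsWithin_iff]
    constructor
    · have : Tendsto (fun k : ℕ => Real.exp (-(k:ℝ))) atTop (𝓝 0) :=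
        Real.tendsto_exp_neg_atTop_nhds_zero.comp tendsto_natCast_atTop_atTop
      simpa using this.div_const 2
    · exact Eventually.of_forall fun k => by simp [Real.exp_pos]
  filter_upwards [hr.eventually hev] with k hk
  have hsub : closedBall x (Real.exp (-(k:ℝ)) / 2) ⊆ ball x (Real.exp (-(k:ℝ))) :=
    closedBall_subset_ball (by linarith [Real.exp_pos (-(k:ℝ))])
  have h1 : volume (closedBall x (Real.exp (-(k:ℝ)) / 2)) ≤
      ENNReal.ofReal D * ν (closedBall x (Real.exp (-(k:ℝ)) / 2)) := by
    rcases eq_or_ne (ν (closedBall x (Real.exp (-(k:ℝ)) / 2))) 0 with h0 | h0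
    · rw [h0, ENNReal.div_zero] at hk
      · exact absurd hk (by simp)
      · rw [Real.volume_closedBall]; simp [Real.exp_pos]
    · exact (ENNReal.div_le_iff h0 (measure_ne_top _ _)).1 hk.le
  have h2 := h1.trans (mul_le_mul' le_rfl (measure_mono hsub))
  rw [Real.volume_closedBall] at h2
  have h3 := ENNReal.toReal_mono (ENNReal.mul_ne_top ENNReal.ofReal_ne_top (measure_ne_top _ _)) h2
  rw [ENNReal.toReal_mul, ENNReal.toReal_ofReal (by positivity), ENNReal.toReal_ofReal hD0.le] at h3
  rw [one_div, inv_mul_le_iff₀ hD0]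
  linarith

lemma bes (l : ℝ) : ∀ᵐ ω ∂P, ∃ c : ℝ, 0 < c ∧
    ∀ᶠ k : ℕ in atTop, c * Real.exp (-(k:ℝ)) ≤ (A k l ω).toReal := by
  have := ae_of_ae_map (measurable_pr' l).aemeasurable (bes_aux (P.map (pr l)))
  filter_upwards [this] with ω hω
  simpa only [A_ball] using hω

/-- a bound `c * exp (-b k) ≤ a k` bounds the exponent from above -/
lemma up_exp {a : ℕ → ℝ} {b c b' : ℝ} (hc : 0 < c) (hb : b < b')
    (h : ∀ᶠ k : ℕ in atTop, c * Real.exp (-(b * k)) ≤ a k) :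
    ∀ᶠ k : ℕ in atTop, -Real.log (a k) / k < b' := by
  have ht : Tendsto (fun k : ℕ => (b' - b) * (k:ℝ)) atTop atTop :=
    tendsto_natCast_atTop_atTop.const_mul_atTop (by linarith)
  filter_upwards [h, ht.eventually_gt_atTop (-Real.log c), eventually_ge_atTop 1] with k h1 h2 h3
  have hk : (0:ℝ) < k := by exact_mod_cast h3
  have := Real.log_le_log (by positivity) h1
  rw [Real.log_mul hc.ne' (Real.exp_pos _).ne', Real.log_exp] at this
  rw [div_lt_iff₀ hk]
  linarith

lemma low_exp {a : ℕ → ℝ} {b c b' : ℝ} (hc : 0 < c) (hb : b' < b) (ha : ∀ k, 0 < a k)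
    (h : ∀ k : ℕ, a k ≤ c * Real.exp (-(b * k))) :
    ∀ᶠ k : ℕ in atTop, b' < -Real.log (a k) / k := by
  have ht : Tendsto (fun k : ℕ => (b - b') * (k:ℝ)) atTop atTop :=
    tendsto_natCast_atTop_atTop.const_mul_atTop (by linarith)
  filter_upwards [ht.eventually_gt_atTop (Real.log c), eventually_ge_atTop 1] with k h2 h3
  have hk : (0:ℝ) < k := by exact_mod_cast h3
  have := Real.log_le_log (ha k) (h k)
  rw [Real.log_mul hc.ne' (Real.exp_pos _).ne', Real.log_exp] at this
  rw [lt_div_iff₀ hk]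
  linarith

lemma upper_all {l : ℝ} (hl : 0 < l) : ∀ᵐ ω ∂P, ∀ b, Real.log 2 / chi l < b →
    ∀ᶠ k : ℕ in atTop, -Real.log (A k l ω).toReal / k < b := by
  have hchi := chi_pos hl
  have hlog : 0 < Real.log 2 := Real.log_pos (by norm_num)
  have h1 : ∀ᵐ ω ∂P, ∀ γ : ℚ, (γ:ℝ) < chi l → ∀ᶠ n : ℕ in atTop, ∀ τ, (∀ i < n, τ i = ω i) →
      |pr l ω - pr l τ| < Real.exp (- (γ * n)) := by
    refine ae_all_iff.2 fun γ => ?_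
    by_cases h : (γ:ℝ) < chi l
    · filter_upwards [upper hl.le h] with ω hω _ using hω
    · exact Eventually.of_forall fun ω h' => absurd h' h
  filter_upwards [h1] with ω hω b hb
  have hb0 : 0 < b := lt_trans (by positivity) hb
  obtain ⟨γ, hγ1, hγ2⟩ := exists_rat_btwn (show Real.log 2 / b < chi l by
    rw [div_lt_iff₀ hchi] at hb
    rw [div_lt_iff₀ hb0]; linarith)
  have hγ0 : (0:ℝ) < γ := lt_trans (by positivity) hγ1
  have hγb : Real.log 2 / γ < b := by
    rw [div_lt_iff₀ hb0] at hγ1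
    rw [div_lt_iff₀ hγ0]; linarith
  refine up_exp (c := 1/2) (by norm_num) hγb ?_
  have ht : Tendsto (fun k : ℕ => ⌈(k:ℝ) / γ⌉₊) atTop atTop :=
    tendsto_nat_ceil_atTop.comp (tendsto_natCast_atTop_atTop.atTop_div_const hγ0)
  filter_upwards [ht.eventually (hω γ hγ2)] with k hk
  have hc1 : (k:ℝ) / γ ≤ (⌈(k:ℝ) / γ⌉₊ : ℝ) := Nat.le_ceil _
  have hc2 : (⌈(k:ℝ) / γ⌉₊ : ℝ) < (k:ℝ) / γ + 1 := Nat.ceil_lt_add_one (by positivity)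
  refine le_trans ?_ (A_ge (n := ⌈(k:ℝ) / γ⌉₊) fun τ hτ => (hk τ hτ).trans_le ?_)
  · have e : ∀ n : ℕ, (1/2:ℝ) ^ n = Real.exp (-(Real.log 2 * n)) := by
      intro n
      rw [Real.exp_neg, mul_comm, Real.exp_nat_mul, Real.exp_log (by norm_num)]
      simp
    have e1 := e 1
    rw [pow_one, Nat.cast_one] at e1
    rw [e, e1, ← Real.exp_add]
    apply Real.exp_le_exp.2
    have : Real.log 2 / γ * k = Real.log 2 * (k / γ) := by ring
    rw [this]
    nlinarith
  · apply Real.exp_le_exp.2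
    rw [div_le_iff₀ hγ0] at hc1
    linarith

/-- the local dimension -/
def dm (l : ℝ) : ℝ := min 1 (Real.log 2 / chi l)

lemma asym {l : ℝ} (hl : 0 < l) (hlow : ∀ s : ℚ, 0 < (s:ℝ) → (s:ℝ) < 1 →
    (s:ℝ) * chi l < Real.log 2 → ∀ᵐ ω ∂P,
      ∑' k : ℕ, ENNReal.ofReal (Real.exp ((s:ℝ) * k)) * A k l ω < ⊤) :
    ∀ᵐ ω ∂P, Tendsto (fun k : ℕ => -Real.log (A k l ω).toReal / k) atTop (𝓝 (dm l)) := by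
  have hchi := chi_pos hl
  have hlog : 0 < Real.log 2 := Real.log_pos (by norm_num)
  have hd0 : 0 < dm l := lt_min one_pos (by positivity)
  have hlow' : ∀ᵐ ω ∂P, ∀ s : ℚ, 0 < (s:ℝ) → (s:ℝ) < dm l →
      ∑' k : ℕ, ENNReal.ofReal (Real.exp ((s:ℝ) * k)) * A k l ω < ⊤ := by
    refine ae_all_iff.2 fun s => ?_
    by_cases h : 0 < (s:ℝ) ∧ (s:ℝ) < dm l
    · have h2 := h.2.trans_le (min_le_right _ _)
      rw [lt_div_iff₀ hchi] at h2
      filter_upwards [hlow s h.1 (h.2.trans_le (min_le_left _ _)) h2] with ω hω _ _ using hω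
    · exact Eventually.of_forall fun ω h1 h2 => absurd ⟨h1, h2⟩ h
  filter_upwards [hlow', upper_all hl, bes l] with ω h1 h2 h3
  rw [tendsto_order]
  constructor
  · intro a ha
    obtain ⟨s, hs1, hs2⟩ := exists_rat_btwn (max_lt ha hd0)
    have hs0 := (le_max_right _ _).trans_lt hs1
    have hsa := (le_max_left _ _).trans_lt hs1
    have hT := h1 s hs0 hs2
    refine low_exp (c := (∑' k : ℕ, ENNReal.ofReal (Real.exp ((s:ℝ) * k)) * A k l ω).toReal + 1)
      (by positivity) hsa (fun k => A_pos hl.le k ω) fun k => ?_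
    have h4 : ENNReal.ofReal (Real.exp ((s:ℝ) * k)) * A k l ω ≤
      ∑' k : ℕ, ENNReal.ofReal (Real.exp ((s:ℝ) * k)) * A k l ω := ENNReal.le_tsum k
    have h5 := ENNReal.toReal_mono hT.ne h4
    rw [ENNReal.toReal_mul, ENNReal.toReal_ofReal (Real.exp_pos _).le] at h5
    rw [Real.exp_neg, ← div_eq_mul_inv, le_div_iff₀ (Real.exp_pos _)]
    linarith
  · intro b hb
    rcases min_lt_iff.1 hb with h | h
    · obtain ⟨c, hc, hev⟩ := h3
      exact up_exp hc h (by simpa using hev)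
    · exact h2 b h

lemma dm_gt {l : ℝ} (hl : 0 < l) (hl2 : l ≤ 1/2) : 1 / 25 < dm l := by
  have h1 := chi_pos hl
  have h2 := chi_le hl.le
  refine lt_min (by norm_num) ?_
  rw [lt_div_iff₀ h1]
  linarith [Real.log_two_gt_d9]

lemma final {l : ℝ} (hl : 0 < l)
    (h : ∀ᵐ ω ∂P, Tendsto (fun k : ℕ => -Real.log (A k l ω).toReal / k) atTop (𝓝 (dm l))) :
    ∀ᵐ x ∂(P.map (pr l)),
      Tendsto (fun r : ℝ => Real.log (((P.map (pr l)) (Metric.ball x r)).toReal) / Real.log r)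
        (nhdsWithin 0 (Set.Ioi 0)) (nhds (dm l)) := by
  set ν := P.map (pr l) with hν
  have hmb : ∀ r : ℝ, Measurable fun x => (ν (ball x r)).toReal := by
    intro r
    have hs : MeasurableSet {p : ℝ × ℝ | dist p.2 p.1 < r} :=
      measurableSet_lt (measurable_snd.dist measurable_fst) measurable_const
    have : Measurable fun x => ν (Prod.mk x ⁻¹' {p : ℝ × ℝ | dist p.2 p.1 < r}) :=
      measurable_measure_prodMk_left hs
    exact this.ennreal_toReal
  have hset1 : MeasurableSet {x | Tendsto
      (fun k : ℕ => -Real.log (ν (ball x (Real.exp (-(k:ℝ))))).toReal / k) atTop (𝓝 (dm l))} :=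
    measurableSet_tendsto _ fun k => ((hmb _).log.neg).div_const _
  have hset2 : MeasurableSet {x | ∀ k : ℕ, 0 < (ν (ball x (Real.exp (-(k:ℝ))))).toReal} := by
    rw [setOf_forall]
    exact MeasurableSet.iInter fun k => measurableSet_lt measurable_const (hmb _)
  have h1 : ∀ᵐ x ∂ν, Tendsto
      (fun k : ℕ => -Real.log (ν (ball x (Real.exp (-(k:ℝ))))).toReal / k) atTop (𝓝 (dm l)) := by
    rw [hν, ae_map_iff (measurable_pr' l).aemeasurable hset1]
    simpa only [hν, A_ball] using h
  have h2 : ∀ᵐ x ∂ν, ∀ k : ℕ, 0 < (ν (ball x (Real.exp (-(k:ℝ))))).toReal := by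
    rw [hν, ae_map_iff (measurable_pr' l).aemeasurable hset2]
    refine Eventually.of_forall fun ω k => ?_
    rw [hν, A_ball]
    exact A_pos hl.le k ω
  filter_upwards [h1, h2] with x hx1 hx2
  refine seq_to_full (m := fun r => (ν (ball x r)).toReal) ?_ ?_ ?_ hx1
  · intro r r' hrr
    exact ENNReal.toReal_mono (measure_ne_top _ _) (measure_mono (ball_subset_ball hrr))
  · intro r hr
    have ht : Tendsto (fun k : ℕ => Real.exp (-(k:ℝ))) atTop (𝓝 0) :=
      Real.tendsto_exp_neg_atTop_nhds_zero.comp tendsto_natCast_atTop_atTop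
    obtain ⟨k, hk⟩ := (ht.eventually (gt_mem_nhds hr)).exists
    exact (hx2 k).trans_le
      (ENNReal.toReal_mono (measure_ne_top _ _) (measure_mono (ball_subset_ball hk.le)))
  · intro r
    have := ENNReal.toReal_mono ENNReal.one_ne_top (prob_le_one (μ := ν) (s := ball x r))
    simpa using this

end Lyo

/-- **Theorem (dimension lower bound for Lyons' random continued fractions).**
For Lebesgue-a.e. `λ ∈ [(√3−1)/2, 1/2]`, the distribution `ν_λ` of the random
continued fraction, i.e. the unique probability on `[0,1]` with
`ν_λ = ½(φ₁^λ)_*ν_λ + ½(φ₂)_*ν_λ`, has pointwise (= Hausdorff) dimension strictly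
larger than `1/25`. -/
theorem lyons_dimension_gt
    (νfam : ℝ → Measure ℝ)
    (hprob : ∀ l : ℝ, 0 < l → IsProbabilityMeasure (νfam l))
    (hsupp : ∀ l : ℝ, 0 < l → νfam l (Set.Icc (0 : ℝ) 1)ᶜ = 0)
    (hself : ∀ l : ℝ, 0 < l →
      νfam l = (2 : ℝ≥0∞)⁻¹ • (νfam l).map (φ₁ l) + (2 : ℝ≥0∞)⁻¹ • (νfam l).map φ₂) :
    ∀ᵐ l ∂(volume.restrict (Set.Icc ((Real.sqrt 3 - 1) / 2) (1 / 2 : ℝ))),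
      ∃ d : ℝ, 1 / 25 < d ∧
        ∀ᵐ x ∂(νfam l),
          Tendsto (fun r : ℝ => Real.log ((νfam l (Metric.ball x r)).toReal) / Real.log r)
            (nhdsWithin 0 (Set.Ioi 0)) (nhds d) := by
  have hsub : Set.Icc ((Real.sqrt 3 - 1) / 2) (1 / 2 : ℝ) ⊆ Set.Icc (0.366 : ℝ) (1 / 2) := by
    apply Set.Icc_subset_Icc_left
    have : (1.732 : ℝ) ≤ Real.sqrt 3 := Real.le_sqrt_of_sq_le (by norm_num)
    linarith
  have h1 := ae_restrict_of_ae_restrict_of_subset hsub Lyo.lower_all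
  filter_upwards [h1, ae_restrict_mem measurableSet_Icc] with l hl hmem
  have hl0 : 0 < l := lt_of_lt_of_le (by norm_num) (hsub hmem).1
  haveI := hprob l hl0
  have e1 : φ₁ l = Lyo.Phi l true := by
    funext x; simp [φ₁, Lyo.Phi, Lyo.par]
  have e2 : φ₂ = Lyo.Phi l false := by
    funext x; simp [φ₂, Lyo.Phi, Lyo.par]
  have hs := hself l hl0
  rw [e1, e2] at hs
  have hν := Lyo.nu_eq hl0.le (νfam l) (hsupp l hl0) hs
  refine ⟨Lyo.dm l, Lyo.dm_gt hl0 hmem.2, ?_⟩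
  rw [hν]
  exact Lyo.final hl0 (Lyo.asym hl0 hl)
end
end
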